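/- arXiv:1411.0915 — 4 statements merged into one kernel-verified Lean document; each statement's English description precedes it below -/
import Mathlib

section
/- Let d ≥ 3 and 0 < r_0 < R_0 < ∞. There is a constant C (depending on d, r_0, R_0) such that for any distinct points x_1, x_2 ∈ ℝ^d, any B > 0, and any Borel sets T_1, T_2 ⊂ [r_0, R_0] with Lebesgue measure |T_i| ≤ 2B (i = 1,2), the d-dimensional Lebesgue measure of the set {y ∈ ℝ^d : |y − x_1| ∈ T_1 and |y − x_2| ∈ T_2} is at most C B² / |x_1 − x_2|. -/
open MeasureTheory Metric

/-- Squaring increases the measure of a set of positive reals bounded by `R`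
at most by a factor `2 * R`. -/
lemma volume_image_sq_le {R : ℝ} {T : Set ℝ} (hT : MeasurableSet T) (hTR : T ⊆ Set.Ioc 0 R) :
    volume ((fun x : ℝ => x ^ 2) '' T) ≤ ENNReal.ofReal (2 * R) * volume T := by
  have hinj : Set.InjOn (fun x : ℝ => x ^ 2) T := fun x hx y hy h =>
    (pow_left_inj₀ (hTR hx).1.le (hTR hy).1.le two_ne_zero).1 h
  have h := lintegral_image_eq_lintegral_abs_deriv_mul hT (f' := fun x => 2 * x)
    (fun x _ => by simpa using (hasDerivAt_pow 2 x).hasDerivWithinAt) hinj (fun _ => 1)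
  simp only [lintegral_const, one_mul, mul_one, Measure.restrict_apply_univ] at h
  rw [h, ← setLIntegral_const]
  refine setLIntegral_mono measurable_const fun x hx => ENNReal.ofReal_le_ofReal ?_
  rw [abs_of_nonneg (by linarith [(hTR hx).1])]
  linarith [(hTR hx).2]

lemma measurableSet_image_sq {T : Set ℝ} (hT : MeasurableSet T) (hT0 : T ⊆ Set.Ioi 0) :
    MeasurableSet ((fun x : ℝ => x ^ 2) '' T) :=
  hT.image_of_continuousOn_injOn (by fun_prop) fun _ hx _ hy h =>
    (pow_left_inj₀ (hT0 hx).le (hT0 hy).le two_ne_zero).1 h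

/-- In dimension at least two, the distribution of `‖z‖ ^ 2` on a ball has bounded density. -/
lemma exists_volume_sq_norm_mem_le {n : ℕ} (hn : 2 ≤ n) {R : ℝ} (hR : 0 < R) :
    ∃ c : ℝ, 0 < c ∧ ∀ U : Set ℝ, MeasurableSet U →
      volume {z : EuclideanSpace ℝ (Fin n) | ‖z‖ ≤ R ∧ ‖z‖ ^ 2 ∈ U}
        ≤ ENNReal.ofReal c * volume U := by
  have : Nontrivial (EuclideanSpace ℝ (Fin n)) :=
    Module.nontrivial_of_finrank_pos (R := ℝ) (by simp; omega)
  set m : ℝ := volume.real (ball (0 : EuclideanSpace ℝ (Fin n)) 1) with hm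
  have hm0 : 0 < m := by
    rw [hm, Measure.real, ENNReal.toReal_pos_iff]
    exact ⟨measure_ball_pos _ _ one_pos, measure_ball_lt_top⟩
  have hn0 : (0 : ℝ) < n := by exact_mod_cast (by omega : 0 < n)
  refine ⟨n * (m * R ^ (n - 2)), by positivity, fun U hU => ?_⟩
  set s : Set ℝ := {x | x ≤ R ∧ x ^ 2 ∈ U} with hs
  have hsm : MeasurableSet s :=
    measurableSet_Iic.inter ((measurable_id.pow_const 2) hU)
  set A : Set ℝ := Set.Ioi 0 ∩ s with hA
  have hAm : MeasurableSet A := measurableSet_Ioi.inter hsm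
  have hAR : A ⊆ Set.Ioc 0 R := fun x hx => ⟨hx.1, hx.2.1⟩
  have hAfin : volume A ≠ ⊤ := ((measure_mono hAR).trans_lt (by simp)).ne
  have himg : (fun x : ℝ => x ^ 2) '' A ⊆ U := by
    rintro _ ⟨x, hx, rfl⟩
    exact hx.2.2
  have hinj : Set.InjOn (fun x : ℝ => x ^ 2) A := fun x hx y hy h =>
    (pow_left_inj₀ (hAR hx).1.le (hAR hy).1.le two_ne_zero).1 h
  have hsq := integral_image_eq_integral_abs_deriv_smul hAm (f' := fun x => 2 * x)
    (fun x _ => by simpa using (hasDerivAt_pow 2 x).hasDerivWithinAt) hinj (fun _ => (1 : ℝ))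
  have himgfin : volume ((fun x : ℝ => x ^ 2) '' A) ≠ ⊤ :=
    ((volume_image_sq_le hAm hAR).trans_lt
      (ENNReal.mul_lt_top ENNReal.ofReal_lt_top hAfin.lt_top)).ne
  have hpolar := integral_fun_norm_addHaar (volume : Measure (EuclideanSpace ℝ (Fin n)))
    (s.indicator fun _ => (1 : ℝ))
  have hset : {z : EuclideanSpace ℝ (Fin n) | ‖z‖ ≤ R ∧ ‖z‖ ^ 2 ∈ U} = norm ⁻¹' s := rfl
  have hint1 : ∫ z : EuclideanSpace ℝ (Fin n), s.indicator (fun _ => (1 : ℝ)) ‖z‖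
      = volume.real (norm ⁻¹' s : Set (EuclideanSpace ℝ (Fin n))) := by
    rw [← integral_indicator_one (measurable_norm hsm)]
    rfl
  have hint2 : ∫ y in Set.Ioi (0 : ℝ), y ^ (n - 1) • s.indicator (fun _ => (1 : ℝ)) y
      = ∫ y in A, y ^ (n - 1) := by
    rw [hA, ← setIntegral_indicator hsm]
    refine integral_congr_ae (.of_forall fun y => ?_)
    by_cases hy : y ∈ s <;> simp [hy]
  have hcont (f : ℝ → ℝ) (hf : Continuous f) : IntegrableOn f A :=
    (hf.integrableOn_Icc (a := 0) (b := R)).mono_set (hAR.trans Set.Ioc_subset_Icc_self)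
  have hle : ∫ y in A, y ^ (n - 1)
      ≤ R ^ (n - 2) * volume.real ((fun x : ℝ => x ^ 2) '' A) := by
    have h1 : volume.real ((fun x : ℝ => x ^ 2) '' A) = ∫ x in A, |2 * x| := by
      simpa using hsq
    rw [h1, ← integral_const_mul]
    refine setIntegral_mono_on (hcont _ (by fun_prop)) (hcont _ (by fun_prop)) hAm fun y hy => ?_
    have hy0 : 0 < y := (hAR hy).1
    have hyR : y ≤ R := (hAR hy).2
    rw [abs_of_pos (by positivity), show n - 1 = n - 2 + 1 by omega, pow_succ]
    gcongr
    linarith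
  rw [finrank_euclideanSpace_fin, hint1, hint2, nsmul_eq_mul, smul_eq_mul, ← hm] at hpolar
  have hfin : volume (norm ⁻¹' s : Set (EuclideanSpace ℝ (Fin n))) ≠ ⊤ := by
    refine ((measure_mono ?_).trans_lt
      (measure_closedBall_lt_top (x := (0 : EuclideanSpace ℝ (Fin n))) (r := R))).ne
    intro z hz
    simpa using hz.1
  rw [hset, ← ofReal_measureReal hfin, hpolar]
  calc ENNReal.ofReal (n * (m * ∫ y in A, y ^ (n - 1)))
      ≤ ENNReal.ofReal (n * (m * R ^ (n - 2)) * volume.real ((fun x : ℝ => x ^ 2) '' A)) := by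
        apply ENNReal.ofReal_le_ofReal
        calc _ ≤ n * (m * (R ^ (n - 2) * volume.real ((fun x : ℝ => x ^ 2) '' A))) := by gcongr
          _ = _ := by ring
    _ = ENNReal.ofReal (n * (m * R ^ (n - 2))) * volume ((fun x : ℝ => x ^ 2) '' A) := by
        rw [ENNReal.ofReal_mul (by positivity), ofReal_measureReal himgfin]
    _ ≤ _ := by gcongr

/-- Cylindrical coordinates around the line through two distinct points. -/
lemma exists_cylindrical_coordinates {n : ℕ} {x₁ x₂ : EuclideanSpace ℝ (Fin (n + 1))}
    (hx : x₁ ≠ x₂) :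
    ∃ Φ : EuclideanSpace ℝ (Fin (n + 1)) → ℝ × EuclideanSpace ℝ (Fin n),
      MeasurePreserving Φ ∧ ∀ y,
        dist y x₁ ^ 2 = (Φ y).1 ^ 2 + ‖(Φ y).2‖ ^ 2 ∧
        dist y x₂ ^ 2 = ((Φ y).1 - dist x₁ x₂) ^ 2 + ‖(Φ y).2‖ ^ 2 := by
  set a := dist x₁ x₂ with ha
  have ha0 : 0 < a := dist_pos.2 hx
  set e : EuclideanSpace ℝ (Fin (n + 1)) := a⁻¹ • (x₂ - x₁) with he
  have he1 : ‖e‖ = 1 := by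
    rw [he, norm_smul, ← dist_eq_norm, dist_comm, ← ha, norm_inv, Real.norm_of_nonneg ha0.le,
      inv_mul_cancel₀ ha0.ne']
  obtain ⟨b, hb⟩ := Orthonormal.exists_orthonormalBasis_extension_of_card_eq (𝕜 := ℝ)
    (E := EuclideanSpace ℝ (Fin (n + 1))) (ι := Fin (n + 1)) (by simp)
    (v := fun _ => e) (s := {0}) (by
      refine ⟨fun i => by simpa using he1, fun i j hij => (hij (Subsingleton.elim i j)).elim⟩)
  have hb0 : b 0 = e := hb 0 rfl
  have hx₂ : x₂ - x₁ = a • b 0 := by rw [hb0, he, smul_inv_smul₀ ha0.ne']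
  have hsq (w : EuclideanSpace ℝ (Fin (n + 1))) :
      ‖w‖ ^ 2 = b.repr w 0 ^ 2 + ∑ i : Fin n, b.repr w i.succ ^ 2 := by
    rw [← b.repr.norm_map w, EuclideanSpace.norm_sq_eq, Fin.sum_univ_succ]
    simp only [Real.norm_eq_abs, sq_abs]
  refine ⟨fun y => (b.repr (y - x₁) 0, WithLp.toLp 2 fun i => b.repr (y - x₁) i.succ), ?_, ?_⟩
  · have h1 := ((PiLp.volume_preserving_ofLp (Fin (n + 1))).comp
      (b.measurePreserving_repr.comp (measurePreserving_sub_right volume x₁)))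
    have h2 := (volume_preserving_piFinSuccAbove (fun _ : Fin (n + 1) => ℝ) 0).comp h1
    have h3 := ((MeasurePreserving.id (volume : Measure ℝ)).prod
      (PiLp.volume_preserving_toLp (Fin n))).comp h2
    exact h3
  · intro y
    have hz : ‖WithLp.toLp 2 fun i : Fin n => b.repr (y - x₁) i.succ‖ ^ 2
        = ∑ i : Fin n, b.repr (y - x₁) i.succ ^ 2 := by
      rw [EuclideanSpace.norm_sq_eq]
      simp only [Real.norm_eq_abs, sq_abs]
    refine ⟨by rw [dist_eq_norm, hsq, hz], ?_⟩
    have h2 : y - x₂ = (y - x₁) - a • b 0 := by rw [← hx₂]; abel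
    rw [dist_eq_norm, hsq, hz, h2]
    simp

/-- The area of the region cut out by a vertical strip over `S₁` and a slanted one over `S₂`. -/
lemma volume_strip_inter {a : ℝ} (ha : 0 < a) {S₁ S₂ : Set ℝ} (hS₁ : MeasurableSet S₁)
    (hS₂ : MeasurableSet S₂) :
    volume {p : ℝ × ℝ | p.2 ∈ S₁ ∧ -2 * a * p.1 + (p.2 + a ^ 2) ∈ S₂}
      = ENNReal.ofReal (1 / (2 * a)) * volume S₂ * volume S₁ := by
  have hm : MeasurableSet {p : ℝ × ℝ | p.2 ∈ S₁ ∧ -2 * a * p.1 + (p.2 + a ^ 2) ∈ S₂} :=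
    (measurable_snd hS₁).inter
      ((by fun_prop : Measurable fun p : ℝ × ℝ => -2 * a * p.1 + (p.2 + a ^ 2)) hS₂)
  rw [Measure.volume_eq_prod, Measure.prod_apply_symm hm, ← setLIntegral_const,
    ← lintegral_indicator hS₁]
  refine lintegral_congr fun v => ?_
  by_cases hv : v ∈ S₁
  · have h : (fun t : ℝ => (t, v)) ⁻¹' {p : ℝ × ℝ | p.2 ∈ S₁ ∧ -2 * a * p.1 + (p.2 + a ^ 2) ∈ S₂}
        = (-2 * a * ·) ⁻¹' ((· + (v + a ^ 2)) ⁻¹' S₂) := by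
      ext t
      simp [hv]
    rw [h, Real.volume_preimage_mul_left (by nlinarith), measure_preimage_add_right,
      Set.indicator_of_mem hv]
    congr 2
    rw [abs_inv, abs_of_neg (by linarith), one_div]
    congr 1
    ring
  · simp [hv]

/-- The higher-dimensional intersection estimate: for `d ≥ 3`, distinct `x_1, x_2 ∈ ℝ^d`
and Borel sets `T_1, T_2 ⊂ [r_0, R_0]` of measure at most `2B`,
`|{y : |y - x_1| ∈ T_1, |y - x_2| ∈ T_2}| ≤ C B² / |x_1 - x_2|`. -/
theorem stmt_12 (d : ℕ) (hd : 3 ≤ d) (r0 R0 : ℝ) (hr0 : 0 < r0) (hR0 : r0 < R0) :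
    ∃ C > 0, ∀ x₁ x₂ : EuclideanSpace ℝ (Fin d), x₁ ≠ x₂ →
      ∀ B : ℝ, 0 < B → ∀ T₁ T₂ : Set ℝ, MeasurableSet T₁ → MeasurableSet T₂ →
        T₁ ⊆ Set.Icc r0 R0 → T₂ ⊆ Set.Icc r0 R0 →
        volume T₁ ≤ ENNReal.ofReal (2 * B) → volume T₂ ≤ ENNReal.ofReal (2 * B) →
        volume {y : EuclideanSpace ℝ (Fin d) | dist y x₁ ∈ T₁ ∧ dist y x₂ ∈ T₂}
          ≤ ENNReal.ofReal (C * B ^ 2 / dist x₁ x₂) := by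
  obtain ⟨n, rfl⟩ : ∃ n, d = n + 1 := ⟨d - 1, by omega⟩
  have hRpos : 0 < R0 := hr0.trans hR0
  obtain ⟨c, hc, hcU⟩ := exists_volume_sq_norm_mem_le (n := n) (by omega) hRpos
  refine ⟨8 * c * R0 ^ 2, by positivity, ?_⟩
  intro x₁ x₂ hx B hB T₁ T₂ hT₁ hT₂ hT₁R hT₂R hT₁B hT₂B
  obtain ⟨Φ, hΦ, hdist⟩ := exists_cylindrical_coordinates hx
  set a := dist x₁ x₂ with ha
  have ha0 : 0 < a := dist_pos.2 hx
  have hIoc : Set.Icc r0 R0 ⊆ Set.Ioc 0 R0 := fun x hx => ⟨hr0.trans_le hx.1, hx.2⟩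
  set S₁ : Set ℝ := (fun x : ℝ => x ^ 2) '' T₁ with hS₁
  set S₂ : Set ℝ := (fun x : ℝ => x ^ 2) '' T₂ with hS₂
  have hS₁m : MeasurableSet S₁ := measurableSet_image_sq hT₁ fun x hx => (hIoc (hT₁R hx)).1
  have hS₂m : MeasurableSet S₂ := measurableSet_image_sq hT₂ fun x hx => (hIoc (hT₂R hx)).1
  have hS₁B : volume S₁ ≤ ENNReal.ofReal (2 * R0) * ENNReal.ofReal (2 * B) :=
    (volume_image_sq_le hT₁ (hT₁R.trans hIoc)).trans (by gcongr)
  have hS₂B : volume S₂ ≤ ENNReal.ofReal (2 * R0) * ENNReal.ofReal (2 * B) :=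
    (volume_image_sq_le hT₂ (hT₂R.trans hIoc)).trans (by gcongr)
  set P : Set (ℝ × EuclideanSpace ℝ (Fin n)) :=
    {p | p.1 ^ 2 + ‖p.2‖ ^ 2 ∈ S₁ ∧ (p.1 - a) ^ 2 + ‖p.2‖ ^ 2 ∈ S₂ ∧ ‖p.2‖ ≤ R0} with hP
  have hPm : MeasurableSet P :=
    ((by fun_prop : Measurable fun p : ℝ × EuclideanSpace ℝ (Fin n) =>
      p.1 ^ 2 + ‖p.2‖ ^ 2) hS₁m).inter
    (((by fun_prop : Measurable fun p : ℝ × EuclideanSpace ℝ (Fin n) =>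
      (p.1 - a) ^ 2 + ‖p.2‖ ^ 2) hS₂m).inter
    (measurableSet_le measurable_snd.norm measurable_const))
  have hsub : {y | dist y x₁ ∈ T₁ ∧ dist y x₂ ∈ T₂} ⊆ Φ ⁻¹' P := by
    rintro y ⟨h1, h2⟩
    refine ⟨(hdist y).1 ▸ ⟨_, h1, rfl⟩, (hdist y).2 ▸ ⟨_, h2, rfl⟩, ?_⟩
    refine le_trans ?_ (hT₁R h1).2
    rw [← pow_le_pow_iff_left₀ (norm_nonneg _) dist_nonneg two_ne_zero, (hdist y).1]
    linarith [sq_nonneg (Φ y).1]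
  set Q : Set (ℝ × ℝ) := {p | p.2 ∈ S₁ ∧ -2 * a * p.1 + (p.2 + a ^ 2) ∈ S₂} with hQ
  have hQm : MeasurableSet Q := (measurable_snd hS₁m).inter
    ((by fun_prop : Measurable fun p : ℝ × ℝ => -2 * a * p.1 + (p.2 + a ^ 2)) hS₂m)
  have hslice (t : ℝ) :
      volume (Prod.mk t ⁻¹' P) ≤ ENNReal.ofReal c * volume (Prod.mk t ⁻¹' Q) := by
    have hQt : MeasurableSet (Prod.mk t ⁻¹' Q) := measurable_prodMk_left hQm
    rw [← measure_preimage_add volume (t ^ 2) (Prod.mk t ⁻¹' Q)]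
    refine (measure_mono ?_).trans (hcU _ (measurable_const_add _ hQt))
    rintro z ⟨h1, h2, h3⟩
    refine ⟨h3, h1, ?_⟩
    convert h2 using 1
    simp only
    ring
  calc volume {y | dist y x₁ ∈ T₁ ∧ dist y x₂ ∈ T₂}
      ≤ volume (Φ ⁻¹' P) := measure_mono hsub
    _ = volume P := hΦ.measure_preimage hPm.nullMeasurableSet
    _ = ∫⁻ t, volume (Prod.mk t ⁻¹' P) := by
        rw [Measure.volume_eq_prod, Measure.prod_apply hPm]
    _ ≤ ∫⁻ t, ENNReal.ofReal c * volume (Prod.mk t ⁻¹' Q) := lintegral_mono hslice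
    _ = ENNReal.ofReal c * volume Q := by
        rw [lintegral_const_mul' _ _ ENNReal.ofReal_ne_top, Measure.volume_eq_prod,
          Measure.prod_apply hQm]
    _ ≤ ENNReal.ofReal c * (ENNReal.ofReal (1 / (2 * a)) *
          (ENNReal.ofReal (2 * R0) * ENNReal.ofReal (2 * B)) *
          (ENNReal.ofReal (2 * R0) * ENNReal.ofReal (2 * B))) := by
        rw [hQ, volume_strip_inter ha0 hS₁m hS₂m]
        gcongr
    _ = ENNReal.ofReal (8 * c * R0 ^ 2 * B ^ 2 / a) := by
        rw [← ENNReal.ofReal_mul (by positivity), ← ENNReal.ofReal_mul (by positivity),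
          ← ENNReal.ofReal_mul (by positivity), ← ENNReal.ofReal_mul (by positivity)]
        congr 1
        field_simp
        ring
end

section
/- For every η > 0 there is a constant C(η) such that for every B > 0 and all Borel sets T_1, T_2 ⊂ (η, ∞) with Lebesgue measure B ≤ |T_i| ≤ 2B (i = 1,2): ∫_{T_1} ∫_{T_2} |(r_2 − |r_1 − 1|)(r_2 − |r_1 + 1|)|^{−1/2} dr_2 dr_1 ≤ C(η) B^{3/2}. -/
open MeasureTheory Metric

open scoped ENNReal

theorem setLIntegral_Icc_rpow_neg_half {B : ℝ} (hB : 0 < B) :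
    ∫⁻ x in Set.Icc 0 B, ENNReal.ofReal x ^ (-(1 : ℝ) / 2)
      = ENNReal.ofReal (2 * B ^ ((1 : ℝ) / 2)) := by
  have hint : IntervalIntegrable (fun x : ℝ => x ^ (-(1 : ℝ) / 2)) volume 0 B :=
    intervalIntegral.intervalIntegrable_rpow' (by norm_num)
  rw [setLIntegral_congr (Ioc_ae_eq_Icc (μ := volume) (a := (0 : ℝ)) (b := B)).symm,
    setLIntegral_congr_fun (g := fun x => ENNReal.ofReal (x ^ (-(1 : ℝ) / 2)))
      measurableSet_Ioc fun x hx => ENNReal.ofReal_rpow_of_pos hx.1,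
    ← ofReal_integral_eq_lintegral_ofReal
      ((intervalIntegrable_iff_integrableOn_Ioc_of_le hB.le).1 hint)
      ((ae_restrict_iff' measurableSet_Ioc).2 <| .of_forall fun x hx =>
        Real.rpow_nonneg hx.1.le _),
    ← intervalIntegral.integral_of_le hB.le, integral_rpow (Or.inl (by norm_num))]
  congr 1
  norm_num
  ring

/-- A set of measure at most `2 * B` captures at most `6 * √B` of the mass of
`|x - a| ^ (-1 / 2)`. -/
theorem setLIntegral_abs_sub_rpow_neg_half_le {B : ℝ} (hB : 0 < B) (a : ℝ) {T : Set ℝ}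
    (hT : volume T ≤ ENNReal.ofReal (2 * B)) :
    ∫⁻ x in T, ENNReal.ofReal |x - a| ^ (-(1 : ℝ) / 2)
      ≤ ENNReal.ofReal (6 * B ^ ((1 : ℝ) / 2)) := by
  set h : ℝ → ℝ≥0∞ :=
    (Set.Icc 0 B).indicator fun x => ENNReal.ofReal x ^ (-(1 : ℝ) / 2) with hh
  have hm : Measurable h :=
    (ENNReal.measurable_ofReal.pow_const _).indicator measurableSet_Icc
  have hI : ∫⁻ x, h x = ENNReal.ofReal (2 * B ^ ((1 : ℝ) / 2)) := by
    rw [hh, lintegral_indicator measurableSet_Icc, setLIntegral_Icc_rpow_neg_half hB]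
  have hpt (x : ℝ) : ENNReal.ofReal |x - a| ^ (-(1 : ℝ) / 2)
      ≤ h (x - a) + h (a - x) + ENNReal.ofReal (B ^ (-(1 : ℝ) / 2)) := by
    rcases le_or_gt |x - a| B with hx | hx
    · refine le_trans ?_ le_self_add
      rcases le_total 0 (x - a) with h0 | h0
      · rw [abs_of_nonneg h0] at hx ⊢
        refine le_trans ?_ le_self_add
        rw [hh, Set.indicator_of_mem (Set.mem_Icc.2 ⟨h0, hx⟩)]
      · rw [abs_of_nonpos h0, neg_sub] at hx ⊢
        refine le_trans ?_ le_add_self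
        rw [hh, Set.indicator_of_mem (Set.mem_Icc.2 ⟨by linarith, hx⟩)]
    · refine le_trans ?_ le_add_self
      rw [ENNReal.ofReal_rpow_of_pos (hB.trans hx)]
      exact ENNReal.ofReal_le_ofReal
        (Real.rpow_le_rpow_of_nonpos hB hx.le (by norm_num))
  have h1 : Measurable fun x => h (x - a) := hm.comp (measurable_id.sub_const a)
  have h2 : Measurable fun x => h (a - x) := hm.comp (measurable_id.const_sub a)
  have hp : B ^ (-(1 : ℝ) / 2) * (2 * B) = 2 * B ^ ((1 : ℝ) / 2) := by
    have : B ^ (-(1 : ℝ) / 2) * B = B ^ ((1 : ℝ) / 2) := by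
      rw [← Real.rpow_add_one hB.ne']
      norm_num
    linarith
  have hpos : 0 ≤ B ^ ((1 : ℝ) / 2) := Real.rpow_nonneg hB.le _
  calc ∫⁻ x in T, ENNReal.ofReal |x - a| ^ (-(1 : ℝ) / 2)
      ≤ ∫⁻ x in T, (h (x - a) + h (a - x) + ENNReal.ofReal (B ^ (-(1 : ℝ) / 2))) :=
        lintegral_mono hpt
    _ = (∫⁻ x in T, h (x - a)) + (∫⁻ x in T, h (a - x))
          + ENNReal.ofReal (B ^ (-(1 : ℝ) / 2)) * volume T := by
        rw [lintegral_add_right _ measurable_const, lintegral_add_right _ h2,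
          setLIntegral_const]
    _ ≤ (∫⁻ x, h (x - a)) + (∫⁻ x, h (a - x))
          + ENNReal.ofReal (B ^ (-(1 : ℝ) / 2)) * ENNReal.ofReal (2 * B) := by
        gcongr <;> exact Measure.restrict_le_self
    _ = ENNReal.ofReal (6 * B ^ ((1 : ℝ) / 2)) := by
        rw [lintegral_sub_right_eq_self, lintegral_sub_left_eq_self h, hI,
          ← ENNReal.ofReal_mul (Real.rpow_nonneg hB.le _), hp,
          ← ENNReal.ofReal_add (by positivity) (by positivity),
          ← ENNReal.ofReal_add (by positivity) (by positivity)]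
        congr 1
        ring

theorem ofReal_abs_mul_rpow_neg_half_le {m u v : ℝ} (hm : 0 < m) (huv : 2 * m ≤ u - v) :
    ENNReal.ofReal |u * v| ^ (-(1 : ℝ) / 2)
      ≤ ENNReal.ofReal (m ^ (-(1 : ℝ) / 2)) *
        (ENNReal.ofReal |u| ^ (-(1 : ℝ) / 2) + ENNReal.ofReal |v| ^ (-(1 : ℝ) / 2)) := by
  have key {s t : ℝ} (hs : m ≤ |s|) : ENNReal.ofReal |s * t| ^ (-(1 : ℝ) / 2)
      ≤ ENNReal.ofReal (m ^ (-(1 : ℝ) / 2)) * ENNReal.ofReal |t| ^ (-(1 : ℝ) / 2) := by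
    rw [abs_mul, ENNReal.ofReal_mul (abs_nonneg _),
      ENNReal.mul_rpow_of_ne_top ENNReal.ofReal_ne_top ENNReal.ofReal_ne_top,
      ENNReal.ofReal_rpow_of_pos (hm.trans_le hs)]
    gcongr ENNReal.ofReal ?_ * _
    exact Real.rpow_le_rpow_of_nonpos hm hs (by norm_num)
  rcases le_or_gt m |u| with hu | hu
  · exact (key hu).trans (mul_le_mul_right le_add_self _)
  · have hv : m ≤ |v| := by
      have := (abs_lt.1 hu).2
      exact le_trans (by linarith) (neg_le_abs v)
    rw [mul_comm u v]
    exact (key hv).trans (mul_le_mul_right le_self_add _)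

/-- The elementary integral estimate: for every `η > 0` there is `C(η)` such that for
all `B > 0` and Borel sets `T_1, T_2 ⊂ (η, ∞)` with `B ≤ |T_i| ≤ 2B`,
`∫_{T_1} ∫_{T_2} |(r_2 - |r_1 - 1|)(r_2 - |r_1 + 1|)|^{-1/2} dr_2 dr_1 ≤ C(η) B^{3/2}`. -/
theorem stmt_13 (η : ℝ) (hη : 0 < η) :
    ∃ C > 0, ∀ B : ℝ, 0 < B → ∀ T₁ T₂ : Set ℝ, MeasurableSet T₁ → MeasurableSet T₂ →
      T₁ ⊆ Set.Ioi η → T₂ ⊆ Set.Ioi η →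
      ENNReal.ofReal B ≤ volume T₁ → volume T₁ ≤ ENNReal.ofReal (2 * B) →
      ENNReal.ofReal B ≤ volume T₂ → volume T₂ ≤ ENNReal.ofReal (2 * B) →
      (∫⁻ r₁ in T₁, ∫⁻ r₂ in T₂,
          ENNReal.ofReal |(r₂ - |r₁ - 1|) * (r₂ - |r₁ + 1|)| ^ (-(1 : ℝ) / 2))
        ≤ ENNReal.ofReal (C * B ^ ((3 : ℝ) / 2)) := by
  set m := min η 1 with hmdef
  have hm : 0 < m := lt_min hη one_pos
  have hK : 0 < m ^ (-(1 : ℝ) / 2) := Real.rpow_pos_of_pos hm _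
  refine ⟨24 * m ^ (-(1 : ℝ) / 2), by positivity, ?_⟩
  intro B hB T₁ T₂ hT₁ _ hs₁ _ _ hu₁ _ hu₂
  have hgap (r : ℝ) (hr : r ∈ T₁) (x : ℝ) :
      2 * m ≤ (x - |r - 1|) - (x - |r + 1|) := by
    have hr' : η < r := hs₁ hr
    have h1 : m ≤ η := min_le_left _ _
    have h2 : m ≤ 1 := min_le_right _ _
    rw [abs_of_pos (by linarith : 0 < r + 1)]
    rcases abs_cases (r - 1) with h | h <;> linarith
  have hmeas (a : ℝ) : Measurable fun x : ℝ => ENNReal.ofReal |x - a| ^ (-(1 : ℝ) / 2) := by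
    fun_prop
  have hinner (r : ℝ) (hr : r ∈ T₁) :
      (∫⁻ r₂ in T₂, ENNReal.ofReal |(r₂ - |r - 1|) * (r₂ - |r + 1|)| ^ (-(1 : ℝ) / 2))
        ≤ ENNReal.ofReal (m ^ (-(1 : ℝ) / 2) * (12 * B ^ ((1 : ℝ) / 2))) := by
    refine (lintegral_mono fun x => ofReal_abs_mul_rpow_neg_half_le hm (hgap r hr x)).trans ?_
    rw [lintegral_const_mul' _ _ ENNReal.ofReal_ne_top, lintegral_add_right _ (hmeas _),
      ENNReal.ofReal_mul hK.le]
    gcongr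
    refine (add_le_add (setLIntegral_abs_sub_rpow_neg_half_le hB _ hu₂)
      (setLIntegral_abs_sub_rpow_neg_half_le hB _ hu₂)).trans ?_
    rw [← ENNReal.ofReal_add (by positivity) (by positivity)]
    exact ENNReal.ofReal_le_ofReal (by linarith)
  have hp : B ^ ((3 : ℝ) / 2) = B ^ ((1 : ℝ) / 2) * B := by
    rw [← Real.rpow_add_one hB.ne']
    norm_num
  refine (setLIntegral_mono' hT₁ hinner).trans ?_
  rw [setLIntegral_const]
  refine (mul_le_mul_right hu₁ _).trans ?_
  rw [← ENNReal.ofReal_mul (by positivity), hp]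
  exact ENNReal.ofReal_le_ofReal (by linarith)
end

section
/- Let d ≥ 3, let 0 < α < α' < 1, 0 < r_0 < R_0 < ∞, and let λ be a compactly supported Borel probability measure on ℝ^d with λ(B(x,δ)) ≤ C δ^{α'} for all x ∈ ℝ^d and δ > 0. There is a constant C' (depending on d, α, α', C, r_0, R_0, and the diameter of the support of λ) such that the following holds: if E ⊂ ℝ^d is a Borel set, μ > 0, B > 0, A ⊂ ℝ^d is a Borel set, and for each x ∈ A there is a Borel set T_x ⊂ [r_0, R_0] with B ≤ |T_x| ≤ 2B such that S1_E(x,r) ≥ μ for all x ∈ A and r ∈ T_x, then μ^{1+α} B^{1−α} λ(A) ≤ C' |E|, where |E| is the Lebesgue measure of E. -/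
open MeasureTheory Metric

/-- The spherical average `Sf(x,r) = ∫_{S^{d-1}} f(x - rσ) dσ`, where the surface
measure on the unit sphere is realized as `(d-1)`-dimensional Hausdorff measure. -/
noncomputable def sphAvg {d : ℕ} (f : EuclideanSpace ℝ (Fin d) → ℝ)
    (x : EuclideanSpace ℝ (Fin d)) (r : ℝ) : ℝ :=
  ∫ σ in Metric.sphere (0 : EuclideanSpace ℝ (Fin d)) 1, f (x - r • σ) ∂(μH[(d : ℝ) - 1])

open Filter Topology ENNReal in
/-- A finite measure whose balls of small radius `r` have mass at least `c * r ^ s` dominates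
`s`-dimensional Hausdorff measure. -/
theorem hausdorffMeasure_le_mul_of_le_closedBall {X : Type*} [MetricSpace X]
    [SecondCountableTopology X] [MeasurableSpace X] [BorelSpace X] (σ : Measure X)
    [IsFiniteMeasure σ] {s : ℝ} (hs : 0 ≤ s) {K : ℝ≥0∞} (hK : K ≠ ⊤)
    (h : ∀ (x : X) (r : ℝ), 0 < r → r ≤ 1 →
      ENNReal.ofReal r ^ s ≤ K * σ (closedBall x r)) (G : Set X) :
    μH[s] G ≤ 10 ^ s * K * σ G := by
  have main : ∀ V : Set X, IsOpen V → G ⊆ V → μH[s] G ≤ 10 ^ s * K * σ V := by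
    intro V hV hGV
    have hu : ∀ n : ℕ, ∃ u : Set (X × ℝ), u.Countable ∧
        (∀ p ∈ u, 0 < p.2 ∧ p.2 ≤ 1 / ((n : ℝ) + 1) ∧ closedBall p.1 p.2 ⊆ V) ∧
        u.PairwiseDisjoint (fun p => closedBall p.1 p.2) ∧
        G ⊆ ⋃ p : u, closedBall p.1.1 (5 * p.1.2) := by
      intro n
      have hn : (0 : ℝ) < 1 / ((n : ℝ) + 1) := by positivity
      obtain ⟨u, hut, hd, hc⟩ := Vitali.exists_disjoint_subfamily_covering_enlargement_closedBall
        {p : X × ℝ | 0 < p.2 ∧ p.2 ≤ 1 / ((n : ℝ) + 1) ∧ closedBall p.1 p.2 ⊆ V}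
        Prod.fst Prod.snd (1 / ((n : ℝ) + 1)) (fun a ha => ha.2.1) 5 (by norm_num)
      refine ⟨u, ?_, fun p hp => hut hp, hd, ?_⟩
      · refine hd.countable_of_nonempty_interior fun p hp => ?_
        exact ⟨p.1, ball_subset_interior_closedBall (mem_ball_self (hut hp).1)⟩
      · intro x hx
        obtain ⟨r, hr, hrV⟩ := Metric.isOpen_iff.1 hV x (hGV hx)
        obtain ⟨b, hb, hsub⟩ := hc (x, min (r / 2) (1 / ((n : ℝ) + 1)))
          ⟨by simp only [lt_inf_iff]; constructor <;> positivity, min_le_right _ _,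
            (closedBall_subset_ball ((min_le_left _ _).trans_lt (by linarith))).trans hrV⟩
        refine Set.mem_iUnion.2 ⟨⟨b, hb⟩, hsub (mem_closedBall_self ?_)⟩
        simp only [le_inf_iff]; constructor <;> positivity
    choose u hcount hu hdisj hcov using hu
    have (n : ℕ) : Countable (u n) := (hcount n).to_subtype
    refine (Measure.hausdorffMeasure_le_liminf_tsum (l := atTop) s G
      (fun n : ℕ => ENNReal.ofReal (10 * (1 / ((n : ℝ) + 1)))) ?_
      (fun n (p : u n) => closedBall p.1.1 (5 * p.1.2)) ?_ (.of_forall hcov)).trans ?_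
    · have := (tendsto_one_div_add_atTop_nhds_zero_nat (𝕜 := ℝ)).const_mul 10
      simpa using ENNReal.tendsto_ofReal this
    · refine .of_forall fun n p => ediam_le fun y hy z hz => ?_
      rw [edist_dist]
      refine ENNReal.ofReal_le_ofReal ?_
      have := (hu n p p.2).2.1
      have := dist_triangle_right y z p.1.1
      have := mem_closedBall.1 hy
      have := mem_closedBall.1 hz
      linarith
    · have hb (n : ℕ) : ∑' p : u n, ediam (closedBall p.1.1 (5 * p.1.2)) ^ s
          ≤ 10 ^ s * K * σ V := by
        calc ∑' p : u n, ediam (closedBall p.1.1 (5 * p.1.2)) ^ s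
            ≤ ∑' p : u n, 10 ^ s * K * σ (closedBall p.1.1 p.1.2) := by
              refine ENNReal.tsum_le_tsum fun p => ?_
              have hp := hu n p p.2
              have h1 : ediam (closedBall p.1.1 (5 * p.1.2)) ≤ 10 * ENNReal.ofReal p.1.2 := by
                rw [show (10 : ℝ≥0∞) = ENNReal.ofReal 10 by simp,
                  ← ENNReal.ofReal_mul (by norm_num)]
                refine ediam_le fun y hy z hz => ?_
                rw [edist_dist]
                refine ENNReal.ofReal_le_ofReal ?_
                have := dist_triangle_right y z p.1.1
                have := mem_closedBall.1 hy
                have := mem_closedBall.1 hz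
                linarith
              calc _ ≤ (10 * ENNReal.ofReal p.1.2) ^ s := ENNReal.rpow_le_rpow h1 hs
                _ = 10 ^ s * ENNReal.ofReal p.1.2 ^ s := ENNReal.mul_rpow_of_nonneg _ _ hs
                _ ≤ 10 ^ s * (K * σ (closedBall p.1.1 p.1.2)) := by
                  gcongr
                  refine h _ _ hp.1 (hp.2.1.trans ?_)
                  rw [div_le_one (by positivity)]
                  linarith [(Nat.cast_nonneg n : (0 : ℝ) ≤ n)]
                _ = _ := by ring
          _ = 10 ^ s * K * σ (⋃ p : u n, closedBall p.1.1 p.1.2) := by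
              rw [ENNReal.tsum_mul_left, measure_iUnion _ fun p => measurableSet_closedBall]
              exact fun p q hpq => hdisj n p.2 q.2 (fun h => hpq (Subtype.ext h))
          _ ≤ _ := by
              gcongr
              exact Set.iUnion_subset fun p => (hu n p p.2).2.2
      exact (liminf_le_liminf (.of_forall hb)).trans (by simp)
  have hK' : (10 : ℝ≥0∞) ^ s * K ≠ ⊤ :=
    ENNReal.mul_ne_top (ENNReal.rpow_ne_top_of_nonneg hs (by simp)) hK
  have hlim : Tendsto (fun ε : ℝ≥0∞ => 10 ^ s * K * (σ G + ε)) (𝓝[>] 0)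
      (𝓝 (10 ^ s * K * (σ G + 0))) := by
    refine (ENNReal.Tendsto.const_mul ?_ (.inr hK')).mono_left nhdsWithin_le_nhds
    exact tendsto_const_nhds.add tendsto_id
  rw [add_zero] at hlim
  refine ge_of_tendsto hlim ?_
  filter_upwards [self_mem_nhdsWithin] with ε hε
  obtain ⟨V, hGV, hV, hle⟩ := G.exists_isOpen_le_add σ (ne_of_gt hε)
  exact (main V hV hGV).trans (by gcongr)

open scoped ENNReal

/-- Integration in polar coordinates. -/
theorem lintegral_eq_lintegral_Ioi_toSphere {E : Type*} [NormedAddCommGroup E] [NormedSpace ℝ E]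
    [Nontrivial E] [FiniteDimensional ℝ E] [MeasurableSpace E] [BorelSpace E] (ν : Measure E)
    [ν.IsAddHaarMeasure] {f : E → ℝ≥0∞} (hf : Measurable f) :
    ∫⁻ y, f y ∂ν = ∫⁻ r in Set.Ioi (0 : ℝ), ENNReal.ofReal (r ^ (Module.finrank ℝ E - 1)) *
      ∫⁻ ω : sphere (0 : E) 1, f (r • (ω : E)) ∂ν.toSphere := by
  have hm : Measurable fun p : sphere (0 : E) 1 × Set.Ioi (0 : ℝ) => f ((p.2 : ℝ) • (p.1 : E)) :=
    hf.comp (by fun_prop)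
  calc ∫⁻ y, f y ∂ν = ∫⁻ y : ({0}ᶜ : Set E), f y ∂(ν.comap (↑)) := by
        rw [lintegral_subtype_comap (measurableSet_singleton _).compl f,
          restrict_compl_singleton]
    _ = ∫⁻ p, f ((p.2 : ℝ) • (p.1 : E))
          ∂ν.toSphere.prod (.volumeIoiPow (Module.finrank ℝ E - 1)) := by
        rw [← ν.measurePreserving_homeomorphUnitSphereProd.lintegral_comp hm]
        refine lintegral_congr fun y => ?_
        have := congrArg Subtype.val ((homeomorphUnitSphereProd E).symm_apply_apply y)
        simp only [homeomorphUnitSphereProd_symm_apply_coe] at this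
        rw [this]
    _ = ∫⁻ r : Set.Ioi (0 : ℝ), ∫⁻ ω : sphere (0 : E) 1, f ((r : ℝ) • (ω : E)) ∂ν.toSphere
          ∂(.volumeIoiPow (Module.finrank ℝ E - 1)) := lintegral_prod_symm' _ hm
    _ = _ := by
        rw [Measure.volumeIoiPow, lintegral_withDensity_eq_lintegral_mul₀ (by fun_prop)
          hm.lintegral_prod_left'.aemeasurable]
        exact lintegral_subtype_comap measurableSet_Ioi (fun r : ℝ =>
          ENNReal.ofReal (r ^ (Module.finrank ℝ E - 1)) *
            ∫⁻ ω : sphere (0 : E) 1, f (r • (ω : E)) ∂ν.toSphere)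

open scoped Pointwise in
/-- A ball of radius `r` around a unit vector generates a cone that contains the balls of
radius `r / 8` around the points `s • x`, `1 / 2 ≤ s ≤ 3 / 4`. -/
theorem ball_smul_subset_cone {E : Type*} [NormedAddCommGroup E] [NormedSpace ℝ E]
    {x : E} (hx : ‖x‖ = 1) {r s : ℝ} (hr1 : r ≤ 1) (hs : s ∈ Set.Icc (1 / 2 : ℝ) (3 / 4)) :
    ball (s • x) (r / 8) ⊆ Set.Ioo (0 : ℝ) 1 • (closedBall x r ∩ sphere (0 : E) 1) := by
  intro y hy
  rw [mem_ball, dist_eq_norm] at hy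
  obtain ⟨h1, h2⟩ := hs
  have hsx : ‖s • x‖ = s := by rw [norm_smul, hx, mul_one, Real.norm_of_nonneg (by linarith)]
  have hys : |‖y‖ - s| < r / 8 := by
    rw [← hsx]; exact (abs_norm_sub_norm_le y (s • x)).trans_lt hy
  rw [abs_lt] at hys
  have hy0 : 0 < ‖y‖ := by linarith
  refine ⟨‖y‖, ⟨hy0, by linarith⟩, ‖y‖⁻¹ • y, ⟨?_, ?_⟩, ?_⟩
  · rw [mem_closedBall, dist_eq_norm]
    have : ‖y‖⁻¹ • y - x = ‖y‖⁻¹ • ((y - s • x) + (s - ‖y‖) • x) := by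
      rw [sub_smul, sub_add_sub_cancel, smul_sub, smul_smul _ ‖y‖, inv_mul_cancel₀ hy0.ne',
        one_smul]
    rw [this, norm_smul, norm_inv, norm_norm, inv_mul_le_iff₀ hy0]
    have h3 := norm_add_le (y - s • x) ((s - ‖y‖) • x)
    rw [norm_smul, hx, mul_one, Real.norm_eq_abs] at h3
    have h4 : |s - ‖y‖| ≤ r / 8 := by rw [abs_le]; constructor <;> linarith
    nlinarith
  · simp [norm_smul, hy0.ne']
  · simp only [smul_smul, mul_inv_cancel₀ hy0.ne', one_smul]

open scoped Pointwise in
/-- Spherical caps of radius `r` have measure at least a multiple of `r ^ (dim - 1)`. -/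
theorem exists_rpow_le_mul_toSphere_closedBall {E : Type*} [NormedAddCommGroup E]
    [NormedSpace ℝ E] [Nontrivial E] [FiniteDimensional ℝ E] [MeasurableSpace E] [BorelSpace E]
    (ν : Measure E) [ν.IsAddHaarMeasure] :
    ∃ K : ℝ≥0∞, K ≠ ⊤ ∧ ∀ (x : sphere (0 : E) 1) (r : ℝ), 0 < r → r ≤ 1 →
      ENNReal.ofReal r ^ ((Module.finrank ℝ E : ℝ) - 1) ≤ K * ν.toSphere (closedBall x r) := by
  set n := Module.finrank ℝ E with hn
  have hn0 : 0 < n := Module.finrank_pos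
  set v := ν (ball 0 1)
  have hv0 : v ≠ 0 := (measure_ball_pos ν 0 one_pos).ne'
  have hvt : v ≠ ⊤ := measure_ball_lt_top.ne
  refine ⟨2 * 8 ^ n * v⁻¹, by finiteness, fun x r hr hr1 => ?_⟩
  have hx : ‖(x : E)‖ = 1 := by simp
  set D : Set E := Set.Ioo (0 : ℝ) 1 • (closedBall (x : E) r ∩ sphere (0 : E) 1) with hD
  have hσ : ν D ≤ ν.toSphere (closedBall x r) := by
    rw [ν.toSphere_apply' measurableSet_closedBall, ← hn]
    have : ((↑) '' closedBall x r : Set E) = closedBall (x : E) r ∩ sphere (0 : E) 1 := by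
      ext y
      constructor
      · rintro ⟨z, hz, rfl⟩
        exact ⟨hz, z.2⟩
      · rintro ⟨h1, h2⟩
        exact ⟨⟨y, h2⟩, h1, rfl⟩
    rw [this]
    calc ν D = 1 * ν D := (one_mul _).symm
      _ ≤ n * ν D := by gcongr; exact_mod_cast hn0
  let Z : Set (ℝ × E) := {p | p.1 ∈ Set.Icc (1 / 2 : ℝ) (3 / 4) ∧ p.2 ∈ ball (p.1 • (x : E)) (r / 8)}
  have hZ : MeasurableSet Z := by
    refine (measurable_fst measurableSet_Icc).inter ?_
    exact measurableSet_lt (f := fun p : ℝ × E => dist p.2 (p.1 • (x : E)))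
      (by fun_prop) measurable_const
  have h1 : ENNReal.ofReal (1 / 4) * (ENNReal.ofReal ((r / 8) ^ n) * v) ≤
      (volume.prod ν) Z := by
    rw [Measure.prod_apply hZ]
    calc _ = ∫⁻ s in Set.Icc (1 / 2 : ℝ) (3 / 4), ENNReal.ofReal ((r / 8) ^ n) * v := by
          rw [setLIntegral_const, Real.volume_Icc, mul_comm]; norm_num
      _ = ∫⁻ s in Set.Icc (1 / 2 : ℝ) (3 / 4), ν (Prod.mk s ⁻¹' Z) := by
          refine setLIntegral_congr_fun measurableSet_Icc fun s hs => ?_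
          have : Prod.mk s ⁻¹' Z = ball (s • (x : E)) (r / 8) := by
            ext y; simp [Z, Set.mem_Icc.1 hs |>.1, Set.mem_Icc.1 hs |>.2, -one_div]
          simp only [this]
          rw [ν.addHaar_ball _ (by positivity)]
      _ ≤ _ := setLIntegral_le_lintegral _ _
  have h2 : (volume.prod ν) Z ≤ ENNReal.ofReal (r / 2) * ν D := by
    rw [Measure.prod_apply_symm hZ]
    have hpt (y : E) : volume ((fun s => (s, y)) ⁻¹' Z) ≤
        (toMeasurable ν D).indicator (fun _ => ENNReal.ofReal (r / 2)) y := by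
      rcases Set.eq_empty_or_nonempty ((fun s : ℝ => (s, y)) ⁻¹' Z) with h | ⟨s₀, hs₀⟩
      · rw [h]; simp
      · rw [Set.indicator_of_mem
          (subset_toMeasurable ν D (ball_smul_subset_cone hx hr1 hs₀.1 hs₀.2))]
        calc _ ≤ volume (closedBall s₀ (r / 4)) := by
              refine measure_mono fun s hs => ?_
              have h3 := hs.2
              have h4 := hs₀.2
              rw [mem_ball] at h3 h4
              rw [mem_closedBall, dist_eq_norm]
              calc ‖s - s₀‖ = dist (s • (x : E)) (s₀ • (x : E)) := by
                    rw [dist_eq_norm, ← sub_smul, norm_smul, hx, mul_one]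
                _ ≤ dist y (s • (x : E)) + dist y (s₀ • (x : E)) := dist_triangle_left _ _ _
                _ ≤ r / 4 := by linarith
          _ = ENNReal.ofReal (r / 2) := by rw [Real.volume_closedBall]; ring_nf
    calc _ ≤ ∫⁻ y, (toMeasurable ν D).indicator (fun _ => ENNReal.ofReal (r / 2)) y ∂ν :=
          lintegral_mono hpt
      _ = _ := by
          rw [lintegral_indicator_const (measurableSet_toMeasurable _ _), measure_toMeasurable]
  have h3 := h1.trans (h2.trans (mul_le_mul_right hσ _))
  have hpow : ENNReal.ofReal r ^ ((n : ℝ) - 1) = ENNReal.ofReal (r ^ (n - 1)) := by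
    rw [ENNReal.ofReal_rpow_of_pos hr, ← Real.rpow_natCast, Nat.cast_sub hn0, Nat.cast_one]
  rw [hpow]
  have h4 : ENNReal.ofReal (1 / 4) * (ENNReal.ofReal ((r / 8) ^ n) * v) =
      ENNReal.ofReal (r / 2) * (ENNReal.ofReal (r ^ (n - 1)) * (ENNReal.ofReal (2 * 8 ^ n))⁻¹ * v) := by
    rw [← ENNReal.ofReal_inv_of_pos (by positivity), ← ENNReal.ofReal_mul (by positivity),
      ← mul_assoc, ← mul_assoc, ← ENNReal.ofReal_mul (by positivity),
      ← ENNReal.ofReal_mul (by positivity)]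
    congr 2
    obtain ⟨k, hk⟩ : ∃ k, n = k + 1 := ⟨n - 1, by omega⟩
    rw [hk, Nat.add_sub_cancel, div_pow]
    field_simp
    ring
  rw [h4, ENNReal.mul_le_mul_iff_right (by simpa using hr) ENNReal.ofReal_ne_top] at h3
  have h5 : ENNReal.ofReal (2 * 8 ^ n) = 2 * 8 ^ n := by
    rw [ENNReal.ofReal_mul (by norm_num), ENNReal.ofReal_pow (by norm_num)]
    simp
  rw [h5] at h3
  have h8t : (2 * 8 ^ n : ℝ≥0∞) ≠ ⊤ := by finiteness
  have h80 : (2 * 8 ^ n : ℝ≥0∞) ≠ 0 := by simp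
  calc _ = 2 * 8 ^ n * v⁻¹ * (ENNReal.ofReal (r ^ (n - 1)) * (2 * 8 ^ n)⁻¹ * v) := by
        rw [show 2 * 8 ^ n * v⁻¹ * (ENNReal.ofReal (r ^ (n - 1)) * (2 * 8 ^ n)⁻¹ * v) =
          ENNReal.ofReal (r ^ (n - 1)) * ((2 * 8 ^ n) * (2 * 8 ^ n)⁻¹) * (v * v⁻¹) by ring,
          ENNReal.mul_inv_cancel h80 h8t, ENNReal.mul_inv_cancel hv0 hvt, mul_one, mul_one]
    _ ≤ _ := by gcongr

/-- Hausdorff measure on the unit sphere is controlled by the polar-coordinates measure. -/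
theorem exists_hausdorffMeasure_le_mul_toSphere {E : Type*} [NormedAddCommGroup E]
    [NormedSpace ℝ E] [Nontrivial E] [FiniteDimensional ℝ E] [MeasurableSpace E] [BorelSpace E]
    (ν : Measure E) [ν.IsAddHaarMeasure] :
    ∃ K : ℝ≥0∞, K ≠ ⊤ ∧ ∀ G : Set (sphere (0 : E) 1),
      μH[(Module.finrank ℝ E : ℝ) - 1] ((↑) '' G : Set E) ≤ K * ν.toSphere G := by
  obtain ⟨K, hK, h⟩ := exists_rpow_le_mul_toSphere_closedBall ν
  have hs : (0 : ℝ) ≤ (Module.finrank ℝ E : ℝ) - 1 := by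
    have : 1 ≤ Module.finrank ℝ E := Module.finrank_pos
    rw [sub_nonneg]
    exact_mod_cast this
  refine ⟨10 ^ ((Module.finrank ℝ E : ℝ) - 1) * K,
    ENNReal.mul_ne_top (ENNReal.rpow_ne_top_of_nonneg hs (by simp)) hK, fun G => ?_⟩
  rw [isometry_subtype_coe.hausdorffMeasure_image (.inl hs)]
  exact hausdorffMeasure_le_mul_of_le_closedBall _ hs hK h G

theorem exists_le_mul_toSphere_of_le_sphAvg (d : ℕ) [NeZero d] :
    ∃ K : ℝ≥0∞, K ≠ 0 ∧ K ≠ ⊤ ∧ ∀ E : Set (EuclideanSpace ℝ (Fin d)), MeasurableSet E →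
      ∀ (m : ℝ) (x : EuclideanSpace ℝ (Fin d)) (r : ℝ),
      m ≤ sphAvg (Set.indicator E fun _ => 1) x r → ENNReal.ofReal m ≤
        K * (volume : Measure (EuclideanSpace ℝ (Fin d))).toSphere {ω | x - r • (ω : _) ∈ E} := by
  obtain ⟨K, hK, h⟩ := exists_hausdorffMeasure_le_mul_toSphere
    (volume : Measure (EuclideanSpace ℝ (Fin d)))
  refine ⟨K + 1, by simp, by finiteness, fun E hE m x r hm => ?_⟩
  set F : Set (EuclideanSpace ℝ (Fin d)) := {σ | x - r • σ ∈ E} with hF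
  have hFm : MeasurableSet F := by
    have : Measurable fun σ : EuclideanSpace ℝ (Fin d) => x - r • σ := by fun_prop
    exact this hE
  have heq : sphAvg (Set.indicator E fun _ => 1) x r =
      (Measure.restrict μH[(d : ℝ) - 1] (sphere (0 : EuclideanSpace ℝ (Fin d)) 1)).real F := by
    rw [sphAvg, ← integral_indicator_one hFm]
    rfl
  have himage : F ∩ sphere (0 : EuclideanSpace ℝ (Fin d)) 1 =
      (↑) '' {ω : sphere (0 : EuclideanSpace ℝ (Fin d)) 1 |
        x - r • (ω : EuclideanSpace ℝ (Fin d)) ∈ E} := by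
    ext y
    constructor
    · rintro ⟨h1, h2⟩
      exact ⟨⟨y, h2⟩, h1, rfl⟩
    · rintro ⟨z, hz, rfl⟩
      exact ⟨hz, z.2⟩
  have := h {ω | x - r • (ω : EuclideanSpace ℝ (Fin d)) ∈ E}
  rw [finrank_euclideanSpace_fin] at this
  calc ENNReal.ofReal m ≤ ENNReal.ofReal ((Measure.restrict μH[(d : ℝ) - 1]
          (sphere (0 : EuclideanSpace ℝ (Fin d)) 1)).real F) := by rw [← heq]; gcongr
    _ ≤ Measure.restrict μH[(d : ℝ) - 1] (sphere (0 : EuclideanSpace ℝ (Fin d)) 1) F :=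
        ENNReal.ofReal_toReal_le
    _ = μH[(d : ℝ) - 1] (F ∩ sphere (0 : EuclideanSpace ℝ (Fin d)) 1) :=
        Measure.restrict_apply hFm
    _ ≤ K * _ := by rw [himage]; exact this
    _ ≤ _ := by gcongr; exact le_self_add

/-- For `m ≥ 2`, the squared norm pushes Lebesgue measure on a ball of `ℝ^m` forward to a measure
with bounded density. -/
theorem exists_volume_norm_sq_mem_le {m : ℕ} (hm : 2 ≤ m) {R : ℝ} (hR : 0 ≤ R) :
    ∃ K : ℝ≥0∞, K ≠ ⊤ ∧ ∀ Q : Set ℝ, MeasurableSet Q → Q ⊆ Set.Iic (R ^ 2) →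
      volume {w : EuclideanSpace ℝ (Fin m) | ‖w‖ ^ 2 ∈ Q} ≤ K * volume Q := by
  have : NeZero m := ⟨by omega⟩
  set σ := (volume : Measure (EuclideanSpace ℝ (Fin m))).toSphere
  refine ⟨ENNReal.ofReal (R ^ (m - 2)) * σ Set.univ, by finiteness, fun Q hQ hQR => ?_⟩
  have hmeas : MeasurableSet {w : EuclideanSpace ℝ (Fin m) | ‖w‖ ^ 2 ∈ Q} := by
    have : Measurable fun w : EuclideanSpace ℝ (Fin m) => ‖w‖ ^ 2 := by fun_prop
    exact this hQ
  have hderiv : ∀ r ∈ Set.Ioi (0 : ℝ),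
      HasDerivWithinAt (fun r : ℝ => r ^ 2) (2 * r) (Set.Ioi 0) r := fun r _ => by
    simpa using (hasDerivAt_pow 2 r).hasDerivWithinAt
  have hinj : Set.InjOn (fun r : ℝ => r ^ 2) (Set.Ioi 0) := fun r hr s hs h =>
    (pow_left_inj₀ (le_of_lt hr) (le_of_lt hs) two_ne_zero).1 h
  calc volume {w : EuclideanSpace ℝ (Fin m) | ‖w‖ ^ 2 ∈ Q}
      = ∫⁻ w : EuclideanSpace ℝ (Fin m), Q.indicator 1 (‖w‖ ^ 2) := by
        rw [← lintegral_indicator_one hmeas]; rfl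
    _ = ∫⁻ r in Set.Ioi (0 : ℝ), ENNReal.ofReal (r ^ (m - 1)) *
          (Q.indicator 1 (r ^ 2) * σ Set.univ) := by
        rw [lintegral_eq_lintegral_Ioi_toSphere volume
          (f := fun w : EuclideanSpace ℝ (Fin m) => Q.indicator 1 (‖w‖ ^ 2))
          ((measurable_one.indicator hQ).comp (by fun_prop)), finrank_euclideanSpace_fin]
        simp [norm_smul, σ]
    _ ≤ ∫⁻ r in Set.Ioi (0 : ℝ), (ENNReal.ofReal (R ^ (m - 2)) * σ Set.univ) *
          (ENNReal.ofReal |2 * r| * Q.indicator 1 (r ^ 2)) := by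
        refine setLIntegral_mono' measurableSet_Ioi fun r hr => ?_
        rw [Set.mem_Ioi] at hr
        by_cases hrQ : r ^ 2 ∈ Q
        · have hrR : r ≤ R := (pow_le_pow_iff_left₀ hr.le hR two_ne_zero).1 (hQR hrQ)
          have : ENNReal.ofReal (r ^ (m - 1)) ≤
              ENNReal.ofReal (R ^ (m - 2)) * ENNReal.ofReal |2 * r| := by
            rw [← ENNReal.ofReal_mul (by positivity)]
            refine ENNReal.ofReal_le_ofReal ?_
            rw [show m - 1 = (m - 2) + 1 by omega, pow_succ, abs_of_pos (by linarith)]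
            gcongr
            linarith
          simp only [Set.indicator_of_mem hrQ, Pi.one_apply, one_mul, mul_one]
          calc _ ≤ _ := mul_le_mul_left this _
            _ = _ := by ring
        · simp [Set.indicator_of_notMem hrQ]
    _ = ENNReal.ofReal (R ^ (m - 2)) * σ Set.univ *
          ∫⁻ x in (fun r : ℝ => r ^ 2) '' Set.Ioi 0, Q.indicator 1 x := by
        rw [lintegral_const_mul' _ _ (by finiteness),
          lintegral_image_eq_lintegral_abs_deriv_mul measurableSet_Ioi hderiv hinj]
    _ ≤ _ := by
        gcongr
        rw [← lintegral_indicator_one hQ]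
        exact setLIntegral_le_lintegral _ _

theorem volume_sqrt_mem_le {T : Set ℝ} (hT : MeasurableSet T) {R : ℝ} (hTR : T ⊆ Set.Icc 0 R) :
    volume {a : ℝ | 0 ≤ a ∧ √a ∈ T} ≤ ENNReal.ofReal (2 * R) * volume T := by
  have himage : {a : ℝ | 0 ≤ a ∧ √a ∈ T} ⊆ (fun r : ℝ => r ^ 2) '' T :=
    fun a ha => ⟨√a, ha.2, Real.sq_sqrt ha.1⟩
  have hderiv : ∀ r ∈ T, HasDerivWithinAt (fun r : ℝ => r ^ 2) (2 * r) T r := fun r _ => by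
    simpa using (hasDerivAt_pow 2 r).hasDerivWithinAt
  have hinj : Set.InjOn (fun r : ℝ => r ^ 2) T := fun r hr s hs h =>
    (pow_left_inj₀ (hTR hr).1 (hTR hs).1 two_ne_zero).1 h
  have := lintegral_image_eq_lintegral_abs_deriv_mul hT hderiv hinj 1
  simp only [Pi.one_apply, mul_one, lintegral_const, MeasurableSet.univ,
    Measure.restrict_apply, Set.univ_inter, one_mul] at this
  calc _ ≤ _ := measure_mono himage
    _ = _ := this
    _ ≤ ∫⁻ r in T, ENNReal.ofReal (2 * R) := by
        refine setLIntegral_mono' hT fun r hr => ENNReal.ofReal_le_ofReal ?_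
        have := hTR hr
        rw [abs_of_nonneg (by linarith [this.1])]
        linarith [this.2]
    _ = _ := setLIntegral_const _ _

/-- The map `(u, q) ↦ (u ^ 2 + q, (u - t) ^ 2 + q)` has Jacobian `2 * t`. -/
theorem lintegral_volume_bipolar_mul {S₁ S₂ : Set ℝ} (h₁ : MeasurableSet S₁)
    (h₂ : MeasurableSet S₂) {t : ℝ} (ht : 0 < t) :
    (∫⁻ u : ℝ, volume {q : ℝ | u ^ 2 + q ∈ S₁ ∧ (u - t) ^ 2 + q ∈ S₂}) * ENNReal.ofReal (2 * t)
      = volume S₁ * volume S₂ := by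
  let Z : Set (ℝ × ℝ) := {p | p.2 ∈ S₁ ∧ p.2 + t ^ 2 - 2 * t * p.1 ∈ S₂}
  have hZ : MeasurableSet Z := by
    have : Measurable fun p : ℝ × ℝ => p.2 + t ^ 2 - 2 * t * p.1 := by fun_prop
    exact (measurable_snd h₁).inter (this h₂)
  have hu (u : ℝ) : volume {q : ℝ | u ^ 2 + q ∈ S₁ ∧ (u - t) ^ 2 + q ∈ S₂} =
      volume (Prod.mk u ⁻¹' Z) := by
    rw [← measure_preimage_add volume (u ^ 2) (Prod.mk u ⁻¹' Z)]
    congr 1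
    ext q
    simp only [Z, Set.mem_preimage, Set.mem_ofPred_eq]
    rw [show u ^ 2 + q + t ^ 2 - 2 * t * u = (u - t) ^ 2 + q by ring]
  have ha (a : ℝ) : volume ((fun u => (u, a)) ⁻¹' Z) =
      S₁.indicator (fun _ => ENNReal.ofReal |(2 * t)⁻¹| * volume S₂) a := by
    by_cases haS : a ∈ S₁
    · rw [Set.indicator_of_mem haS]
      have : ((fun u => (u, a)) ⁻¹' Z) =
          (fun u => 2 * t * u) ⁻¹' ((fun u => a + t ^ 2 - u) ⁻¹' S₂) := by
        ext u; simp [Z, haS]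
      rw [this, Real.volume_preimage_mul_left (by positivity),
        (Measure.measurePreserving_sub_left volume (a + t ^ 2)).measure_preimage h₂.nullMeasurableSet]
    · rw [Set.indicator_of_notMem haS]
      simp [Z, haS]
  simp_rw [hu]
  rw [← Measure.prod_apply hZ, Measure.prod_apply_symm hZ]
  simp_rw [ha]
  rw [lintegral_indicator_const h₁, abs_of_pos (by positivity), mul_comm, mul_comm (volume S₁),
    ← mul_assoc, ← mul_assoc, ← ENNReal.ofReal_mul (by positivity), mul_inv_cancel₀ (by positivity),
    ENNReal.ofReal_one, one_mul]

/-- Cartesian coordinates adapted to a nonzero vector `v`. -/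
theorem exists_measurePreserving_adapted_coordinates {m : ℕ}
    {v : EuclideanSpace ℝ (Fin (m + 1))} (hv : v ≠ 0) :
    ∃ Φ : EuclideanSpace ℝ (Fin (m + 1)) → ℝ × EuclideanSpace ℝ (Fin m),
      MeasurePreserving Φ ∧ ∀ y, ‖y‖ ^ 2 = (Φ y).1 ^ 2 + ‖(Φ y).2‖ ^ 2 ∧
        ‖y - v‖ ^ 2 = ((Φ y).1 - ‖v‖) ^ 2 + ‖(Φ y).2‖ ^ 2 := by
  have horth : Orthonormal ℝ (({0} : Set (Fin (m + 1))).domRestrict fun _ => ‖v‖⁻¹ • v) := by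
    refine ⟨fun i => ?_, fun i j hij => absurd (Subsingleton.elim i j) hij⟩
    rw [Set.domRestrict_apply]
    simp [norm_smul, hv]
  obtain ⟨b, hb⟩ := horth.exists_orthonormalBasis_extension_of_card_eq (by simp)
  replace hb : b 0 = ‖v‖⁻¹ • v := hb 0 rfl
  have hv' : v = ‖v‖ • b 0 := by rw [hb, smul_smul, mul_inv_cancel₀ (by simpa using hv), one_smul]
  let Φ : EuclideanSpace ℝ (Fin (m + 1)) → ℝ × EuclideanSpace ℝ (Fin m) := fun y =>
    (b.repr y 0, WithLp.toLp 2 fun i : Fin m => b.repr y i.succ)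
  have hΦ : MeasurePreserving Φ := by
    have h1 := b.measurePreserving_repr
    have h2 := PiLp.volume_preserving_ofLp (Fin (m + 1))
    have h3 := volume_preserving_piFinSuccAbove (fun _ : Fin (m + 1) => ℝ) 0
    have h4 : MeasurePreserving (Prod.map id (WithLp.toLp 2) :
        ℝ × (Fin m → ℝ) → ℝ × EuclideanSpace ℝ (Fin m)) volume volume :=
      (MeasurePreserving.id volume).prod (PiLp.volume_preserving_toLp (Fin m))
    exact h4.comp (h3.comp (h2.comp h1))
  have hnorm (y) : ‖y‖ ^ 2 = (Φ y).1 ^ 2 + ‖(Φ y).2‖ ^ 2 := by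
    rw [← b.repr.norm_map y, EuclideanSpace.norm_sq_eq, EuclideanSpace.norm_sq_eq,
      Fin.sum_univ_succ]
    simp [Φ]
  refine ⟨Φ, hΦ, fun y => ⟨hnorm y, ?_⟩⟩
  rw [hnorm (y - v)]
  have h1 : b.repr v 0 = ‖v‖ := by
    conv_lhs => rw [hv']
    simp
  have h2 (i : Fin m) : b.repr v i.succ = 0 := by
    conv_lhs => rw [hv']
    simp
  simp [Φ, h1, h2]

/-- In dimension at least `3`, the map `y ↦ (dist y x₁, dist y x₂)` pushes Lebesgue measure on
bounded sets forward to a measure with density `O(1 / dist x₁ x₂)`. -/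
theorem exists_volume_dist_mem_dist_mem_le {d : ℕ} (hd : 3 ≤ d) {R : ℝ} (hR : 0 ≤ R) :
    ∃ K : ℝ≥0∞, K ≠ ⊤ ∧ ∀ (x₁ x₂ : EuclideanSpace ℝ (Fin d)) (T₁ T₂ : Set ℝ),
      MeasurableSet T₁ → MeasurableSet T₂ → T₁ ⊆ Set.Icc 0 R → T₂ ⊆ Set.Icc 0 R →
      volume {y | dist x₁ y ∈ T₁ ∧ dist x₂ y ∈ T₂} * edist x₁ x₂ ≤
        K * (volume T₁ * volume T₂) := by
  obtain ⟨m, rfl⟩ : ∃ m, d = m + 1 := ⟨d - 1, by omega⟩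
  obtain ⟨K, hK, hKQ⟩ := exists_volume_norm_sq_mem_le (m := m) (by omega) hR
  refine ⟨K * (ENNReal.ofReal (2 * R) * ENNReal.ofReal (2 * R)), by finiteness,
    fun x₁ x₂ T₁ T₂ hT₁ hT₂ hT₁R hT₂R => ?_⟩
  rcases eq_or_ne x₁ x₂ with rfl | hne
  · simp
  set v := x₂ - x₁ with hv
  have hv0 : v ≠ 0 := sub_ne_zero.2 hne.symm
  obtain ⟨Φ, hΦ, hΦy⟩ := exists_measurePreserving_adapted_coordinates hv0
  set S₁ : Set ℝ := {a | 0 ≤ a ∧ √a ∈ T₁} with hS₁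
  set S₂ : Set ℝ := {a | 0 ≤ a ∧ √a ∈ T₂} with hS₂
  have hmS₁ : MeasurableSet S₁ := measurableSet_Ici.inter (Real.continuous_sqrt.measurable hT₁)
  have hmS₂ : MeasurableSet S₂ := measurableSet_Ici.inter (Real.continuous_sqrt.measurable hT₂)
  let Z : Set (ℝ × EuclideanSpace ℝ (Fin m)) :=
    {p | p.1 ^ 2 + ‖p.2‖ ^ 2 ∈ S₁ ∧ (p.1 - ‖v‖) ^ 2 + ‖p.2‖ ^ 2 ∈ S₂}
  have hZ : MeasurableSet Z := by
    have h1 : Measurable fun p : ℝ × EuclideanSpace ℝ (Fin m) => p.1 ^ 2 + ‖p.2‖ ^ 2 := by fun_prop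
    have h2 : Measurable fun p : ℝ × EuclideanSpace ℝ (Fin m) => (p.1 - ‖v‖) ^ 2 + ‖p.2‖ ^ 2 := by
      fun_prop
    exact (h1 hmS₁).inter (h2 hmS₂)
  have hvol : volume {y | dist x₁ y ∈ T₁ ∧ dist x₂ y ∈ T₂} ≤ volume Z := by
    rw [← hΦ.measure_preimage hZ.nullMeasurableSet,
      ← measure_preimage_add volume x₁ {y | dist x₁ y ∈ T₁ ∧ dist x₂ y ∈ T₂}]
    refine measure_mono fun y hy => ?_
    simp only [Set.mem_preimage, Set.mem_ofPred_eq, dist_self_add_right] at hy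
    have hd2 : dist x₂ (x₁ + y) = ‖y - v‖ := by
      rw [dist_comm, dist_eq_norm]; congr 1; rw [hv]; abel
    rw [hd2] at hy
    constructor
    · rw [← (hΦy y).1]
      exact ⟨by positivity, by rw [Real.sqrt_sq (norm_nonneg _)]; exact hy.1⟩
    · rw [← (hΦy y).2]
      exact ⟨by positivity, by rw [Real.sqrt_sq (norm_nonneg _)]; exact hy.2⟩
  have hslice (u : ℝ) : volume (Prod.mk u ⁻¹' Z) ≤
      K * volume {q : ℝ | u ^ 2 + q ∈ S₁ ∧ (u - ‖v‖) ^ 2 + q ∈ S₂} := by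
    refine hKQ {q : ℝ | u ^ 2 + q ∈ S₁ ∧ (u - ‖v‖) ^ 2 + q ∈ S₂} ?_ fun q hq => ?_
    · have h1 : Measurable fun q : ℝ => u ^ 2 + q := by fun_prop
      have h2 : Measurable fun q : ℝ => (u - ‖v‖) ^ 2 + q := by fun_prop
      exact (h1 hmS₁).inter (h2 hmS₂)
    · have h1 := hT₁R hq.1.2
      have h2 : u ^ 2 + q ≤ R ^ 2 := (Real.sqrt_le_left hR).1 h1.2
      rw [Set.mem_Iic]
      nlinarith [sq_nonneg u]
  have hed : edist x₁ x₂ ≤ ENNReal.ofReal (2 * ‖v‖) := by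
    rw [edist_dist, dist_comm, dist_eq_norm]
    exact ENNReal.ofReal_le_ofReal (by linarith [norm_nonneg v])
  calc volume {y | dist x₁ y ∈ T₁ ∧ dist x₂ y ∈ T₂} * edist x₁ x₂
      ≤ volume Z * ENNReal.ofReal (2 * ‖v‖) := by gcongr
    _ = (∫⁻ u, volume (Prod.mk u ⁻¹' Z)) * ENNReal.ofReal (2 * ‖v‖) := by
        rw [Measure.volume_eq_prod, Measure.prod_apply hZ]
    _ ≤ (∫⁻ u, K * volume {q : ℝ | u ^ 2 + q ∈ S₁ ∧ (u - ‖v‖) ^ 2 + q ∈ S₂}) *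
          ENNReal.ofReal (2 * ‖v‖) := by
        gcongr with u; exact hslice u
    _ = K * (volume S₁ * volume S₂) := by
        rw [lintegral_const_mul' _ _ hK, mul_assoc,
          lintegral_volume_bipolar_mul hmS₁ hmS₂ (norm_pos_iff.2 hv0)]
    _ ≤ K * ((ENNReal.ofReal (2 * R) * volume T₁) * (ENNReal.ofReal (2 * R) * volume T₂)) := by
        gcongr
        · exact volume_sqrt_mem_le hT₁ hT₁R
        · exact volume_sqrt_mem_le hT₂ hT₂R
    _ = _ := by ring

/-- A Frostman condition with exponent `α'` bounds the `α`-energy potential for `α < α'`. -/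
theorem exists_lintegral_edist_rpow_neg_le {X : Type*} [PseudoMetricSpace X] [MeasurableSpace X]
    [OpensMeasurableSpace X] (ν : Measure X) [IsFiniteMeasure ν] {α α' C : ℝ} (hα : 0 < α)
    (hαα' : α < α')
    (h : ∀ (x : X) (δ : ℝ), 0 < δ → ν (ball x δ) ≤ ENNReal.ofReal (C * δ ^ α')) :
    ∃ K : ℝ≥0∞, K ≠ ⊤ ∧ ∀ x, ∫⁻ y, edist x y ^ (-α) ∂ν ≤ K := by
  let a : ℕ → ℝ := fun n => ((2 : ℝ) ^ α) ^ (n + 1)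
  have ha : ∀ n, 1 ≤ a n := fun n => one_le_pow₀ (Real.one_le_rpow one_le_two hα.le)
  let c : ℕ → ℝ := fun n => a n * (|C| * (2 * (1 / 2) ^ n) ^ α')
  have hc : Summable c := by
    have h1 : ∀ n, c n = ((2 : ℝ) ^ α * |C| * 2 ^ α') * ((2 : ℝ) ^ α * (1 / 2) ^ α') ^ n := by
      intro n
      simp only [c, a]
      rw [Real.mul_rpow (by norm_num) (by positivity), ← Real.rpow_natCast (1 / 2) n,
        ← Real.rpow_mul (by norm_num), mul_comm (n : ℝ), Real.rpow_mul (by norm_num),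
        Real.rpow_natCast, mul_pow]
      ring
    refine (summable_congr h1).2 ?_
    refine (summable_geometric_of_lt_one (by positivity) ?_).mul_left _
    rw [one_div, Real.inv_rpow (by norm_num), ← div_eq_mul_inv, div_lt_one (by positivity)]
    exact Real.rpow_lt_rpow_of_exponent_lt one_lt_two hαα'
  refine ⟨ν Set.univ + ∑' n, ENNReal.ofReal (c n),
    ENNReal.add_ne_top.2 ⟨by finiteness, hc.tsum_ofReal_ne_top⟩, fun x => ?_⟩
  let B : ℕ → Set X := fun n => ball x (2 * (1 / 2) ^ n)
  have hpt (y : X) : edist x y ^ (-α) ≤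
      1 + ∑' n, (B n).indicator (fun _ => ENNReal.ofReal (a n)) y := by
    rw [edist_dist]
    rcases (dist_nonneg (x := x) (y := y)).eq_or_lt with h0 | h0
    · have : ∑' n, (B n).indicator (fun _ => ENNReal.ofReal (a n)) y = ⊤ := by
        refine top_unique ((ENNReal.tsum_const_eq_top_of_ne_zero (α := ℕ) one_ne_zero).symm.le.trans
          (ENNReal.tsum_le_tsum fun n => ?_))
        have hy : y ∈ B n := by
          rw [mem_ball, dist_comm, ← h0]; positivity
        rw [Set.indicator_of_mem hy]
        exact ENNReal.one_le_ofReal.2 (ha n)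
      rw [this]
      simp
    rw [ENNReal.ofReal_rpow_of_pos h0]
    rcases le_total 1 (dist x y) with h1 | h1
    · refine le_add_of_le_of_nonneg ?_ (by simp)
      rw [ENNReal.ofReal_le_one]
      exact Real.rpow_le_one_of_one_le_of_nonpos h1 (by linarith)
    · obtain ⟨n, hn1, hn2⟩ := exists_nat_pow_near_of_lt_one h0 h1
        (by norm_num : (0 : ℝ) < 1 / 2) (by norm_num)
      refine le_trans ?_ ((ENNReal.le_tsum n).trans le_add_self)
      have hy : y ∈ B n := by
        rw [mem_ball, dist_comm]
        have : (0 : ℝ) < (1 / 2) ^ n := by positivity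
        linarith
      rw [Set.indicator_of_mem hy]
      refine ENNReal.ofReal_le_ofReal ?_
      calc dist x y ^ (-α) ≤ ((1 / 2 : ℝ) ^ (n + 1)) ^ (-α) :=
            Real.rpow_le_rpow_of_nonpos (by positivity) hn1.le (by linarith)
        _ = a n := by
            simp only [a]
            rw [Real.rpow_neg (by positivity), ← Real.inv_rpow (by positivity), one_div, inv_pow,
              inv_inv, ← Real.rpow_natCast, ← Real.rpow_natCast, ← Real.rpow_mul (by norm_num),
              ← Real.rpow_mul (by norm_num), mul_comm]
  calc ∫⁻ y, edist x y ^ (-α) ∂ν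
      ≤ ∫⁻ y, (1 + ∑' n, (B n).indicator (fun _ => ENNReal.ofReal (a n)) y) ∂ν :=
        lintegral_mono hpt
    _ = ν Set.univ + ∑' n, ENNReal.ofReal (a n) * ν (B n) := by
        rw [lintegral_add_left measurable_const, lintegral_one,
          lintegral_tsum fun n => (measurable_const.indicator measurableSet_ball).aemeasurable]
        simp_rw [fun n => lintegral_indicator_const (μ := ν)
          (measurableSet_ball : MeasurableSet (B n)) (ENNReal.ofReal (a n))]
        rfl
    _ ≤ _ := by
        gcongr with n
        simp only [c]
        rw [ENNReal.ofReal_mul (zero_le_one.trans (ha n))]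
        gcongr
        refine (h x _ (by positivity)).trans (ENNReal.ofReal_le_ofReal ?_)
        gcongr
        exact le_abs_self C

/-- Cutting a finite measure on the line without atoms at a quantile. -/
theorem measure_setOf_measure_Iic_le_eq (ρ : Measure ℝ) [IsFiniteMeasure ρ] {R : ℝ}
    (hatom : ∀ r, ρ {r} = 0) (hsupp : ρ (Set.Icc 0 R)ᶜ = 0) {m : ℝ≥0∞} (hm : m ≤ ρ Set.univ) :
    ρ {r | ρ (Set.Iic r) ≤ m} = m := by
  have hm' : m ≠ ⊤ := (hm.trans_lt (measure_lt_top _ _)).ne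
  have hcont : Continuous fun r => ρ.real (Set.Iic r) := by
    have (r : ℝ) : ρ.real (Set.Iic r) = ∫ t, (Set.Iic r).indicator (fun _ => (1 : ℝ)) t ∂ρ :=
      (integral_indicator_one measurableSet_Iic).symm
    simp_rw [this]
    refine continuous_iff_continuousAt.2 fun r₀ => continuousAt_of_dominated
      (bound := fun _ => (1 : ℝ)) (.of_forall fun r => ?_) (.of_forall fun r => ?_)
      (integrable_const _) ?_
    · exact (measurable_const.indicator measurableSet_Iic).aestronglyMeasurable
    · refine .of_forall fun t => ?_
      by_cases ht : t ∈ Set.Iic r <;> simp [ht]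
    · have : ∀ᵐ t ∂ρ, t ≠ r₀ := by rw [ae_iff]; simpa using hatom r₀
      filter_upwards [this] with t ht
      rcases lt_or_gt_of_ne ht with h | h
      · refine (continuousAt_const (y := (1 : ℝ))).congr ?_
        filter_upwards [lt_mem_nhds h] with r hr
        simp [hr.le]
      · refine (continuousAt_const (y := (0 : ℝ))).congr ?_
        filter_upwards [gt_mem_nhds h] with r hr
        simp [hr]
  have hle (r : ℝ) : ρ (Set.Iic r) ≤ m ↔ ρ.real (Set.Iic r) ≤ m.toReal :=
    (ENNReal.toReal_le_toReal (measure_ne_top _ _) hm').symm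
  have hR : ρ (Set.Iic R) = ρ Set.univ := by
    refine measure_congr (Filter.eventuallyEq_univ.2 ?_)
    refine mem_ae_iff.2 (measure_mono_null (Set.compl_subset_compl.2 ?_) hsupp)
    exact fun r hr => hr.2
  have h0 : ρ (Set.Iic 0) = 0 := by
    refine measure_mono_null (t := {0} ∪ (Set.Icc 0 R)ᶜ) (fun r hr => ?_)
      (measure_union_null (hatom 0) hsupp)
    rcases (Set.mem_Iic.1 hr).eq_or_lt with h | h
    · exact .inl h
    · exact .inr fun h' => absurd h'.1 h.not_ge
  rcases lt_or_ge R 0 with hR0 | hR0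
  · rw [Set.Icc_eq_empty hR0.not_ge, Set.compl_empty] at hsupp
    have hm0 : m = 0 := by simpa [hsupp] using hm
    rw [hm0]
    exact measure_mono_null (Set.subset_univ _) hsupp
  obtain ⟨s, -, hs⟩ : m.toReal ∈ (fun r => ρ.real (Set.Iic r)) '' Set.Icc 0 R := by
    refine intermediate_value_Icc hR0 hcont.continuousOn ⟨?_, ?_⟩
    · simp [measureReal_def, h0]
    · rw [measureReal_def, hR]
      exact ENNReal.toReal_mono (measure_ne_top _ _) hm
  have hs' : ρ (Set.Iic s) = m := (ENNReal.toReal_eq_toReal_iff' (measure_ne_top _ _) hm').1 hs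
  refine le_antisymm ?_ ?_
  · obtain ⟨M, ⟨-, hM⟩, hmax⟩ :=
      (isCompact_Icc.inter_right (isClosed_le hcont continuous_const)
        : IsCompact (Set.Icc 0 R ∩ {r | ρ.real (Set.Iic r) ≤ m.toReal})).exists_isMaxOn
        ⟨0, ⟨le_rfl, hR0⟩, by simp [measureReal_def, h0]⟩ continuousOn_id
    calc ρ {r | ρ (Set.Iic r) ≤ m} ≤ ρ (Set.Iic M ∪ (Set.Icc 0 R)ᶜ) := by
          refine measure_mono fun r hr => ?_
          by_cases hrR : r ∈ Set.Icc 0 R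
          · exact .inl (hmax ⟨hrR, (hle r).1 hr⟩)
          · exact .inr hrR
      _ ≤ ρ (Set.Iic M) + ρ (Set.Icc 0 R)ᶜ := measure_union_le _ _
      _ ≤ m := by rw [hsupp, add_zero]; exact (hle M).2 hM
  · calc m = ρ (Set.Iic s) := hs'.symm
      _ ≤ _ := measure_mono fun r hr => (measure_mono (Set.Iic_subset_Iic.2 hr)).trans hs'.le

/-- A second moment bound: if the fibres of `G ⊆ A × E` over `A` have measure at least `m` and
small pairwise intersections on average, then `E` is large. -/
theorem sq_mul_measure_le_of_inter_le {X Y : Type*} [MeasurableSpace X] [MeasurableSpace Y]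
    (ν : Measure X) [IsFiniteMeasure ν] (τ : Measure Y) [SFinite τ] {A : Set X} {E : Set Y}
    (hA : MeasurableSet A) (hE : MeasurableSet E) {G : Set (X × Y)} (hG : MeasurableSet G)
    (hGE : ∀ p ∈ G, p.2 ∈ E) {m D K : ℝ≥0∞} (hD : D ≠ ⊤) (hm : ∀ x ∈ A, m ≤ τ (Prod.mk x ⁻¹' G))
    {k : X → X → ℝ≥0∞} (hk : ∀ x ∈ A, ∫⁻ x', k x x' ∂ν ≤ K)
    (hinter : ∀ x ∈ A, ∀ x' ∈ A, τ (Prod.mk x ⁻¹' G ∩ Prod.mk x' ⁻¹' G) ≤ D * k x x') :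
    m ^ 2 * ν A ≤ D * K * τ E := by
  rcases eq_or_ne (ν A) 0 with h0 | h0
  · simp [h0]
  set ν' := ν.restrict A
  set h : Y → ℝ≥0∞ := fun y => ν' ((fun x => (x, y)) ⁻¹' G) with hh
  have hhm : Measurable h := measurable_measure_prodMk_right hG
  have hone : m * ν A ≤ ∫⁻ y, E.indicator 1 y * h y ∂τ := by
    calc m * ν A = ∫⁻ x in A, m ∂ν := (setLIntegral_const _ _).symm
      _ ≤ ∫⁻ x in A, τ (Prod.mk x ⁻¹' G) ∂ν := setLIntegral_mono' hA hm
      _ = ∫⁻ y, h y ∂τ := by rw [← Measure.prod_apply hG, Measure.prod_apply_symm hG]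
      _ = ∫⁻ y, E.indicator 1 y * h y ∂τ := by
        refine lintegral_congr fun y => ?_
        by_cases hy : y ∈ E
        · simp [hy]
        · have : (fun x => (x, y)) ⁻¹' G = ∅ :=
            Set.eq_empty_of_forall_notMem fun x hx => hy (hGE _ hx)
          simp [hh, this]
  have htwo : ∫⁻ y, h y ^ 2 ∂τ ≤ D * K * ν A := by
    let W : Set ((X × X) × Y) := {p | (p.1.1, p.2) ∈ G ∧ (p.1.2, p.2) ∈ G}
    have hW : MeasurableSet W := by
      have h1 : Measurable fun p : (X × X) × Y => (p.1.1, p.2) := by fun_prop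
      have h2 : Measurable fun p : (X × X) × Y => (p.1.2, p.2) := by fun_prop
      exact (h1 hG).inter (h2 hG)
    calc ∫⁻ y, h y ^ 2 ∂τ = ∫⁻ y, (ν'.prod ν') ((fun p => (p, y)) ⁻¹' W) ∂τ := by
          refine lintegral_congr fun y => ?_
          rw [sq, hh, ← Measure.prod_prod]
          rfl
      _ = ∫⁻ p, τ (Prod.mk p ⁻¹' W) ∂(ν'.prod ν') := by
          rw [← Measure.prod_apply_symm hW, Measure.prod_apply hW]
      _ = ∫⁻ x in A, ∫⁻ x' in A, τ (Prod.mk x ⁻¹' G ∩ Prod.mk x' ⁻¹' G) ∂ν ∂ν :=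
          lintegral_prod _ (measurable_measure_prodMk_left hW).aemeasurable
      _ ≤ ∫⁻ x in A, D * K ∂ν := by
          refine setLIntegral_mono' hA fun x hx => ?_
          calc _ ≤ ∫⁻ x' in A, D * k x x' ∂ν := setLIntegral_mono' hA (hinter x hx)
            _ = D * ∫⁻ x' in A, k x x' ∂ν := lintegral_const_mul' _ _ hD
            _ ≤ _ := by
              gcongr
              exact (setLIntegral_le_lintegral _ _).trans (hk x hx)
      _ = _ := setLIntegral_const _ _
  have hcs := ENNReal.lintegral_mul_le_Lp_mul_Lq τ Real.HolderConjugate.two_two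
    (measurable_one.indicator hE).aemeasurable hhm.aemeasurable
  have hind : ∫⁻ y, (E.indicator 1 y : ℝ≥0∞) ^ (2 : ℝ) ∂τ = τ E := by
    rw [← lintegral_indicator_one hE]
    refine lintegral_congr fun y => ?_
    by_cases hy : y ∈ E <;> simp [hy]
  rw [hind] at hcs
  have hsq : (m * ν A) ^ 2 ≤ τ E * (D * K * ν A) := by
    calc (m * ν A) ^ 2 ≤ (τ E ^ (1 / 2 : ℝ) * (∫⁻ y, h y ^ (2 : ℝ) ∂τ) ^ (1 / 2 : ℝ)) ^ 2 := by
          exact pow_le_pow_left' (hone.trans hcs) 2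
      _ = τ E * ∫⁻ y, h y ^ 2 ∂τ := by
          rw [mul_pow, ← ENNReal.rpow_mul_natCast, ← ENNReal.rpow_mul_natCast]
          simp
      _ ≤ _ := by gcongr
  rw [← ENNReal.mul_le_mul_iff_left h0 (measure_ne_top ν A)]
  calc m ^ 2 * ν A * ν A = (m * ν A) ^ 2 := by ring
    _ ≤ _ := hsq
    _ = _ := by ring

/-- If `E` occupies a portion at least `b` of each sphere around `x` with radius in `U`, then the
part of `E` at distances in `U` from `x` has volume at least a multiple of `b * volume U`. -/
theorem mul_volume_le_volume_dist_mem {d : ℕ} [NeZero d] {E : Set (EuclideanSpace ℝ (Fin d))}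
    (hE : MeasurableSet E) {r₀ : ℝ} (hr₀ : 0 < r₀) {b : ℝ≥0∞} (x : EuclideanSpace ℝ (Fin d))
    {U : Set ℝ} (hU : MeasurableSet U) (hUr : U ⊆ Set.Ici r₀)
    (hb : ∀ r ∈ U, b ≤ (volume : Measure (EuclideanSpace ℝ (Fin d))).toSphere
      {ω | x - r • (ω : EuclideanSpace ℝ (Fin d)) ∈ E}) :
    ENNReal.ofReal (r₀ ^ (d - 1)) * b * volume U ≤ volume {y | y ∈ E ∧ dist x y ∈ U} := by
  set σ := (volume : Measure (EuclideanSpace ℝ (Fin d))).toSphere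
  let F : Set (EuclideanSpace ℝ (Fin d)) := {z | x - z ∈ E ∧ ‖z‖ ∈ U}
  have hsub : Measurable fun z : EuclideanSpace ℝ (Fin d) => x - z := by fun_prop
  have hF : MeasurableSet F := (hsub hE).inter (measurable_norm hU)
  have hmE : MeasurableSet {y | y ∈ E ∧ dist x y ∈ U} := by
    have : Measurable fun y => dist x y := by fun_prop
    exact hE.inter (this hU)
  calc ENNReal.ofReal (r₀ ^ (d - 1)) * b * volume U
      = ∫⁻ r in U, ENNReal.ofReal (r₀ ^ (d - 1)) * b := (setLIntegral_const _ _).symm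
    _ ≤ ∫⁻ r in U, ENNReal.ofReal (r ^ (d - 1)) *
          ∫⁻ ω : sphere (0 : EuclideanSpace ℝ (Fin d)) 1, F.indicator 1 (r • (ω : _)) ∂σ := by
        refine setLIntegral_mono' hU fun r hr => ?_
        have hrr := hUr hr
        have hr0 : 0 < r := hr₀.trans_le hrr
        gcongr
        · exact hrr
        · refine (hb r hr).trans ?_
          have hset : MeasurableSet {ω : sphere (0 : EuclideanSpace ℝ (Fin d)) 1 |
              x - r • (ω : EuclideanSpace ℝ (Fin d)) ∈ E} := by
            have : Measurable fun ω : sphere (0 : EuclideanSpace ℝ (Fin d)) 1 =>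
              x - r • (ω : EuclideanSpace ℝ (Fin d)) := by fun_prop
            exact this hE
          rw [← lintegral_indicator_one hset]
          refine lintegral_mono fun ω => ?_
          by_cases hω : x - r • (ω : EuclideanSpace ℝ (Fin d)) ∈ E
          · have hωF : r • (ω : EuclideanSpace ℝ (Fin d)) ∈ F := by
              refine ⟨hω, ?_⟩
              rwa [norm_smul, norm_eq_of_mem_sphere, mul_one, Real.norm_of_nonneg hr0.le]
            simp [Set.indicator_of_mem hωF]
            exact Set.indicator_le_self' (by simp) _
          · rw [Set.indicator_of_notMem (by exact hω)]
            exact zero_le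
    _ ≤ ∫⁻ r in Set.Ioi (0 : ℝ), ENNReal.ofReal (r ^ (d - 1)) *
          ∫⁻ ω : sphere (0 : EuclideanSpace ℝ (Fin d)) 1, F.indicator 1 (r • (ω : _)) ∂σ :=
        lintegral_mono_set fun r hr => hr₀.trans_le (hUr hr)
    _ = volume F := by
        rw [← lintegral_indicator_one hF, lintegral_eq_lintegral_Ioi_toSphere volume
          (measurable_one.indicator hF), finrank_euclideanSpace_fin]
    _ = _ := by
        rw [← (Measure.measurePreserving_sub_left volume x).measure_preimage
          hmE.nullMeasurableSet]
        congr 1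
        ext z
        simp [F]

/-- The set of radii at which a measurable set of spheres around `x` meets `E` can be cut down
measurably in `x` so that a prescribed volume of `E` remains. -/
theorem exists_subset_volume_dist_mem_eq {d : ℕ} [NeZero d] {E : Set (EuclideanSpace ℝ (Fin d))}
    (hE : MeasurableSet E) {U : Set (EuclideanSpace ℝ (Fin d) × ℝ)} (hU : MeasurableSet U) {R : ℝ}
    (hUR : ∀ p ∈ U, p.2 ∈ Set.Icc 0 R) (m : ℝ≥0∞) :
    ∃ V ⊆ U, MeasurableSet V ∧ ∀ x, m ≤ volume {y | y ∈ E ∧ (x, dist x y) ∈ U} →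
      volume {y | y ∈ E ∧ (x, dist x y) ∈ V} = m := by
  let X := EuclideanSpace ℝ (Fin d)
  let W : Set ((X × ℝ) × X) :=
    {q | (q.2 ∈ E ∧ (q.1.1, dist q.1.1 q.2) ∈ U) ∧ dist q.1.1 q.2 ≤ q.1.2}
  have hW : MeasurableSet W := by
    have h1 : Measurable fun q : (X × ℝ) × X => (q.1.1, dist q.1.1 q.2) := by fun_prop
    have h2 : Measurable fun q : (X × ℝ) × X => dist q.1.1 q.2 := by fun_prop
    exact ((measurable_snd hE).inter (h1 hU)).inter (measurableSet_le h2 measurable_fst.snd)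
  have hψ : Measurable fun p : X × ℝ => volume (Prod.mk p ⁻¹' W) :=
    measurable_measure_prodMk_left hW
  refine ⟨U ∩ {p | volume (Prod.mk p ⁻¹' W) ≤ m}, Set.inter_subset_left,
    hU.inter (hψ measurableSet_Iic), fun x hx => ?_⟩
  let H : Set X := {y | y ∈ E ∧ (x, dist x y) ∈ U}
  have hdist : Measurable fun y : X => dist x y := by fun_prop
  have hH : MeasurableSet H := hE.inter ((measurable_const.prodMk hdist : Measurable
    fun y : X => (x, dist x y)) hU)
  have hHfin : volume H < ⊤ := by
    refine (measure_mono fun y hy => ?_).trans_lt (measure_closedBall_lt_top (x := x) (r := R))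
    rw [mem_closedBall, dist_comm]
    exact (hUR _ hy.2).2
  have : IsFiniteMeasure (volume.restrict H) := ⟨by simpa using hHfin⟩
  let ρ : Measure ℝ := (volume.restrict H).map fun y => dist x y
  have hρ {s : Set ℝ} (hs : MeasurableSet s) : ρ s = volume {y | y ∈ H ∧ dist x y ∈ s} := by
    rw [Measure.map_apply hdist hs, Measure.restrict_apply (hdist hs), Set.inter_comm]
    rfl
  have hatom (r : ℝ) : ρ {r} = 0 := by
    rw [hρ (measurableSet_singleton r)]
    refine measure_mono_null (t := sphere x r) (fun y hy => ?_) (Measure.addHaar_sphere _ _ _)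
    rw [mem_sphere, dist_comm]
    exact hy.2
  have hsupp : ρ (Set.Icc 0 R)ᶜ = 0 := by
    rw [hρ measurableSet_Icc.compl]
    refine measure_mono_null (t := ∅) (fun y hy => hy.2 (hUR _ hy.1.2)) measure_empty
  have huniv : ρ Set.univ = volume H := by simp [hρ]
  have key := measure_setOf_measure_Iic_le_eq ρ hatom hsupp (m := m) (by rw [huniv]; exact hx)
  have hset : {r | ρ (Set.Iic r) ≤ m} = {r | volume (Prod.mk (x, r) ⁻¹' W) ≤ m} := by
    ext r
    change ρ _ ≤ m ↔ _
    rw [hρ measurableSet_Iic]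
    rfl
  have hmeas : MeasurableSet {r | volume (Prod.mk (x, r) ⁻¹' W) ≤ m} :=
    (hψ.comp measurable_prodMk_left) measurableSet_Iic
  rw [hset, hρ hmeas] at key
  refine Eq.trans ?_ key
  congr 1
  ext y
  exact and_assoc.symm

/-- Interpolation between two upper bounds of an extended nonnegative real. -/
theorem ENNReal.le_rpow_mul_rpow_mul_rpow_neg {v m N e : ℝ≥0∞} {α : ℝ} (hα0 : 0 < α)
    (hα1 : α < 1) (hm : m ≠ ⊤) (hN0 : N ≠ 0) (hN : N ≠ ⊤) (hvm : v ≤ m) (hvN : v * e ≤ N) :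
    v ≤ m ^ (1 - α) * N ^ α * e ^ (-α) := by
  rcases eq_or_ne v 0 with rfl | hv
  · exact zero_le
  have h1 : v ≤ N * e⁻¹ := by
    rw [← div_eq_mul_inv]
    exact (ENNReal.le_div_iff_mul_le (.inr hN0) (.inr hN)).2 hvN
  calc v = v ^ (1 - α) * v ^ α := by
        rw [← ENNReal.rpow_add _ _ hv (ne_top_of_le_ne_top hm hvm)]
        simp
    _ ≤ m ^ (1 - α) * (N * e⁻¹) ^ α :=
        mul_le_mul' (ENNReal.rpow_le_rpow hvm (by linarith)) (ENNReal.rpow_le_rpow h1 hα0.le)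
    _ = _ := by
        rw [ENNReal.mul_rpow_of_nonneg _ _ hα0.le, ENNReal.inv_rpow, ENNReal.rpow_neg, mul_assoc]

/-- The restricted weak type inequality `μ^{1+α} B^{1-α} λ(A) ≲ |E|` underlying
Theorem 3(c): here `d ≥ 3`, `λ` is a compactly supported probability measure on `ℝ^d`
with `λ(B(x,δ)) ≤ C δ^{α'}`, `0 < α < α' < 1`, and for each `x ∈ A` the spherical
averages `S1_E(x,r)` are at least `μ` for all `r` in a set `T_x ⊂ [r_0, R_0]` with
`B ≤ |T_x| ≤ 2B`. -/
theorem stmt_17 (d : ℕ) (hd : 3 ≤ d)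
    (α α' C : ℝ) (hα0 : 0 < α) (hαα' : α < α') (hα' : α' < 1)
    (r0 R0 : ℝ) (hr0 : 0 < r0) (hR0 : r0 < R0)
    (lam : Measure (EuclideanSpace ℝ (Fin d))) [IsProbabilityMeasure lam]
    (hcomp : ∃ K : Set (EuclideanSpace ℝ (Fin d)), IsCompact K ∧ lam Kᶜ = 0)
    (hfrost : ∀ (x : EuclideanSpace ℝ (Fin d)) (δ : ℝ), 0 < δ →
      lam (Metric.ball x δ) ≤ ENNReal.ofReal (C * δ ^ α')) :
    ∃ C' > 0, ∀ E : Set (EuclideanSpace ℝ (Fin d)), MeasurableSet E →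
      ∀ μ B : ℝ, 0 < μ → 0 < B →
      ∀ A : Set (EuclideanSpace ℝ (Fin d)), MeasurableSet A →
      ∀ T : EuclideanSpace ℝ (Fin d) → Set ℝ,
      (∀ x ∈ A, MeasurableSet (T x) ∧ T x ⊆ Set.Icc r0 R0 ∧
        ENNReal.ofReal B ≤ volume (T x) ∧ volume (T x) ≤ ENNReal.ofReal (2 * B) ∧
        ∀ r ∈ T x, μ ≤ sphAvg (Set.indicator E fun _ => 1) x r) →
      ENNReal.ofReal (μ ^ (1 + α) * B ^ (1 - α)) * lam A
        ≤ ENNReal.ofReal C' * volume E := by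
  have : NeZero d := ⟨by omega⟩
  obtain ⟨K₁, hK₁0, hK₁, havg⟩ := exists_le_mul_toSphere_of_le_sphAvg d
  obtain ⟨K₂, hK₂, hbip⟩ := exists_volume_dist_mem_dist_mem_le hd (hr0.trans hR0).le
  obtain ⟨K₃, hK₃, hen⟩ := exists_lintegral_edist_rpow_neg_le lam hα0 hαα' hfrost
  have hα1 : α < 1 := hαα'.trans hα'
  obtain ⟨k, rfl⟩ : ∃ k : NNReal, (k : ℝ≥0∞) = K₁ := ⟨K₁.toNNReal, ENNReal.coe_toNNReal hK₁⟩
  have hk : 0 < (k : ℝ) := NNReal.coe_pos.2 (pos_iff_ne_zero.2 (by simpa using hK₁0))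
  let κ : ℝ := r0 ^ (d - 1) / k
  have hκ : 0 < κ := by positivity
  have hκ0 : ENNReal.ofReal (κ ^ (1 + α)) ≠ 0 := by
    rw [ENNReal.ofReal_ne_zero_iff]
    positivity
  let L : ℝ≥0∞ := (K₂ + 1) ^ α * K₃ / ENNReal.ofReal (κ ^ (1 + α))
  have hL : L ≠ ⊤ := ENNReal.div_ne_top
    (ENNReal.mul_ne_top (ENNReal.rpow_ne_top_of_nonneg hα0.le (by finiteness)) hK₃) hκ0
  refine ⟨L.toReal + 1, by positivity, fun E hE μ B hμ hB A hA T hT => ?_⟩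
  let X := EuclideanSpace ℝ (Fin d)
  let b : ℝ≥0∞ := ENNReal.ofReal (μ / k)
  have hb {x : X} (hx : x ∈ A) {r : ℝ} (hr : r ∈ T x) :
      b ≤ (volume : Measure X).toSphere {ω | x - r • (ω : X) ∈ E} := by
    have h1 := havg E hE μ x r ((hT x hx).2.2.2.2 r hr)
    simp only [b]
    rw [ENNReal.ofReal_div_of_pos hk, ENNReal.ofReal_coe_nnreal]
    exact ENNReal.div_le_of_le_mul' h1
  let c : ℝ≥0∞ := ENNReal.ofReal (r0 ^ (d - 1)) * b
  have hc : c = ENNReal.ofReal (κ * μ) := by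
    simp only [c, b, κ]
    rw [← ENNReal.ofReal_mul (by positivity)]
    congr 1
    ring
  have hc0 : c ≠ 0 := by
    rw [hc, ENNReal.ofReal_ne_zero_iff]
    positivity
  have hctop : c ≠ ⊤ := hc ▸ ENNReal.ofReal_ne_top
  let β : ℝ≥0∞ := ENNReal.ofReal B
  have hβ0 : β ≠ 0 := by
    rw [ENNReal.ofReal_ne_zero_iff]
    exact hB
  let U : Set (X × ℝ) := {p | p.2 ∈ Set.Icc r0 R0 ∧
    b ≤ (volume : Measure X).toSphere {ω | p.1 - p.2 • (ω : X) ∈ E}}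
  have hU : MeasurableSet U := by
    have h1 : Measurable fun q : (X × ℝ) × sphere (0 : X) 1 => q.1.1 - q.1.2 • (q.2 : X) := by
      fun_prop
    exact (measurable_snd measurableSet_Icc).inter
      (measurable_measure_prodMk_left (h1 hE) measurableSet_Ici)
  have hvol (x : X) {S : Set ℝ} (hS : MeasurableSet S) (hSU : ∀ r ∈ S, (x, r) ∈ U) :
      c * volume S ≤ volume {y | y ∈ E ∧ dist x y ∈ S} :=
    mul_volume_le_volume_dist_mem hE hr0 x hS (fun r hr => (hSU r hr).1.1)
      fun r hr => (hSU r hr).2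
  obtain ⟨V, hVU, hV, hVm⟩ := exists_subset_volume_dist_mem_eq hE hU (R := R0)
    (fun p hp => ⟨hr0.le.trans hp.1.1, hp.1.2⟩) (c * β)
  have hVx (x : X) : MeasurableSet {r | (x, r) ∈ V} := measurable_prodMk_left hV
  have hfib {x : X} (hx : x ∈ A) : volume {y | y ∈ E ∧ (x, dist x y) ∈ V} = c * β := by
    obtain ⟨hTm, hTr, hTB, -, -⟩ := hT x hx
    refine hVm x ?_
    calc c * β ≤ c * volume (T x) := by gcongr
      _ ≤ volume {y | y ∈ E ∧ dist x y ∈ T x} :=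
        hvol x hTm fun r hr => ⟨hTr hr, hb hx hr⟩
      _ ≤ volume {y | y ∈ E ∧ (x, dist x y) ∈ U} :=
        measure_mono fun y hy => ⟨hy.1, hTr hy.2, hb hx hy.2⟩
  have hVβ {x : X} (hx : x ∈ A) : volume {r | (x, r) ∈ V} ≤ β := by
    rw [← ENNReal.mul_le_mul_iff_right hc0 hctop, ← hfib hx]
    exact hvol x (hVx x) fun r hr => hVU hr
  let G : Set (X × X) := {p | p.2 ∈ E ∧ (p.1, dist p.1 p.2) ∈ V}
  have hG : MeasurableSet G := by
    have h1 : Measurable fun p : X × X => (p.1, dist p.1 p.2) := by fun_prop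
    exact (measurable_snd hE).inter (h1 hV)
  have hVR (x : X) : {r | (x, r) ∈ V} ⊆ Set.Icc 0 R0 :=
    fun r hr => ⟨hr0.le.trans (hVU hr).1.1, (hVU hr).1.2⟩
  let D : ℝ≥0∞ := (c * β) ^ (1 - α) * ((K₂ + 1) * (β * β)) ^ α
  have hmain : (c * β) ^ 2 * lam A ≤ D * K₃ * volume E := by
    refine sq_mul_measure_le_of_inter_le lam volume hA hE hG (fun p hp => hp.1) ?_
      (fun x hx => (hfib hx).ge) (k := fun x x' => edist x x' ^ (-α)) (fun x _ => hen x)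
      fun x hx x' hx' => ?_
    · exact ENNReal.mul_ne_top
        (ENNReal.rpow_ne_top_of_nonneg (by linarith) (by finiteness))
        (ENNReal.rpow_ne_top_of_nonneg hα0.le (by finiteness))
    · refine ENNReal.le_rpow_mul_rpow_mul_rpow_neg hα0 hα1 (by finiteness) ?_ (by finiteness)
        ((measure_mono Set.inter_subset_left).trans (hfib hx).le) ?_
      · exact mul_ne_zero (by simp) (mul_ne_zero hβ0 hβ0)
      · calc _ ≤ volume {y | dist x y ∈ {r | (x, r) ∈ V} ∧ dist x' y ∈ {r | (x', r) ∈ V}} *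
              edist x x' := by
              gcongr
              exact fun y hy => ⟨hy.1.2, hy.2.2⟩
          _ ≤ K₂ * (volume {r | (x, r) ∈ V} * volume {r | (x', r) ∈ V}) :=
              hbip x x' _ _ (hVx x) (hVx x') (hVR x) (hVR x')
          _ ≤ _ := by
              gcongr
              · exact le_self_add
              · exact hVβ hx
              · exact hVβ hx'
  let w : ℝ := (κ * μ * B) ^ (1 - α) * (B * B) ^ α
  have hw : 0 < w := by positivity
  have hcβ : c * β = ENNReal.ofReal (κ * μ * B) := by
    rw [hc, ← ENNReal.ofReal_mul (by positivity)]
  have hD : D = ENNReal.ofReal w * (K₂ + 1) ^ α := by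
    have hββ : β * β = ENNReal.ofReal (B * B) := (ENNReal.ofReal_mul hB.le).symm
    change (c * β) ^ (1 - α) * ((K₂ + 1) * (β * β)) ^ α = ENNReal.ofReal (_ * _) * _
    rw [hcβ, hββ, ENNReal.mul_rpow_of_nonneg _ _ hα0.le,
      ENNReal.ofReal_mul (p := (κ * μ * B) ^ (1 - α)) (by positivity),
      ← ENNReal.ofReal_rpow_of_pos (by positivity), ← ENNReal.ofReal_rpow_of_pos (by positivity)]
    ring
  have hsq : (c * β) ^ 2 = ENNReal.ofReal w * (ENNReal.ofReal (κ ^ (1 + α)) *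
      ENNReal.ofReal (μ ^ (1 + α) * B ^ (1 - α))) := by
    rw [hcβ, ← ENNReal.ofReal_pow (by positivity), ← ENNReal.ofReal_mul (by positivity),
      ← ENNReal.ofReal_mul hw.le]
    congr 1
    simp only [w]
    have h2 : ∀ t : ℝ, 0 < t → t ^ (1 - α) * t ^ (1 + α) = t ^ 2 := fun t ht => by
      rw [← Real.rpow_add ht, ← Real.rpow_natCast]
      congr 1
      push_cast
      ring
    have h3 : B ^ (1 - α) * B ^ α = B := by
      rw [← Real.rpow_add hB]
      simp
    rw [Real.mul_rpow (by positivity) hB.le, Real.mul_rpow hκ.le hμ.le, Real.mul_rpow hB.le hB.le]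
    calc (κ * μ * B) ^ 2 = κ ^ 2 * μ ^ 2 * (B * B) := by ring
      _ = (κ ^ (1 - α) * κ ^ (1 + α)) * (μ ^ (1 - α) * μ ^ (1 + α)) *
          ((B ^ (1 - α) * B ^ α) * (B ^ (1 - α) * B ^ α)) := by
        rw [h2 κ hκ, h2 μ hμ, h3]
      _ = _ := by ring
  have hfin : ENNReal.ofReal (κ ^ (1 + α)) * (ENNReal.ofReal (μ ^ (1 + α) * B ^ (1 - α)) * lam A)
      ≤ (K₂ + 1) ^ α * K₃ * volume E := by
    rw [← ENNReal.mul_le_mul_iff_right (a := ENNReal.ofReal w)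
      (by rw [ENNReal.ofReal_ne_zero_iff]; exact hw) ENNReal.ofReal_ne_top]
    calc _ = (c * β) ^ 2 * lam A := by rw [hsq]; ring
      _ ≤ _ := hmain
      _ = _ := by rw [hD]; ring
  calc _ ≤ L * volume E := by
        simp only [L]
        rw [ENNReal.mul_div_right_comm]
        rw [← ENNReal.mul_le_mul_iff_right hκ0 ENNReal.ofReal_ne_top]
        refine hfin.trans_eq ?_
        rw [← ENNReal.mul_div_right_comm, ← mul_assoc,
          ENNReal.mul_div_cancel hκ0 ENNReal.ofReal_ne_top]
    _ ≤ _ := by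
        gcongr
        rw [ENNReal.ofReal_add (by positivity) zero_le_one, ENNReal.ofReal_toReal hL]
        exact le_self_add
end

section
/- Let d ≥ 2 and let μ be a nonnegative Borel measure supported on a compact subset of ℝ^d × (0,∞). Suppose for some α ∈ (0, (d−1)/2) that μ({(x,r) : |x − x'| + |r − r'| < δ}) ≤ C δ^α for all (x', r') ∈ ℝ^d × (0,∞) and all δ > 0. Then for every ε > 0 there is a constant C' (depending on C, α, ε, and the support of μ) such that for all Schwartz functions f on ℝ^d the weak-type bound holds: sup_{t > 0} t · μ({(x,r) : |Sf(x,r)| > t})^{1/2} ≤ C' ‖f‖_{W^{2,(1−α)/2+ε}}. -/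
open MeasureTheory Metric

open FourierTransform in
/-- The `L²`-Sobolev norm of order `s`:
`‖f‖_{W^{2,s}} = (∫ (1+|ξ|²)^s |f̂(ξ)|² dξ)^{1/2}`. -/
noncomputable def sobolevNorm {d : ℕ} (s : ℝ) (f : EuclideanSpace ℝ (Fin d) → ℝ) : ℝ :=
  (∫ ξ : EuclideanSpace ℝ (Fin d),
    (1 + ‖ξ‖ ^ 2) ^ s * ‖𝓕 (fun x => (f x : ℂ)) ξ‖ ^ 2) ^ ((1 : ℝ) / 2)

open scoped NNReal ENNReal

section SphereMeasure

lemma lipschitzOnWith_normalize {E : Type*} [NormedAddCommGroup E] [NormedSpace ℝ E] :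
    LipschitzOnWith 2 (fun y : E => ‖y‖⁻¹ • y) {y | 1 ≤ ‖y‖} := by
  refine LipschitzOnWith.of_dist_le_mul fun y hy z hz => ?_
  simp only [Set.mem_ofPred_eq] at hy hz
  have hy0 : 0 < ‖y‖ := by linarith
  have hz0 : 0 < ‖z‖ := by linarith
  rw [dist_eq_norm, dist_eq_norm]
  have h1 : ‖y‖⁻¹ • y - ‖z‖⁻¹ • z = ‖y‖⁻¹ • (y - z) + (‖y‖⁻¹ - ‖z‖⁻¹) • z := by
    rw [smul_sub, sub_smul]; abel
  have h2 : |‖y‖⁻¹ - ‖z‖⁻¹| * ‖z‖ = ‖y‖⁻¹ * |‖z‖ - ‖y‖| := by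
    rw [inv_sub_inv hy0.ne' hz0.ne', abs_div, abs_of_pos (mul_pos hy0 hz0)]
    field_simp
  have h3 : |‖z‖ - ‖y‖| ≤ ‖y - z‖ := by
    rw [abs_sub_comm]; exact abs_norm_sub_norm_le y z
  have h4 : ‖y‖⁻¹ ≤ 1 := inv_le_one_of_one_le₀ hy
  have h5 : 0 < ‖y‖⁻¹ := inv_pos.2 hy0
  calc ‖‖y‖⁻¹ • y - ‖z‖⁻¹ • z‖ ≤ ‖y‖⁻¹ * ‖y - z‖ + |‖y‖⁻¹ - ‖z‖⁻¹| * ‖z‖ := by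
        rw [h1]
        refine (norm_add_le _ _).trans (le_of_eq ?_)
        rw [norm_smul, norm_smul, Real.norm_eq_abs, Real.norm_eq_abs, abs_of_pos h5]
    _ ≤ 1 * ‖y - z‖ + 1 * ‖y - z‖ := by
        rw [h2]; gcongr
    _ = ((2 : ℝ≥0) : ℝ) * ‖y - z‖ := by push_cast; ring

lemma hausdorffMeasure_sphere_lt_top (n : ℕ) :
    μH[(n : ℝ)] (sphere (0 : EuclideanSpace ℝ (Fin (n + 1))) 1) < ∞ := by
  let Q : Set (Fin n → ℝ) := Set.univ.pi fun _ => Set.Icc (-1) 1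
  let φ : Fin (n + 1) → ℝ → (Fin n → ℝ) → EuclideanSpace ℝ (Fin (n + 1)) :=
    fun i s u => WithLp.toLp 2 (i.insertNth s u)
  have hQ : μH[(n : ℝ)] Q < ∞ := by
    have h := hausdorffMeasure_pi_real (ι := Fin n)
    rw [Fintype.card_fin] at h
    rw [h]
    exact (isCompact_univ_pi fun _ => isCompact_Icc).measure_lt_top
  have hφ : ∀ i s, ∃ K, LipschitzWith K (φ i s) := by
    intro i s
    refine ⟨_ * 1, (PiLp.lipschitzWith_toLp 2 _).comp (LipschitzWith.of_dist_le_mul fun u v => ?_)⟩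
    rw [NNReal.coe_one, one_mul]
    refine (dist_pi_le_iff dist_nonneg).2 fun j => ?_
    rcases eq_or_ne j i with rfl | hj
    · simp
    · obtain ⟨k, rfl⟩ := Fin.exists_succAbove_eq hj
      simpa using dist_le_pi_dist u v k
  have hnorm : ∀ i s u, |s| = 1 → 1 ≤ ‖φ i s u‖ := by
    intro i s u hs
    have h := PiLp.norm_apply_le (φ i s u) i
    simpa [φ, hs] using h
  have hfin : ∀ i s, |s| = 1 → μH[(n : ℝ)] ((fun y => ‖y‖⁻¹ • y) '' (φ i s '' Q)) < ∞ := by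
    intro i s hs
    obtain ⟨K, hK⟩ := hφ i s
    have hsub : φ i s '' Q ⊆ {y | 1 ≤ ‖y‖} := by
      rintro _ ⟨u, -, rfl⟩; exact hnorm i s u hs
    refine ((lipschitzOnWith_normalize.mono hsub).hausdorffMeasure_image_le
      (Nat.cast_nonneg n)).trans_lt ?_
    refine ENNReal.mul_lt_top (by finiteness) ?_
    refine (hK.hausdorffMeasure_image_le (Nat.cast_nonneg n) Q).trans_lt ?_
    exact ENNReal.mul_lt_top (by finiteness) hQ
  have hcover : sphere (0 : EuclideanSpace ℝ (Fin (n + 1))) 1 ⊆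
      ⋃ i : Fin (n + 1), ⋃ b : Bool,
        (fun y => ‖y‖⁻¹ • y) '' (φ i (if b then 1 else -1) '' Q) := by
    intro y hy
    have hy1 : ‖y‖ = 1 := by simpa using hy
    obtain ⟨i, -, hi⟩ := Finset.exists_max_image Finset.univ (fun i => |y i|) Finset.univ_nonempty
    have hi0 : 0 < |y i| := by
      by_contra hcon
      have : y = 0 := by
        ext j
        have := hi j (Finset.mem_univ _)
        have : |y j| ≤ 0 := by linarith
        simpa using this
      simp [this] at hy1
    refine Set.mem_iUnion.2 ⟨i, Set.mem_iUnion.2 ⟨decide (0 < y i), ?_⟩⟩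
    let u : Fin n → ℝ := fun k => |y i|⁻¹ * y (i.succAbove k)
    have hz : φ i (if decide (0 < y i) then 1 else -1) u = |y i|⁻¹ • y := by
      ext j
      rcases eq_or_ne j i with rfl | hj
      · by_cases h : 0 < y j
        · simp [φ, h, abs_of_pos h, h.ne']
        · have h' : y j < 0 := lt_of_le_of_ne (not_lt.1 h) (abs_pos.1 hi0)
          simp [φ, h, abs_of_neg h', h'.ne]
      · obtain ⟨k, rfl⟩ := Fin.exists_succAbove_eq hj
        simp [φ, u]
    refine ⟨_, ⟨u, ?_, rfl⟩, ?_⟩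
    · intro k _
      refine abs_le.1 ?_
      simp only [u]
      rw [abs_mul, abs_inv, abs_abs, inv_mul_le_one₀ hi0]
      exact hi _ (Finset.mem_univ _)
    · simp only [hz, norm_smul, hy1, norm_inv, Real.norm_eq_abs, abs_abs, mul_one, inv_inv,
        smul_smul]
      rw [mul_inv_cancel₀ hi0.ne', one_smul]
  refine (measure_mono hcover).trans_lt ?_
  refine (measure_iUnion_le _).trans_lt ?_
  rw [tsum_fintype]
  refine ENNReal.sum_lt_top.2 fun i _ => (measure_iUnion_le _).trans_lt ?_
  rw [tsum_fintype]
  refine ENNReal.sum_lt_top.2 fun b _ => hfin i _ ?_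
  cases b <;> simp

/-- Surface measure on the unit sphere, as a measure on the ambient space. -/
noncomputable def sphMeasure (d : ℕ) : Measure (EuclideanSpace ℝ (Fin d)) :=
  (μH[(d : ℝ) - 1]).restrict (sphere 0 1)

lemma isFiniteMeasure_sphMeasure {d : ℕ} (hd : 2 ≤ d) : IsFiniteMeasure (sphMeasure d) := by
  obtain ⟨n, rfl⟩ : ∃ n, d = n + 1 := ⟨d - 1, by omega⟩
  refine ⟨?_⟩
  rw [sphMeasure, Measure.restrict_apply_univ]
  have h := hausdorffMeasure_sphere_lt_top n
  push_cast
  rwa [add_sub_cancel_right]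

lemma ae_norm_eq_one_sphMeasure (d : ℕ) : ∀ᵐ y ∂(sphMeasure d), ‖y‖ = 1 := by
  filter_upwards [ae_restrict_mem (isClosed_sphere.measurableSet)] with y hy
  simpa using hy

lemma measurePreserving_sphMeasure {d : ℕ}
    (L : EuclideanSpace ℝ (Fin d) ≃ₗᵢ[ℝ] EuclideanSpace ℝ (Fin d)) :
    MeasurePreserving L (sphMeasure d) (sphMeasure d) := by
  have h := (L.toIsometryEquiv.measurePreserving_hausdorffMeasure ((d : ℝ) - 1)).restrict_preimage
    (s := sphere 0 1) isClosed_sphere.measurableSet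
  have hpre : L.toIsometryEquiv ⁻¹' (sphere 0 1) = sphere 0 1 := by
    ext y; simp
  rw [hpre] at h
  exact h

end SphereMeasure

section Decay

lemma exists_abs_le_rpow_of_bessel {g S : ℝ → ℝ} {m : ℝ}
    (hg : ∀ ρ, 0 < ρ → HasDerivAt g (-S ρ) ρ)
    (hS : ∀ ρ, 0 < ρ → HasDerivAt S (g ρ - 2 * m * S ρ / ρ) ρ) :
    ∃ C, 0 ≤ C ∧ ∀ ρ, 1 ≤ ρ → |g ρ| ≤ C * ρ ^ (-m) := by
  set c : ℝ := m * (m - 1) with hc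
  let v : ℝ → ℝ := fun ρ => ρ ^ m * g ρ
  let w : ℝ → ℝ := fun ρ => ρ ^ m * (-S ρ) + m * ρ ^ (m - 1) * g ρ
  have hv : ∀ ρ, 0 < ρ → HasDerivAt v (w ρ) ρ := by
    intro ρ hρ
    refine ((Real.hasDerivAt_rpow_const (p := m) (Or.inl hρ.ne')).mul (hg ρ hρ)).congr_deriv ?_
    simp only [w]; ring
  have hw : ∀ ρ, 0 < ρ → HasDerivAt w ((-1 + c / ρ ^ 2) * v ρ) ρ := by
    intro ρ hρ
    refine (((Real.hasDerivAt_rpow_const (p := m) (Or.inl hρ.ne')).mul (hS ρ hρ).neg).add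
      (((Real.hasDerivAt_rpow_const (p := m - 1) (Or.inl hρ.ne')).const_mul m).mul
        (hg ρ hρ))).congr_deriv ?_
    have e1 : ρ ^ (m - 1) = ρ ^ m / ρ := by rw [Real.rpow_sub hρ, Real.rpow_one]
    have e2 : ρ ^ (m - 1 - 1) = ρ ^ m / ρ ^ 2 := by
      rw [Real.rpow_sub hρ, Real.rpow_one, e1]; field_simp
    simp only [v, e1, e2, hc, Pi.neg_apply]
    field_simp
    ring
  let Φ : ℝ → ℝ := fun ρ => (v ρ ^ 2 + w ρ ^ 2) * Real.exp (|c| / ρ)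
  have hΦ : ∀ ρ, 0 < ρ → HasDerivAt Φ
      ((2 * c * v ρ * w ρ / ρ ^ 2 - |c| * (v ρ ^ 2 + w ρ ^ 2) / ρ ^ 2) * Real.exp (|c| / ρ)) ρ := by
    intro ρ hρ
    refine ((((hv ρ hρ).pow 2).add ((hw ρ hρ).pow 2)).mul
      (((hasDerivAt_inv hρ.ne').const_mul |c|).exp)).congr_deriv ?_
    simp only [Pi.add_apply, Pi.pow_apply, div_eq_mul_inv]
    push_cast
    ring
  have hanti : AntitoneOn Φ (Set.Ici 1) := by
    refine antitoneOn_of_deriv_nonpos (convex_Ici 1) ?_ ?_ ?_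
    · exact fun x hx => (hΦ x (lt_of_lt_of_le one_pos hx)).continuousAt.continuousWithinAt
    · intro x hx
      rw [interior_Ici] at hx
      exact (hΦ x (one_pos.trans hx)).differentiableAt.differentiableWithinAt
    · intro x hx
      rw [interior_Ici] at hx
      rw [(hΦ x (one_pos.trans hx)).deriv, ← sub_div]
      refine mul_nonpos_of_nonpos_of_nonneg (div_nonpos_of_nonpos_of_nonneg ?_ (sq_nonneg _))
        (Real.exp_pos _).le
      have h1 : 2 * c * v x * w x ≤ |c| * |2 * (v x * w x)| := by
        rw [← abs_mul]; refine le_trans (le_of_eq ?_) (le_abs_self _); ring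
      have h2 : |2 * (v x * w x)| ≤ v x ^ 2 + w x ^ 2 := by
        rw [abs_le]; constructor <;> nlinarith [sq_nonneg (v x + w x), sq_nonneg (v x - w x)]
      nlinarith [mul_le_mul_of_nonneg_left h2 (abs_nonneg c)]
  refine ⟨√(Φ 1), Real.sqrt_nonneg _, fun ρ hρ => ?_⟩
  have hρ0 : 0 < ρ := by linarith
  have h1 : v ρ ^ 2 ≤ Φ 1 := by
    refine le_trans ?_ (hanti (Set.mem_Ici.2 le_rfl) (Set.mem_Ici.2 hρ) hρ)
    have : 1 ≤ Real.exp (|c| / ρ) := Real.one_le_exp (by positivity)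
    simp only [Φ]
    nlinarith [sq_nonneg (v ρ), sq_nonneg (w ρ)]
  have h2 : |v ρ| ≤ √(Φ 1) := Real.abs_le_sqrt h1
  have h3 : g ρ = v ρ * ρ ^ (-m) := by
    simp only [v]
    rw [mul_right_comm, ← Real.rpow_add hρ0]; simp
  rw [h3, abs_mul, abs_of_pos (Real.rpow_pos_of_pos hρ0 _)]
  gcongr

lemma hasDerivAt_integral_comp_affine {Y : Type*} [TopologicalSpace Y] [MeasurableSpace Y]
    [BorelSpace Y] {σ : Measure Y} [IsFiniteMeasure σ] {Φ Φ' : ℝ → ℝ}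
    (hΦ : ∀ t, HasDerivAt Φ (Φ' t) t) (hΦ' : Continuous Φ') (hb : ∀ t, |Φ t| ≤ 1)
    (hb' : ∀ t, |Φ' t| ≤ 1) {a b c : Y → ℝ} (ha : Continuous a) (hbc : Continuous b)
    (hc : Continuous c) (ha1 : ∀ᵐ y ∂σ, |a y| ≤ 1) (hc1 : ∀ᵐ y ∂σ, |c y| ≤ 1) (t : ℝ) :
    HasDerivAt (fun t => ∫ y, a y * Φ (b y + t * c y) ∂σ)
      (∫ y, a y * (c y * Φ' (b y + t * c y)) ∂σ) t := by
  have hΦc : Continuous Φ := continuous_iff_continuousAt.2 fun t => (hΦ t).continuousAt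
  refine (hasDerivAt_integral_of_dominated_loc_of_deriv_le (s := Set.univ) (bound := fun _ => 1)
    (F' := fun t y => a y * (c y * Φ' (b y + t * c y))) Filter.univ_mem
    (Filter.Eventually.of_forall fun s => ?_) ?_ ?_ ?_ (integrable_const _) ?_).2
  · exact Measurable.aestronglyMeasurable (Continuous.measurable (by fun_prop))
  · refine Integrable.of_bound (C := 1)
      (Measurable.aestronglyMeasurable (Continuous.measurable (by fun_prop))) ?_
    filter_upwards [ha1] with y hy
    rw [norm_mul, Real.norm_eq_abs, Real.norm_eq_abs]
    exact mul_le_one₀ hy (abs_nonneg _) (hb _)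
  · exact Measurable.aestronglyMeasurable (Continuous.measurable (by fun_prop))
  · filter_upwards [ha1, hc1] with y hy hy' s _
    rw [norm_mul, norm_mul, Real.norm_eq_abs, Real.norm_eq_abs, Real.norm_eq_abs]
    exact mul_le_one₀ hy (by positivity) (mul_le_one₀ hy' (abs_nonneg _) (hb' _))
  · refine Filter.Eventually.of_forall fun y s _ => ?_
    refine (((hΦ _).comp s (((hasDerivAt_id s).mul_const (c y)).const_add (b y))).const_mul
      (a y)).congr_deriv ?_
    simp only [id]; ring

/-- The Fourier transform of a symmetric measure, normalised without the factor `2π`. -/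
noncomputable def cosTransform {d : ℕ} (σ : Measure (EuclideanSpace ℝ (Fin d)))
    (ξ : EuclideanSpace ℝ (Fin d)) : ℝ :=
  ∫ y, Real.cos (inner ℝ y ξ) ∂σ

variable {d : ℕ} {σ : Measure (EuclideanSpace ℝ (Fin d))}

lemma abs_cosTransform_le [IsFiniteMeasure σ] (ξ : EuclideanSpace ℝ (Fin d)) :
    |cosTransform σ ξ| ≤ σ.real Set.univ := by
  have h := norm_integral_le_of_norm_le_const (μ := σ) (C := 1)
    (f := fun y => Real.cos (inner ℝ y ξ))
    (Filter.Eventually.of_forall fun y => Real.abs_cos_le_one _)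
  rwa [one_mul] at h

lemma continuous_cosTransform [IsFiniteMeasure σ] : Continuous (cosTransform σ) := by
  refine continuous_of_dominated (bound := fun _ => 1)
    (fun ξ => Measurable.aestronglyMeasurable (Continuous.measurable (by fun_prop)))
    (fun ξ => Filter.Eventually.of_forall fun y => Real.abs_cos_le_one _) (integrable_const _)
    (Filter.Eventually.of_forall fun y => by fun_prop)

variable
  (hinv : ∀ L : EuclideanSpace ℝ (Fin d) ≃ₗᵢ[ℝ] EuclideanSpace ℝ (Fin d), MeasurePreserving L σ σ)

include hinv in
lemma cosTransform_eq_of_norm_eq {ξ η : EuclideanSpace ℝ (Fin d)} (h : ‖ξ‖ = ‖η‖) :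
    cosTransform σ ξ = cosTransform σ η := by
  let L := (Submodule.span ℝ {ξ - η})ᗮ.reflection
  have hL : L ξ = η := Submodule.reflection_sub h
  have h1 := (hinv L).integral_comp L.toHomeomorph.measurableEmbedding
    (fun y => Real.cos (inner ℝ y η))
  rw [cosTransform, cosTransform, ← h1, ← hL]
  simp only [LinearIsometryEquiv.inner_map_map]

include hinv in
lemma exists_cosTransform_decay [IsFiniteMeasure σ] (hd : 2 ≤ d) (hsupp : ∀ᵐ y ∂σ, ‖y‖ = 1) :
    ∃ C, 0 ≤ C ∧ ∀ β, 0 ≤ β → β ≤ ((d : ℝ) - 1) / 2 → ∀ ξ : EuclideanSpace ℝ (Fin d), ξ ≠ 0 →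
      |cosTransform σ ξ| ≤ C * ‖ξ‖ ^ (-β) := by
  let i₀ : Fin d := ⟨0, by omega⟩
  let e : Fin d → EuclideanSpace ℝ (Fin d) := fun i => EuclideanSpace.single i 1
  have hinner : ∀ (y : EuclideanSpace ℝ (Fin d)) i, inner ℝ y (e i) = y i := by
    intro y i; simp [e, EuclideanSpace.inner_single_right]
  have hcoord : ∀ i, ∀ᵐ y ∂σ, |y i| ≤ 1 := by
    intro i
    filter_upwards [hsupp] with y hy
    rw [← hy]; exact PiLp.norm_apply_le y i
  have hcont : ∀ i, Continuous fun y : EuclideanSpace ℝ (Fin d) => y i := by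
    intro i; fun_prop
  have hcos' : ∀ t : ℝ, |-Real.sin t| ≤ 1 := fun t => by
    rw [abs_neg]; exact Real.abs_sin_le_one t
  let g : ℝ → ℝ := fun ρ => cosTransform σ (ρ • e i₀)
  let S : ℝ → ℝ := fun ρ => ∫ y, y i₀ * Real.sin (ρ * y i₀) ∂σ
  let P : Fin d → ℝ → ℝ := fun i ρ => ∫ y, y i * (y i * Real.cos (ρ * y i₀)) ∂σ
  have hgdef : ∀ ρ, g ρ = ∫ y, Real.cos (ρ * y i₀) ∂σ := by
    intro ρ
    simp only [g, cosTransform, inner_smul_right, hinner]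
  have hg : ∀ ρ, HasDerivAt g (-S ρ) ρ := by
    intro ρ
    have h := hasDerivAt_integral_comp_affine (σ := σ) Real.hasDerivAt_cos
      Real.continuous_sin.neg Real.abs_cos_le_one hcos' (a := fun _ => 1) (b := fun _ => 0)
      continuous_const continuous_const (hcont i₀) (by simp) (hcoord i₀) ρ
    simp only [one_mul, zero_add, mul_neg, integral_neg] at h
    exact h.congr_of_eventuallyEq (Filter.Eventually.of_forall hgdef)
  have hS : ∀ ρ, HasDerivAt S (P i₀ ρ) ρ := by
    intro ρ
    have h := hasDerivAt_integral_comp_affine (σ := σ) Real.hasDerivAt_sin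
      Real.continuous_cos Real.abs_sin_le_one Real.abs_cos_le_one (a := fun y => y i₀)
      (b := fun _ => 0) (hcont i₀) continuous_const (hcont i₀) (hcoord i₀) (hcoord i₀) ρ
    simpa only [zero_add] using h
  have hP : ∀ i, i ≠ i₀ → ∀ ρ, 0 < ρ → P i ρ = S ρ / ρ := by
    intro i hi ρ hρ
    let q : ℝ → ℝ := fun t => √(ρ ^ 2 + t ^ 2)
    have hqpos : ∀ t, 0 < ρ ^ 2 + t ^ 2 := fun t => by positivity
    have hq0 : q 0 = ρ := by simp [q, Real.sqrt_sq hρ.le]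
    have hqne : ∀ t, q t ≠ 0 := fun t => (Real.sqrt_pos.2 (hqpos t)).ne'
    have hq : ∀ t, HasDerivAt q (t / q t) t := by
      intro t
      refine ((((hasDerivAt_id t).pow 2).const_add (ρ ^ 2)).sqrt (hqpos t).ne').congr_deriv ?_
      have h1 : √(ρ ^ 2 + t ^ 2) ≠ 0 := hqne t
      simp only [q, Pi.pow_apply, id]
      push_cast
      field_simp
    have hrad : ∀ t, ∫ y, 1 * Real.cos (ρ * y i₀ + t * y i) ∂σ = g (q t) := by
      intro t
      have h1 : cosTransform σ (ρ • e i₀ + t • e i) = g (q t) := by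
        refine cosTransform_eq_of_norm_eq hinv ?_
        have horth : inner ℝ (ρ • e i₀) (t • e i) = 0 := by
          rw [inner_smul_left, inner_smul_right, hinner]
          simp [e, hi]
        have h2 := norm_add_sq_eq_norm_sq_add_norm_sq_real horth
        rw [norm_smul, Real.norm_eq_abs, abs_of_nonneg (Real.sqrt_nonneg _)]
        have he : ∀ i, ‖e i‖ = 1 := fun i => by simp [e]
        rw [he, mul_one]
        refine (Real.sqrt_mul_self (norm_nonneg _)).symm.trans ?_
        rw [h2, norm_smul, norm_smul, he, he, Real.norm_eq_abs, Real.norm_eq_abs]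
        simp only [mul_one, abs_mul_abs_self, pow_two]
      rw [← h1, cosTransform]
      simp only [one_mul, inner_add_right, inner_smul_right, hinner]
    have hd1 : ∀ t, ∫ y, y i * Real.sin (ρ * y i₀ + t * y i) ∂σ = t * (S (q t) / q t) := by
      intro t
      have hl := hasDerivAt_integral_comp_affine (σ := σ) Real.hasDerivAt_cos
        Real.continuous_sin.neg Real.abs_cos_le_one hcos' (a := fun _ => 1)
        (b := fun y => ρ * y i₀) continuous_const ((hcont i₀).const_mul ρ) (hcont i) (by simp)
        (hcoord i) t
      have hr := (hg (q t)).comp t (hq t)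
      have h := (hl.congr_of_eventuallyEq
        (Filter.Eventually.of_forall fun t => (hrad t).symm)).unique hr
      simp only [one_mul, mul_neg, integral_neg] at h
      rw [← neg_inj, h]; ring
    have hl := hasDerivAt_integral_comp_affine (σ := σ) Real.hasDerivAt_sin
      Real.continuous_cos Real.abs_sin_le_one Real.abs_cos_le_one (a := fun y => y i)
      (b := fun y => ρ * y i₀) (hcont i) ((hcont i₀).const_mul ρ) (hcont i) (hcoord i)
      (hcoord i) 0
    have hr := (hasDerivAt_id (0 : ℝ)).mul
      ((((hS (q 0)).comp (0 : ℝ) (hq 0))).div (hq 0) (hqne 0))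
    have h := (hl.congr_of_eventuallyEq
      (Filter.Eventually.of_forall fun t => (hd1 t).symm)).unique hr
    simp only [zero_mul, add_zero, id, one_mul, Pi.div_apply, Function.comp_apply, hq0] at h
    exact h
  have hsum : ∀ ρ, ∑ i, P i ρ = g ρ := by
    intro ρ
    rw [hgdef, ← integral_finsetSum]
    · refine integral_congr_ae ?_
      filter_upwards [hsupp] with y hy
      have h1 : ∑ i, y i ^ 2 = 1 := by
        rw [← EuclideanSpace.real_norm_sq_eq, hy, one_pow]
      simp only [← mul_assoc, ← pow_two]
      rw [← Finset.sum_mul, h1, one_mul]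
    · intro i _
      refine Integrable.of_bound (C := 1)
        (Measurable.aestronglyMeasurable (Continuous.measurable (by fun_prop))) ?_
      filter_upwards [hcoord i] with y hy
      rw [norm_mul, norm_mul, Real.norm_eq_abs, Real.norm_eq_abs]
      exact mul_le_one₀ hy (by positivity) (mul_le_one₀ hy (abs_nonneg _) (Real.abs_cos_le_one _))
  have hS' : ∀ ρ, 0 < ρ →
      HasDerivAt S (g ρ - 2 * (((d : ℝ) - 1) / 2) * S ρ / ρ) ρ := by
    intro ρ hρ
    refine (hS ρ).congr_deriv ?_
    have h1 := hsum ρ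
    rw [← Finset.add_sum_erase _ _ (Finset.mem_univ i₀),
      Finset.sum_congr rfl fun i hi => hP i (Finset.ne_of_mem_erase hi) ρ hρ, Finset.sum_const,
      Finset.card_erase_of_mem (Finset.mem_univ _), Finset.card_univ, Fintype.card_fin,
      nsmul_eq_mul, Nat.cast_sub (by omega)] at h1
    rw [← h1]; push_cast; ring
  obtain ⟨C, hC0, hC⟩ := exists_abs_le_rpow_of_bessel (fun ρ _ => hg ρ) hS'
  refine ⟨C + σ.real Set.univ, by positivity, fun β hβ0 hβ ξ hξ => ?_⟩
  have hpos : 0 < ‖ξ‖ := norm_pos_iff.2 hξ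
  have hgξ : cosTransform σ ξ = g ‖ξ‖ := by
    refine cosTransform_eq_of_norm_eq hinv ?_
    simp [norm_smul, e]
  rw [hgξ, add_mul]
  rcases le_total 1 ‖ξ‖ with h1 | h1
  · have h2 : ‖ξ‖ ^ (-(((d : ℝ) - 1) / 2)) ≤ ‖ξ‖ ^ (-β) :=
      Real.rpow_le_rpow_of_exponent_le h1 (by linarith)
    have h3 : 0 ≤ σ.real Set.univ * ‖ξ‖ ^ (-β) := by positivity
    linarith [hC _ h1, mul_le_mul_of_nonneg_left h2 hC0]
  · have h2 : 1 ≤ ‖ξ‖ ^ (-β) := Real.one_le_rpow_of_pos_of_le_one_of_nonpos hpos h1 (by linarith)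
    have h3 : 0 ≤ C * ‖ξ‖ ^ (-β) := by positivity
    have h4 : |g ‖ξ‖| ≤ σ.real Set.univ := abs_cosTransform_le _
    nlinarith [measureReal_nonneg (μ := σ) (s := Set.univ)]

end Decay

section Shell

/-- A smooth bump function equal to `1` on `[1, 4]` and supported in `[1/2, 9/2]`. -/
noncomputable def shellBump : ContDiffBump (5 / 2 : ℝ) where
  rIn := 3 / 2
  rOut := 2
  rIn_pos := by norm_num
  rIn_lt_rOut := by norm_num

/-- A smooth radial weight equal to `1` on the shell `1 ≤ ‖ξ‖ ≤ 2`. -/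
noncomputable def shellWeight (d : ℕ) (ξ : EuclideanSpace ℝ (Fin d)) : ℝ :=
  shellBump (‖ξ‖ ^ 2)

/-- Lebesgue measure smoothly localised to frequencies `‖ξ‖ ∼ R`. -/
noncomputable def shellMeasure (d : ℕ) (R : ℝ) : Measure (EuclideanSpace ℝ (Fin d)) :=
  volume.withDensity fun ξ => ENNReal.ofReal (shellWeight d (R⁻¹ • ξ))

variable {d : ℕ}

lemma contDiff_shellWeight : ContDiff ℝ (⊤ : ℕ∞) (shellWeight d) :=
  shellBump.contDiff.comp (contDiff_norm_sq ℝ)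

lemma shellWeight_nonneg (ξ : EuclideanSpace ℝ (Fin d)) : 0 ≤ shellWeight d ξ :=
  shellBump.nonneg

lemma measurable_shellWeight_smul (R : ℝ) :
    Measurable fun ξ : EuclideanSpace ℝ (Fin d) => shellWeight d (R⁻¹ • ξ) :=
  Continuous.measurable (contDiff_shellWeight.continuous.comp (continuous_const_smul _))

lemma shellWeight_eq_zero {ξ : EuclideanSpace ℝ (Fin d)} (h : ‖ξ‖ < 1 / 2 ∨ 3 < ‖ξ‖) :
    shellWeight d ξ = 0 := by
  refine shellBump.zero_of_le_dist ?_
  have hrOut : shellBump.rOut = 2 := rfl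
  rw [hrOut, Real.dist_eq]
  rcases h with h | h
  · rw [le_abs]; right; nlinarith [norm_nonneg ξ]
  · rw [le_abs]; left; nlinarith [norm_nonneg ξ]

lemma shellWeight_eq_one {ξ : EuclideanSpace ℝ (Fin d)} (h : 1 ≤ ‖ξ‖) (h' : ‖ξ‖ ≤ 2) :
    shellWeight d ξ = 1 := by
  refine shellBump.one_of_mem_closedBall ?_
  have hrIn : shellBump.rIn = 3 / 2 := rfl
  rw [mem_closedBall, hrIn, Real.dist_eq, abs_le]
  constructor <;> nlinarith [norm_nonneg ξ]

lemma hasCompactSupport_shellWeight : HasCompactSupport (shellWeight d) := by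
  refine HasCompactSupport.intro (isCompact_closedBall 0 3) fun ξ hξ => ?_
  refine shellWeight_eq_zero (Or.inr ?_)
  simpa using hξ

lemma integrable_shellWeight : Integrable (shellWeight d) :=
  contDiff_shellWeight.continuous.integrable_of_hasCompactSupport hasCompactSupport_shellWeight

lemma integral_shellWeight_smul {R : ℝ} (hR : 0 < R) :
    ∫ ξ, shellWeight d (R⁻¹ • ξ) = R ^ d * ∫ ξ, shellWeight d ξ := by
  rw [Measure.integral_comp_inv_smul, finrank_euclideanSpace_fin, abs_of_pos (pow_pos hR d),
    smul_eq_mul]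

lemma shellMeasure_univ {R : ℝ} (hR : 0 < R) :
    shellMeasure d R Set.univ = ENNReal.ofReal (R ^ d * ∫ ξ, shellWeight d ξ) := by
  rw [shellMeasure, withDensity_apply _ MeasurableSet.univ, Measure.restrict_univ,
    ← integral_shellWeight_smul hR, ofReal_integral_eq_lintegral_ofReal]
  · exact (integrable_comp_smul_iff volume _ (inv_ne_zero hR.ne')).2 integrable_shellWeight
  · exact Filter.Eventually.of_forall fun ξ => shellWeight_nonneg _

lemma isFiniteMeasure_shellMeasure {R : ℝ} (hR : 0 < R) : IsFiniteMeasure (shellMeasure d R) :=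
  ⟨by rw [shellMeasure_univ hR]; exact ENNReal.ofReal_lt_top⟩

lemma shellMeasure_real_univ {R : ℝ} (hR : 0 < R) :
    (shellMeasure d R).real Set.univ = R ^ d * ∫ ξ, shellWeight d ξ := by
  rw [Measure.real, shellMeasure_univ hR, ENNReal.toReal_ofReal]
  exact mul_nonneg (pow_pos hR d).le (integral_nonneg fun ξ => shellWeight_nonneg ξ)

lemma ae_le_norm_shellMeasure {R : ℝ} (hR : 0 < R) :
    ∀ᵐ ξ ∂(shellMeasure d R), R / 2 ≤ ‖ξ‖ := by
  rw [shellMeasure, ae_withDensity_iff (measurable_shellWeight_smul R).ennreal_ofReal]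
  refine Filter.Eventually.of_forall fun ξ hξ => ?_
  by_contra! hcon
  refine hξ ?_
  rw [shellWeight_eq_zero, ENNReal.ofReal_zero]
  left
  rw [norm_smul, norm_inv, Real.norm_eq_abs, abs_of_pos hR, inv_mul_lt_iff₀ hR]
  linarith

lemma measurePreserving_shellMeasure (R : ℝ)
    (L : EuclideanSpace ℝ (Fin d) ≃ₗᵢ[ℝ] EuclideanSpace ℝ (Fin d)) :
    MeasurePreserving L (shellMeasure d R) (shellMeasure d R) := by
  refine ⟨L.continuous.measurable, Measure.ext fun s hs => ?_⟩
  rw [Measure.map_apply L.continuous.measurable hs, shellMeasure,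
    withDensity_apply _ (L.continuous.measurable hs), withDensity_apply _ hs,
    ← L.measurePreserving.setLIntegral_comp_preimage hs
      (measurable_shellWeight_smul R).ennreal_ofReal]
  simp only [shellWeight, norm_smul, LinearIsometryEquiv.norm_map]

lemma restrict_le_shellMeasure {R : ℝ} (hR : 0 < R) :
    volume.restrict {ξ : EuclideanSpace ℝ (Fin d) | R ≤ ‖ξ‖ ∧ ‖ξ‖ ≤ 2 * R} ≤ shellMeasure d R := by
  have hms : MeasurableSet {ξ : EuclideanSpace ℝ (Fin d) | R ≤ ‖ξ‖ ∧ ‖ξ‖ ≤ 2 * R} :=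
    (measurableSet_le measurable_const measurable_norm).inter
      (measurableSet_le measurable_norm measurable_const)
  rw [← withDensity_indicator_one hms]
  refine withDensity_mono (Filter.Eventually.of_forall fun ξ => ?_)
  by_cases h : R ≤ ‖ξ‖ ∧ ‖ξ‖ ≤ 2 * R
  · rw [Set.indicator_of_mem (by exact h)]
    simp only [Pi.one_apply]
    rw [shellWeight_eq_one, ENNReal.ofReal_one]
    · rw [norm_smul, norm_inv, Real.norm_eq_abs, abs_of_pos hR, le_inv_mul_iff₀ hR]
      linarith
    · rw [norm_smul, norm_inv, Real.norm_eq_abs, abs_of_pos hR, inv_mul_le_iff₀ hR]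
      linarith
  · rw [Set.indicator_of_notMem (by exact h)]; exact zero_le

lemma exists_shellMeasure_fourier_decay (d N : ℕ) :
    ∃ C, 0 ≤ C ∧ ∀ R, 0 < R → ∀ w : EuclideanSpace ℝ (Fin d),
      (R * ‖w‖) ^ N * ‖∫ ξ, Complex.exp (↑(2 * Real.pi * inner ℝ w ξ) * Complex.I)
        ∂(shellMeasure d R)‖ ≤ C * R ^ d := by
  have hc : HasCompactSupport fun ξ => (shellWeight d ξ : ℂ) :=
    hasCompactSupport_shellWeight.comp_left (g := fun x : ℝ => (x : ℂ)) Complex.ofReal_zero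
  have hs : ContDiff ℝ (⊤ : ℕ∞) fun ξ => (shellWeight d ξ : ℂ) :=
    Complex.ofRealCLM.contDiff.comp contDiff_shellWeight
  let Ψ : SchwartzMap (EuclideanSpace ℝ (Fin d)) ℂ := hc.toSchwartzMap hs
  have hΨ : ∀ ξ, Ψ ξ = (shellWeight d ξ : ℂ) := fun ξ => rfl
  obtain ⟨C, hC0, hC⟩ := (FourierTransform.fourierInv Ψ).decay N 0
  refine ⟨C, hC0.le, fun R hR w => ?_⟩
  have h1 : ∫ ξ, Complex.exp (↑(2 * Real.pi * inner ℝ w ξ) * Complex.I) ∂(shellMeasure d R)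
      = R ^ d • FourierTransform.fourierInv Ψ (R • w) := by
    rw [shellMeasure, integral_withDensity_eq_integral_toReal_smul
      (measurable_shellWeight_smul R).ennreal_ofReal
      (Filter.Eventually.of_forall fun ξ => ENNReal.ofReal_lt_top)]
    rw [SchwartzMap.fourierInv_coe, Real.fourierInv_eq']
    have h2 := Measure.integral_comp_inv_smul (volume : Measure (EuclideanSpace ℝ (Fin d)))
      (fun v => Complex.exp (↑(2 * Real.pi * inner ℝ v (R • w)) * Complex.I) • Ψ v) R
    rw [finrank_euclideanSpace_fin, abs_of_pos (pow_pos hR d)] at h2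
    rw [← h2]
    refine integral_congr_ae (Filter.Eventually.of_forall fun ξ => ?_)
    simp only [hΨ, inner_smul_left, inner_smul_right, ENNReal.toReal_ofReal (shellWeight_nonneg _),
      real_inner_comm w ξ]
    rw [Complex.real_smul, smul_eq_mul, mul_comm]
    congr 4
    simp only [conj_trivial]
    field_simp
  rw [h1, norm_smul, Real.norm_eq_abs, abs_of_pos (pow_pos hR d)]
  have h3 := hC (R • w)
  rw [norm_iteratedFDeriv_zero, norm_smul, Real.norm_eq_abs, abs_of_pos hR] at h3
  calc _ = R ^ d * ((R * ‖w‖) ^ N * ‖FourierTransform.fourierInv Ψ (R • w)‖) := by ring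
    _ ≤ R ^ d * C := by gcongr
    _ = C * R ^ d := mul_comm _ _

end Shell

section Kernel

variable {d : ℕ}

/-- The character `ξ ↦ exp(2πi⟨x, ξ⟩)`. -/
noncomputable def planeWave (x ξ : EuclideanSpace ℝ (Fin d)) : ℂ :=
  Complex.exp (↑(2 * Real.pi * inner ℝ x ξ) * Complex.I)

lemma norm_planeWave (x ξ : EuclideanSpace ℝ (Fin d)) : ‖planeWave x ξ‖ = 1 :=
  Complex.norm_exp_ofReal_mul_I _

lemma planeWave_add (x y ξ : EuclideanSpace ℝ (Fin d)) :
    planeWave (x + y) ξ = planeWave x ξ * planeWave y ξ := by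
  rw [planeWave, planeWave, planeWave, ← Complex.exp_add, inner_add_left]
  push_cast; ring_nf

lemma conj_planeWave (x ξ : EuclideanSpace ℝ (Fin d)) :
    (starRingEnd ℂ) (planeWave x ξ) = planeWave (-x) ξ := by
  rw [planeWave, planeWave, ← Complex.exp_conj, map_mul, Complex.conj_I, Complex.conj_ofReal,
    inner_neg_left]
  push_cast; ring_nf

@[fun_prop]
lemma Continuous.planeWave {X : Type*} [TopologicalSpace X] {f g : X → EuclideanSpace ℝ (Fin d)}
    (hf : Continuous f) (hg : Continuous g) : Continuous fun x => planeWave (f x) (g x) := by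
  unfold _root_.planeWave
  fun_prop

variable {σ : Measure (EuclideanSpace ℝ (Fin d))} [IsFiniteMeasure σ]
  (hinv : ∀ L : EuclideanSpace ℝ (Fin d) ≃ₗᵢ[ℝ] EuclideanSpace ℝ (Fin d), MeasurePreserving L σ σ)

include hinv in
lemma integral_planeWave_smul (s : ℝ) (ξ : EuclideanSpace ℝ (Fin d)) :
    ∫ y, planeWave (s • y) ξ ∂σ = (cosTransform σ ((2 * Real.pi * s) • ξ) : ℂ) := by
  have hsin : ∫ y, Real.sin (inner ℝ y ((2 * Real.pi * s) • ξ)) ∂σ = 0 := by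
    let L := LinearIsometryEquiv.neg ℝ (E := EuclideanSpace ℝ (Fin d))
    have h := (hinv L).integral_comp L.toHomeomorph.measurableEmbedding
      (fun y => Real.sin (inner ℝ y ((2 * Real.pi * s) • ξ)))
    simp only [L, LinearIsometryEquiv.coe_neg, inner_neg_left, Real.sin_neg,
      integral_neg] at h
    linarith
  have hexp : ∀ y : EuclideanSpace ℝ (Fin d), planeWave (s • y) ξ =
      (Real.cos (inner ℝ y ((2 * Real.pi * s) • ξ)) : ℂ) +
        (Real.sin (inner ℝ y ((2 * Real.pi * s) • ξ)) : ℂ) * Complex.I := by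
    intro y
    rw [planeWave, Complex.exp_mul_I, Complex.ofReal_cos, Complex.ofReal_sin]
    have h1 : inner ℝ y ((2 * Real.pi * s) • ξ) = 2 * Real.pi * inner ℝ (s • y) ξ := by
      rw [real_inner_smul_left, real_inner_smul_right]; ring
    rw [h1]
  simp only [hexp]
  rw [integral_add, integral_mul_const, integral_complex_ofReal, integral_complex_ofReal, hsin,
    cosTransform]
  · simp
  · refine Integrable.of_bound (C := 1)
      (Measurable.aestronglyMeasurable (Continuous.measurable (by fun_prop)))
      (Filter.Eventually.of_forall fun y => ?_)
    rw [Complex.norm_real]; exact Real.abs_cos_le_one _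
  · refine Integrable.of_bound (C := 1)
      (Measurable.aestronglyMeasurable (Continuous.measurable (by fun_prop)))
      (Filter.Eventually.of_forall fun y => ?_)
    rw [norm_mul, Complex.norm_real, Complex.norm_I, mul_one]; exact Real.abs_sin_le_one _

/-- The `TT*` kernel of the spherical averages, localised to frequencies `‖ξ‖ ∼ R`. -/
noncomputable def shellKernel (σ : Measure (EuclideanSpace ℝ (Fin d))) (R : ℝ)
    (z : EuclideanSpace ℝ (Fin d)) (r r' : ℝ) : ℂ :=
  ∫ ξ, planeWave z ξ * (cosTransform σ ((2 * Real.pi * r) • ξ) *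
    cosTransform σ ((2 * Real.pi * r') • ξ) : ℝ) ∂(shellMeasure d R)

omit [IsFiniteMeasure σ] in
lemma abs_cosTransform_smul_le {C₀ m : ℝ}
    (hdec : ∀ β, 0 ≤ β → β ≤ m → ∀ ξ : EuclideanSpace ℝ (Fin d), ξ ≠ 0 →
      |cosTransform σ ξ| ≤ C₀ * ‖ξ‖ ^ (-β)) (hC₀ : 0 ≤ C₀) {β a R r : ℝ} (hβ : 0 ≤ β) (hβm : β ≤ m)
    (ha : 0 < a) (hR : 0 < R) (har : a ≤ r) {ξ : EuclideanSpace ℝ (Fin d)} (hξ : R / 2 ≤ ‖ξ‖) :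
    |cosTransform σ ((2 * Real.pi * r) • ξ)| ≤ C₀ * (a * R) ^ (-β) := by
  have hr : 0 < r := ha.trans_le har
  have hnorm : a * R ≤ ‖(2 * Real.pi * r) • ξ‖ := by
    rw [norm_smul, Real.norm_eq_abs, abs_of_pos (by positivity)]
    calc a * R ≤ r * R := by gcongr
      _ = 2 * 1 * r * (R / 2) := by ring
      _ ≤ 2 * Real.pi * r * ‖ξ‖ := by
        gcongr
        linarith [Real.pi_gt_three]
  have h0 : 0 < a * R := by positivity
  refine (hdec β hβ hβm _ (norm_pos_iff.1 (h0.trans_le hnorm))).trans ?_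
  exact mul_le_mul_of_nonneg_left
    (Real.rpow_le_rpow_of_nonpos h0 hnorm (by linarith)) hC₀

omit [IsFiniteMeasure σ] in
lemma norm_shellKernel_le {C₀ m : ℝ}
    (hdec : ∀ β, 0 ≤ β → β ≤ m → ∀ ξ : EuclideanSpace ℝ (Fin d), ξ ≠ 0 →
      |cosTransform σ ξ| ≤ C₀ * ‖ξ‖ ^ (-β)) (hC₀ : 0 ≤ C₀) {a R r r' : ℝ} (hm : 0 ≤ m)
    (ha : 0 < a) (hR : 0 < R) (har : a ≤ r) (har' : a ≤ r') (z : EuclideanSpace ℝ (Fin d)) :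
    ‖shellKernel σ R z r r'‖ ≤ (C₀ * (a * R) ^ (-m)) ^ 2 * (shellMeasure d R).real Set.univ := by
  have := isFiniteMeasure_shellMeasure (d := d) hR
  refine norm_integral_le_of_norm_le_const ?_
  filter_upwards [ae_le_norm_shellMeasure hR] with ξ hξ
  rw [norm_mul, norm_planeWave, one_mul, Complex.norm_real, norm_mul, pow_two]
  exact mul_le_mul (abs_cosTransform_smul_le hdec hC₀ hm le_rfl ha hR har hξ)
    (abs_cosTransform_smul_le hdec hC₀ hm le_rfl ha hR har' hξ) (norm_nonneg _) (by positivity)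

include hinv in
omit [IsFiniteMeasure σ] in
lemma shellKernel_eq_of_norm_eq (R : ℝ) {z w : EuclideanSpace ℝ (Fin d)} (r r' : ℝ)
    (h : ‖z‖ = ‖w‖) : shellKernel σ R z r r' = shellKernel σ R w r r' := by
  let L := (Submodule.span ℝ {z - w})ᗮ.reflection
  have hL : L z = w := Submodule.reflection_sub h
  have h1 := (measurePreserving_shellMeasure R L).integral_comp L.toHomeomorph.measurableEmbedding
    (fun ξ => planeWave w ξ * (cosTransform σ ((2 * Real.pi * r) • ξ) *
      cosTransform σ ((2 * Real.pi * r') • ξ) : ℝ))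
  rw [shellKernel, shellKernel, ← h1, ← hL]
  have h2 : ∀ (c : ℝ) ξ, cosTransform σ (c • L ξ) = cosTransform σ (c • ξ) := fun c ξ =>
    cosTransform_eq_of_norm_eq hinv (by rw [norm_smul, norm_smul, L.norm_map])
  simp only [h2, planeWave, LinearIsometryEquiv.inner_map_map]

include hinv in
lemma integral_shellKernel (hsupp : ∀ᵐ y ∂σ, ‖y‖ = 1) {R : ℝ} (hR : 0 < R)
    (z : EuclideanSpace ℝ (Fin d)) (r r' : ℝ) :
    (σ.real Set.univ : ℂ) * shellKernel σ R z r r' =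
      ∫ ξ, ((cosTransform σ ((2 * Real.pi * ‖z‖) • ξ) * (cosTransform σ ((2 * Real.pi * r) • ξ) *
        cosTransform σ ((2 * Real.pi * r') • ξ)) : ℝ) : ℂ) ∂(shellMeasure d R) := by
  have := isFiniteMeasure_shellMeasure (d := d) hR
  have hc := continuous_cosTransform (σ := σ)
  have h1 : ∫ y, shellKernel σ R (‖z‖ • y) r r' ∂σ =
      (σ.real Set.univ : ℂ) * shellKernel σ R z r r' := by
    rw [← Complex.real_smul, ← integral_const]
    refine integral_congr_ae ?_
    filter_upwards [hsupp] with y hy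
    refine shellKernel_eq_of_norm_eq hinv R r r' ?_
    rw [norm_smul, hy, norm_norm, mul_one]
  rw [← h1]
  unfold shellKernel
  rw [integral_integral_swap]
  · refine integral_congr_ae (Filter.Eventually.of_forall fun ξ => ?_)
    simp only
    rw [integral_mul_const, integral_planeWave_smul hinv, ← Complex.ofReal_mul]
  · refine Integrable.of_bound (C := σ.real Set.univ * σ.real Set.univ)
      (Measurable.aestronglyMeasurable (Continuous.measurable (by fun_prop)))
      (Filter.Eventually.of_forall fun p => ?_)
    simp only [Function.uncurry]
    rw [norm_mul, norm_planeWave, one_mul, Complex.norm_real, norm_mul]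
    exact mul_le_mul (abs_cosTransform_le _) (abs_cosTransform_le _) (norm_nonneg _)
      measureReal_nonneg

include hinv in
lemma norm_shellKernel_le_of_ne {C₀ m : ℝ} (hsupp : ∀ᵐ y ∂σ, ‖y‖ = 1)
    (hdec : ∀ β, 0 ≤ β → β ≤ m → ∀ ξ : EuclideanSpace ℝ (Fin d), ξ ≠ 0 →
      |cosTransform σ ξ| ≤ C₀ * ‖ξ‖ ^ (-β)) (hC₀ : 0 ≤ C₀) {a R r r' β : ℝ} (hβ : 0 ≤ β)
    (hβm : β ≤ m) (ha : 0 < a) (hR : 0 < R) (har : a ≤ r) (har' : a ≤ r')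
    {z : EuclideanSpace ℝ (Fin d)} (hz : z ≠ 0) :
    σ.real Set.univ * ‖shellKernel σ R z r r'‖ ≤
      C₀ * (‖z‖ * R) ^ (-β) * (C₀ * (a * R) ^ (-m)) ^ 2 * (shellMeasure d R).real Set.univ := by
  have := isFiniteMeasure_shellMeasure (d := d) hR
  have h1 : σ.real Set.univ * ‖shellKernel σ R z r r'‖ =
      ‖(σ.real Set.univ : ℂ) * shellKernel σ R z r r'‖ := by
    rw [norm_mul, Complex.norm_real, Real.norm_of_nonneg measureReal_nonneg]
  rw [h1, integral_shellKernel hinv hsupp hR]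
  refine norm_integral_le_of_norm_le_const ?_
  filter_upwards [ae_le_norm_shellMeasure hR] with ξ hξ
  have hm : 0 ≤ m := hβ.trans hβm
  rw [Complex.norm_real, norm_mul, norm_mul, pow_two]
  have hz' : 0 < ‖z‖ := norm_pos_iff.2 hz
  refine mul_le_mul (abs_cosTransform_smul_le hdec hC₀ hβ hβm hz' hR le_rfl hξ)
    (mul_le_mul (abs_cosTransform_smul_le hdec hC₀ hm le_rfl ha hR har hξ)
    (abs_cosTransform_smul_le hdec hC₀ hm le_rfl ha hR har' hξ) (norm_nonneg _) (by positivity))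
    (by positivity) (by positivity)

include hinv in
lemma shellKernel_eq_integral {R : ℝ} (hR : 0 < R) (z : EuclideanSpace ℝ (Fin d)) (r r' : ℝ) :
    shellKernel σ R z r r' =
      ∫ q, ∫ ξ, planeWave (z + r • q.1 + r' • q.2) ξ ∂(shellMeasure d R) ∂(σ.prod σ) := by
  have := isFiniteMeasure_shellMeasure (d := d) hR
  rw [integral_integral_swap, shellKernel]
  · refine integral_congr_ae (Filter.Eventually.of_forall fun ξ => ?_)
    simp only [planeWave_add, mul_assoc (planeWave z ξ)]
    rw [integral_const_mul,
      integral_prod_mul (fun y => planeWave (r • y) ξ) (fun y => planeWave (r' • y) ξ),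
      integral_planeWave_smul hinv, integral_planeWave_smul hinv, ← Complex.ofReal_mul]
  · refine Integrable.of_bound (C := 1)
      (Measurable.aestronglyMeasurable (Continuous.measurable (by fun_prop)))
      (Filter.Eventually.of_forall fun p => ?_)
    simp only [Function.uncurry]
    rw [norm_planeWave]

include hinv in
lemma norm_shellKernel_le_of_separated (hsupp : ∀ᵐ y ∂σ, ‖y‖ = 1) {N : ℕ} {C₁ : ℝ}
    (hC₁ : ∀ R, 0 < R → ∀ w : EuclideanSpace ℝ (Fin d),
      (R * ‖w‖) ^ N * ‖∫ ξ, planeWave w ξ ∂(shellMeasure d R)‖ ≤ C₁ * R ^ d)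
    {R r r' : ℝ} (hR : 0 < R) (hr : 0 < r) (hr' : 0 < r') {z : EuclideanSpace ℝ (Fin d)}
    (hne : r ≠ r') (hz : ‖z‖ ≤ |r - r'| / 2) :
    ‖shellKernel σ R z r r'‖ ≤
      C₁ * R ^ d * ((R * (|r - r'| / 2)) ^ N)⁻¹ * (σ.prod σ).real Set.univ := by
  rw [shellKernel_eq_integral hinv hR]
  refine norm_integral_le_of_norm_le_const ?_
  have hδ : 0 < |r - r'| := abs_pos.2 (sub_ne_zero.2 hne)
  have h1 : ∀ᵐ q ∂(σ.prod σ), ‖q.1‖ = 1 := Measure.quasiMeasurePreserving_fst.ae hsupp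
  have h2 : ∀ᵐ q ∂(σ.prod σ), ‖q.2‖ = 1 := Measure.quasiMeasurePreserving_snd.ae hsupp
  filter_upwards [h1, h2] with q hq1 hq2
  have hsep : |r - r'| / 2 ≤ ‖z + r • q.1 + r' • q.2‖ := by
    have e1 : ‖r • q.1‖ = r := by rw [norm_smul, hq1, Real.norm_of_nonneg hr.le, mul_one]
    have e2 : ‖r' • q.2‖ = r' := by rw [norm_smul, hq2, Real.norm_of_nonneg hr'.le, mul_one]
    have e3 : |r - r'| ≤ ‖r • q.1 + r' • q.2‖ := by
      have := abs_norm_sub_norm_le (r • q.1) (-(r' • q.2))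
      rwa [norm_neg, e1, e2, sub_neg_eq_add] at this
    have e4 : ‖r • q.1 + r' • q.2‖ ≤ ‖z + r • q.1 + r' • q.2‖ + ‖z‖ := by
      refine (norm_sub_le _ z).trans' (le_of_eq ?_)
      congr 1; abel
    linarith
  have hpos : 0 < (R * (|r - r'| / 2)) ^ N := by positivity
  rw [← div_eq_mul_inv, le_div_iff₀' hpos]
  refine le_trans ?_ (hC₁ R hR (z + r • q.1 + r' • q.2))
  gcongr

lemma le_of_le_mul_pow_of_le {x B R X β η : ℝ} {N d : ℕ} (hx : 0 ≤ x) (hB : 0 ≤ B) (hR : 1 ≤ R)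
    (hX : 0 < X) (hN : 0 < N) (hβ : 0 ≤ β) (hβN : β ≤ N) (hη : ((d : ℝ) - 1) * β ≤ η * N)
    (h1 : x ≤ B * R) (h2 : x ≤ B * R ^ d * (X ^ N)⁻¹) : x ≤ B * R ^ (1 + η) * X ^ (-β) := by
  have hN' : (0 : ℝ) < N := by exact_mod_cast hN
  have hR0 : 0 < R := by linarith
  set θ : ℝ := β / N with hθ
  have hθ0 : 0 ≤ θ := by positivity
  have hθ1 : θ ≤ 1 := (div_le_one hN').2 hβN
  have hXN : ((X ^ N)⁻¹) ^ θ = X ^ (-β) := by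
    rw [← Real.rpow_natCast, ← Real.rpow_neg hX.le, ← Real.rpow_mul hX.le, hθ]
    congr 1; field_simp
  calc x = x ^ (1 - θ) * x ^ θ := by
        rw [← Real.rpow_add_of_nonneg hx (by linarith) hθ0, sub_add_cancel, Real.rpow_one]
    _ ≤ (B * R) ^ (1 - θ) * (B * R ^ d * (X ^ N)⁻¹) ^ θ := by
        gcongr
    _ = (B ^ (1 - θ) * B ^ θ) * (R ^ (1 - θ) * R ^ (d * θ)) * X ^ (-β) := by
        rw [Real.mul_rpow hB hR0.le, Real.mul_rpow (by positivity) (by positivity),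
          Real.mul_rpow hB (by positivity), hXN, Real.rpow_mul hR0.le, Real.rpow_natCast]
        ring
    _ = B * R ^ (1 + (d - 1) * θ) * X ^ (-β) := by
        rw [← Real.rpow_add_of_nonneg hB (by linarith) hθ0, sub_add_cancel, Real.rpow_one,
          ← Real.rpow_add hR0]
        ring_nf
    _ ≤ B * R ^ (1 + η) * X ^ (-β) := by
        gcongr
        rw [hθ, ← mul_div_assoc, div_le_iff₀ hN']; exact hη

include hinv in
lemma exists_shellKernel_bound (hd : 2 ≤ d) (hsupp : ∀ᵐ y ∂σ, ‖y‖ = 1) {a β η : ℝ} (ha : 0 < a)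
    (hβ : 0 ≤ β) (hβm : β ≤ ((d : ℝ) - 1) / 2) (hη : 0 < η) :
    ∃ C, 0 ≤ C ∧ ∀ R, 1 ≤ R → ∀ r r', a ≤ r → a ≤ r' → ∀ z : EuclideanSpace ℝ (Fin d),
      0 < ‖z‖ + |r - r'| →
      ‖shellKernel σ R z r r'‖ ≤ C * R ^ (1 + η) * (R * (‖z‖ + |r - r'|)) ^ (-β) := by
  obtain ⟨C₀, hC₀, hdec⟩ := exists_cosTransform_decay hinv hd hsupp
  set m : ℝ := ((d : ℝ) - 1) / 2 with hm
  have hm0 : 0 ≤ m := hβ.trans hβm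
  obtain ⟨N, hN⟩ := exists_nat_ge (max 1 (max β (((d : ℝ) - 1) * β / η)))
  obtain ⟨C₁, hC₁, hdecφ⟩ := exists_shellMeasure_fourier_decay d N
  have hN1 : 1 ≤ N := by exact_mod_cast (le_max_left _ _).trans hN
  have hNβ : β ≤ N := (le_max_left _ _).trans ((le_max_right _ _).trans hN)
  have hNη : ((d : ℝ) - 1) * β ≤ η * N := by
    have := (le_max_right _ _).trans ((le_max_right _ _).trans hN)
    rwa [div_le_iff₀ hη, mul_comm (N : ℝ)] at this
  set c : ℝ := ∫ ξ, shellWeight d ξ with hc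
  have hc0 : 0 ≤ c := integral_nonneg fun ξ => shellWeight_nonneg ξ
  set M : ℝ := σ.real Set.univ with hM
  have hM0 : 0 ≤ M := measureReal_nonneg
  set A : ℝ := C₀ ^ 2 * (a ^ (-m)) ^ 2 * c with hA
  have hA0 : 0 ≤ A := by positivity
  have hAR : ∀ R, 0 < R →
      (C₀ * (a * R) ^ (-m)) ^ 2 * (shellMeasure d R).real Set.univ = A * R := by
    intro R hR
    have h1 : (R ^ (-m)) ^ 2 * R ^ d = R := by
      rw [← Real.rpow_natCast, ← Real.rpow_natCast, ← Real.rpow_mul hR.le, ← Real.rpow_add hR, hm]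
      convert Real.rpow_one R using 2
      push_cast; ring
    rw [shellMeasure_real_univ hR, Real.mul_rpow ha.le hR.le, hA]
    calc _ = C₀ ^ 2 * (a ^ (-m)) ^ 2 * c * ((R ^ (-m)) ^ 2 * R ^ d) := by ring
      _ = _ := by rw [h1]
  set B : ℝ := max A (C₁ * (σ.prod σ).real Set.univ) with hB
  have hB0 : 0 ≤ B := hA0.trans (le_max_left _ _)
  refine ⟨(M⁻¹ * (C₀ * A) + B) * 3 ^ β, by positivity, fun R hR r r' har har' z hD => ?_⟩
  have hR0 : 0 < R := by linarith
  set D : ℝ := ‖z‖ + |r - r'| with hDdef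
  have hcomp : ∀ X, R * D / 3 ≤ X → X ^ (-β) ≤ 3 ^ β * (R * D) ^ (-β) := by
    intro X hX
    have h0 : 0 < R * D / 3 := by positivity
    refine (Real.rpow_le_rpow_of_nonpos h0 hX (by linarith)).trans (le_of_eq ?_)
    rw [Real.div_rpow (by positivity) (by norm_num), Real.rpow_neg (by norm_num : (0 : ℝ) ≤ 3),
      div_inv_eq_mul, mul_comm]
  have hfin : ∀ E X, 0 ≤ E → E ≤ M⁻¹ * (C₀ * A) + B → R * D / 3 ≤ X →
      E * R ^ (1 + η) * X ^ (-β) ≤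
        (M⁻¹ * (C₀ * A) + B) * 3 ^ β * R ^ (1 + η) * (R * D) ^ (-β) := by
    intro E X hE hEle hX
    calc E * R ^ (1 + η) * X ^ (-β)
        ≤ (M⁻¹ * (C₀ * A) + B) * R ^ (1 + η) * (3 ^ β * (R * D) ^ (-β)) := by
          have h0 : 0 < R * D / 3 := by positivity
          have : 0 ≤ X := h0.le.trans hX
          gcongr
          exact hcomp X hX
      _ = _ := by ring
  have hCA : 0 ≤ M⁻¹ * (C₀ * A) := by positivity
  rcases lt_or_ge (|r - r'| / 2) ‖z‖ with hz | hz
  · have hzpos : 0 < ‖z‖ := lt_of_le_of_lt (by positivity) hz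
    refine le_trans ?_ (hfin (M⁻¹ * (C₀ * A)) (‖z‖ * R) hCA (by linarith) (by nlinarith))
    rcases hM0.eq_or_lt with hM1 | hM1
    · have hzero : ∀ ξ, cosTransform σ ξ = 0 := fun ξ =>
        abs_nonpos_iff.1 ((abs_cosTransform_le ξ).trans hM1.symm.le)
      have : shellKernel σ R z r r' = 0 := by simp [shellKernel, hzero]
      rw [this, norm_zero]; positivity
    · have h1 := norm_shellKernel_le_of_ne hinv hsupp hdec hC₀ hβ hβm ha hR0 har har'
        (norm_pos_iff.1 hzpos)
      rw [mul_assoc, hAR R hR0] at h1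
      have hRη : R ≤ R ^ (1 + η) := by
        conv_lhs => rw [← Real.rpow_one R]
        exact Real.rpow_le_rpow_of_exponent_le hR (by linarith)
      calc ‖shellKernel σ R z r r'‖ ≤ M⁻¹ * (C₀ * (‖z‖ * R) ^ (-β) * (A * R)) := by
            rw [← div_eq_inv_mul, le_div_iff₀' hM1]; exact h1
        _ ≤ M⁻¹ * (C₀ * (‖z‖ * R) ^ (-β) * (A * R ^ (1 + η))) := by gcongr
        _ = M⁻¹ * (C₀ * A) * R ^ (1 + η) * (‖z‖ * R) ^ (-β) := by ring
  · have hδ : 0 < |r - r'| := by linarith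
    refine le_trans ?_ (hfin B (R * (|r - r'| / 2)) hB0 (by linarith) (by nlinarith))
    refine le_of_le_mul_pow_of_le (norm_nonneg _) hB0 hR (by positivity) hN1 hβ hNβ hNη ?_ ?_
    · refine (norm_shellKernel_le hdec hC₀ hm0 ha hR0 har har' z).trans ?_
      rw [hAR R hR0]
      gcongr
      exact le_max_left _ _
    · refine (norm_shellKernel_le_of_separated hinv hsupp hdecφ hR0 (ha.trans_le har)
        (ha.trans_le har') (sub_ne_zero.1 (abs_pos.1 hδ)) hz).trans ?_
      calc _ = C₁ * (σ.prod σ).real Set.univ * R ^ d * ((R * (|r - r'| / 2)) ^ N)⁻¹ := by ring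
        _ ≤ _ := by
          gcongr
          exact le_max_right _ _

end Kernel

section Frostman

lemma exists_lintegral_rpow_neg_le {X : Type*} [MeasurableSpace X] {μ : Measure X}
    [IsFiniteMeasure μ] {α β C : ℝ} (hβ : 0 < β) (hβα : β < α) :
    ∃ A : ℝ≥0∞, A ≠ ∞ ∧ ∀ D : X → ℝ, Measurable D → (∀ q, 0 ≤ D q) →
      (∀ δ, 0 < δ → μ {q | D q < δ} ≤ ENNReal.ofReal (C * δ ^ α)) →
      ∫⁻ q, ENNReal.ofReal (D q ^ (-β)) ∂μ ≤ A := by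
  let δ : ℕ → ℝ := fun k => 2 * (1 / 2) ^ k
  let b : ℕ → ℝ := fun k => ((1 / 2 : ℝ) ^ (k + 1)) ^ (-β)
  have hb : ∀ k, 0 < b k := fun k => by positivity
  refine ⟨μ Set.univ + ∑' k, ENNReal.ofReal (b k * (|C| * δ k ^ α)), ?_, ?_⟩
  · refine ENNReal.add_ne_top.2 ⟨measure_ne_top _ _, ?_⟩
    have hterm : ∀ k, b k * (|C| * δ k ^ α) =
        (1 / 2 : ℝ) ^ (-β) * (|C| * 2 ^ α) * ((1 / 2 : ℝ) ^ (α - β)) ^ k := by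
      intro k
      have h2 : (0 : ℝ) ≤ 1 / 2 := by norm_num
      have h2' : (0 : ℝ) < 1 / 2 := by norm_num
      simp only [b, δ]
      rw [pow_succ, Real.mul_rpow (by positivity) h2, Real.mul_rpow (by norm_num) (by positivity),
        ← Real.rpow_natCast, ← Real.rpow_natCast, ← Real.rpow_mul h2, ← Real.rpow_mul h2,
        ← Real.rpow_mul h2, show (α - β) * (k : ℝ) = k * (-β) + k * α by ring,
        Real.rpow_add h2']
      ring
    have hsum : Summable fun k => b k * (|C| * δ k ^ α) := by
      simp only [hterm]
      refine (summable_geometric_of_lt_one (by positivity) ?_).mul_left _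
      exact Real.rpow_lt_one (by norm_num) (by norm_num) (by linarith)
    rw [← ENNReal.ofReal_tsum_of_nonneg (fun k => by have := hb k; positivity) hsum]
    exact ENNReal.ofReal_ne_top
  · intro D hD hD0 hμ
    have hms : ∀ k, MeasurableSet {q | D q < δ k} := fun k => measurableSet_lt hD measurable_const
    have hpt : ∀ q, ENNReal.ofReal (D q ^ (-β)) ≤
        1 + ∑' k, {q | D q < δ k}.indicator (fun _ => ENNReal.ofReal (b k)) q := by
      intro q
      rcases (hD0 q).eq_or_lt with h0 | h0
      · rw [← h0, Real.zero_rpow (by linarith)]; simp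
      rcases le_or_gt 1 (D q) with h1 | h1
      · refine le_trans ?_ le_self_add
        rw [ENNReal.ofReal_le_one]
        exact Real.rpow_le_one_of_one_le_of_nonpos h1 (by linarith)
      · obtain ⟨k, hk1, hk2⟩ := exists_nat_pow_near_of_lt_one h0 h1.le
          (by norm_num : (0 : ℝ) < 1 / 2) (by norm_num)
        refine le_trans ?_ (le_add_self.trans' (ENNReal.le_tsum k))
        rw [Set.indicator_of_mem]
        · refine ENNReal.ofReal_le_ofReal ?_
          exact Real.rpow_le_rpow_of_nonpos (by positivity) hk1.le (by linarith)
        · change D q < 2 * (1 / 2) ^ k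
          have : (0 : ℝ) < (1 / 2) ^ k := by positivity
          linarith
    refine (lintegral_mono hpt).trans ?_
    rw [lintegral_add_left measurable_const, lintegral_one,
      lintegral_tsum fun k => (measurable_const.indicator (hms k)).aemeasurable]
    gcongr with k
    rw [lintegral_indicator_const (hms k), ENNReal.ofReal_mul (hb k).le]
    gcongr
    refine (hμ (δ k) (by positivity)).trans (ENNReal.ofReal_le_ofReal ?_)
    gcongr
    exact le_abs_self C

end Frostman

section AvgTransform

variable {d : ℕ} {σ : Measure (EuclideanSpace ℝ (Fin d))} [IsFiniteMeasure σ]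
  (hinv : ∀ L : EuclideanSpace ℝ (Fin d) ≃ₗᵢ[ℝ] EuclideanSpace ℝ (Fin d), MeasurePreserving L σ σ)

/-- The dual of the spherical averaging operator, applied to `ν`, on the Fourier side. -/
noncomputable def avgTransform (σ : Measure (EuclideanSpace ℝ (Fin d)))
    (ν : Measure (EuclideanSpace ℝ (Fin d) × ℝ)) (ξ : EuclideanSpace ℝ (Fin d)) : ℂ :=
  ∫ p, planeWave p.1 ξ * (cosTransform σ ((2 * Real.pi * p.2) • ξ) : ℂ) ∂ν

lemma norm_planeWave_mul_cosTransform_le (x ξ η : EuclideanSpace ℝ (Fin d)) :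
    ‖planeWave x ξ * (cosTransform σ η : ℂ)‖ ≤ σ.real Set.univ := by
  rw [norm_mul, norm_planeWave, one_mul, Complex.norm_real]
  exact abs_cosTransform_le _

variable {ν : Measure (EuclideanSpace ℝ (Fin d) × ℝ)} [IsFiniteMeasure ν]

lemma norm_avgTransform_le (ξ : EuclideanSpace ℝ (Fin d)) :
    ‖avgTransform σ ν ξ‖ ≤ σ.real Set.univ * ν.real Set.univ :=
  norm_integral_le_of_norm_le_const
    (Filter.Eventually.of_forall fun p => norm_planeWave_mul_cosTransform_le p.1 ξ _)

lemma continuous_avgTransform : Continuous (avgTransform σ ν) := by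
  have hc := continuous_cosTransform (σ := σ)
  refine continuous_of_dominated (bound := fun _ => σ.real Set.univ) (fun ξ => ?_) (fun ξ => ?_)
    (integrable_const _) ?_
  · exact Measurable.aestronglyMeasurable (Continuous.measurable (by fun_prop))
  · exact Filter.Eventually.of_forall fun p => norm_planeWave_mul_cosTransform_le p.1 ξ _
  · exact Filter.Eventually.of_forall fun p => by fun_prop

lemma integral_norm_avgTransform_sq {R : ℝ} (hR : 0 < R) :
    ((∫ ξ, ‖avgTransform σ ν ξ‖ ^ 2 ∂(shellMeasure d R) : ℝ) : ℂ) =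
      ∫ p, shellKernel σ R (p.1.1 - p.2.1) p.1.2 p.2.2 ∂(ν.prod ν) := by
  have := isFiniteMeasure_shellMeasure (d := d) hR
  have hc := continuous_cosTransform (σ := σ)
  have hsq : ∀ ξ, ((‖avgTransform σ ν ξ‖ ^ 2 : ℝ) : ℂ) = ∫ p, planeWave (p.1.1 - p.2.1) ξ *
      (cosTransform σ ((2 * Real.pi * p.1.2) • ξ) * cosTransform σ ((2 * Real.pi * p.2.2) • ξ) : ℝ)
        ∂(ν.prod ν) := by
    intro ξ
    rw [Complex.ofReal_pow, ← Complex.mul_conj', avgTransform, ← integral_conj, ← integral_prod_mul]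
    refine integral_congr_ae (Filter.Eventually.of_forall fun p => ?_)
    simp only
    rw [map_mul, conj_planeWave, Complex.conj_ofReal, sub_eq_add_neg, planeWave_add]
    push_cast; ring
  rw [← integral_complex_ofReal]
  simp only [hsq]
  unfold shellKernel
  refine integral_integral_swap (Integrable.of_bound (C := σ.real Set.univ * σ.real Set.univ)
    (Measurable.aestronglyMeasurable (Continuous.measurable (by fun_prop)))
    (Filter.Eventually.of_forall fun p => ?_))
  simp only [Function.uncurry]
  rw [norm_mul, norm_planeWave, one_mul, Complex.norm_real, norm_mul]
  exact mul_le_mul (abs_cosTransform_le _) (abs_cosTransform_le _) (norm_nonneg _)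
    measureReal_nonneg

lemma lintegral_avgTransform_sq_le {R : ℝ} (hR : 0 < R) :
    ∫⁻ ξ, ‖avgTransform σ ν ξ‖ₑ ^ 2 ∂(shellMeasure d R) ≤
      ∫⁻ p, ∫⁻ q, ‖shellKernel σ R (p.1 - q.1) p.2 q.2‖ₑ ∂ν ∂ν := by
  have := isFiniteMeasure_shellMeasure (d := d) hR
  have hF := continuous_avgTransform (σ := σ) (ν := ν)
  have hintg : Integrable (fun ξ => ‖avgTransform σ ν ξ‖ ^ 2) (shellMeasure d R) := by
    refine Integrable.of_bound (C := (σ.real Set.univ * ν.real Set.univ) ^ 2)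
      (Measurable.aestronglyMeasurable (Continuous.measurable (by fun_prop)))
      (Filter.Eventually.of_forall fun ξ => ?_)
    rw [norm_pow, norm_norm]
    gcongr
    exact norm_avgTransform_le ξ
  calc ∫⁻ ξ, ‖avgTransform σ ν ξ‖ₑ ^ 2 ∂(shellMeasure d R)
      = ENNReal.ofReal (∫ ξ, ‖avgTransform σ ν ξ‖ ^ 2 ∂(shellMeasure d R)) := by
        rw [ofReal_integral_eq_lintegral_ofReal hintg
          (Filter.Eventually.of_forall fun ξ => by positivity)]
        simp only [ENNReal.ofReal_pow (norm_nonneg _), ofReal_norm]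
    _ = ‖∫ p, shellKernel σ R (p.1.1 - p.2.1) p.1.2 p.2.2 ∂(ν.prod ν)‖ₑ := by
        rw [← integral_norm_avgTransform_sq hR, ← ofReal_norm, Complex.norm_real, Real.norm_eq_abs,
          abs_of_nonneg (integral_nonneg fun ξ => by positivity)]
    _ ≤ ∫⁻ p, ‖shellKernel σ R (p.1.1 - p.2.1) p.1.2 p.2.2‖ₑ ∂(ν.prod ν) :=
        enorm_integral_le_lintegral_enorm _
    _ ≤ _ := lintegral_prod_le _

include hinv in
lemma exists_lintegral_avgTransform_sq_le (hd : 2 ≤ d) (hsupp : ∀ᵐ y ∂σ, ‖y‖ = 1)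
    {μ : Measure (EuclideanSpace ℝ (Fin d) × ℝ)} [IsFiniteMeasure μ] {a α β C η : ℝ} (ha : 0 < a)
    (hμa : ∀ᵐ p ∂μ, a ≤ p.2)
    (hfrost : ∀ (x' : EuclideanSpace ℝ (Fin d)) (r' : ℝ), 0 < r' → ∀ δ : ℝ, 0 < δ →
      μ {p : EuclideanSpace ℝ (Fin d) × ℝ | dist p.1 x' + |p.2 - r'| < δ}
        ≤ ENNReal.ofReal (C * δ ^ α))
    (hβ : 0 < β) (hβα : β < α) (hβm : β ≤ ((d : ℝ) - 1) / 2) (hη : 0 < η) :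
    ∃ A : ℝ≥0∞, A ≠ ∞ ∧ ∀ ν ≤ μ, ∀ R, 1 ≤ R →
      ∫⁻ ξ, ‖avgTransform σ ν ξ‖ₑ ^ 2 ∂(shellMeasure d R) ≤
        A * ν Set.univ * ENNReal.ofReal (R ^ (1 + η - β)) := by
  obtain ⟨C₀, hC₀, hK⟩ := exists_shellKernel_bound hinv hd hsupp ha hβ.le hβm hη
  obtain ⟨A, hA, hAle⟩ := exists_lintegral_rpow_neg_le (μ := μ) (C := C) hβ hβα
  refine ⟨ENNReal.ofReal C₀ * A, ENNReal.mul_ne_top ENNReal.ofReal_ne_top hA,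
    fun ν hν R hR => ?_⟩
  have hR0 : 0 < R := by linarith
  have : IsFiniteMeasure ν := isFiniteMeasure_of_le μ hν
  have hD : ∀ p : EuclideanSpace ℝ (Fin d) × ℝ, Measurable
      fun q : EuclideanSpace ℝ (Fin d) × ℝ => dist q.1 p.1 + |q.2 - p.2| := fun p =>
    Continuous.measurable (by fun_prop)
  have hpos : ∀ p : EuclideanSpace ℝ (Fin d) × ℝ, 0 < p.2 →
      ∀ᵐ q ∂μ, 0 < dist q.1 p.1 + |q.2 - p.2| := by
    intro p hp
    have hlim : Filter.Tendsto (fun δ : ℝ => ENNReal.ofReal (C * δ ^ α)) (nhdsWithin 0 (Set.Ioi 0))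
        (nhds 0) := by
      have h1 : Continuous fun δ : ℝ => ENNReal.ofReal (C * δ ^ α) :=
        ENNReal.continuous_ofReal.comp
          (continuous_const.mul (Real.continuous_rpow_const (hβ.trans hβα).le))
      have h2 := h1.tendsto 0
      rw [Real.zero_rpow (hβ.trans hβα).ne', mul_zero, ENNReal.ofReal_zero] at h2
      exact h2.mono_left nhdsWithin_le_nhds
    have h0 : μ {q | ¬ 0 < dist q.1 p.1 + |q.2 - p.2|} ≤ 0 := by
      refine ge_of_tendsto hlim ?_
      filter_upwards [self_mem_nhdsWithin] with δ (hδ : 0 < δ)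
      refine (measure_mono fun q (hq : ¬ 0 < _) => ?_).trans (hfrost p.1 p.2 hp δ hδ)
      exact (not_lt.1 hq).trans_lt hδ
    exact nonpos_iff_eq_zero.1 h0
  have hinner : ∀ p : EuclideanSpace ℝ (Fin d) × ℝ, a ≤ p.2 →
      ∫⁻ q, ‖shellKernel σ R (p.1 - q.1) p.2 q.2‖ₑ ∂ν ≤
        ENNReal.ofReal C₀ * A * ENNReal.ofReal (R ^ (1 + η - β)) := by
    intro p hp
    calc ∫⁻ q, ‖shellKernel σ R (p.1 - q.1) p.2 q.2‖ₑ ∂ν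
        ≤ ∫⁻ q, ‖shellKernel σ R (p.1 - q.1) p.2 q.2‖ₑ ∂μ := lintegral_mono' hν le_rfl
      _ ≤ ∫⁻ q, ENNReal.ofReal (C₀ * R ^ (1 + η - β)) *
            ENNReal.ofReal ((dist q.1 p.1 + |q.2 - p.2|) ^ (-β)) ∂μ := by
          refine lintegral_mono_ae ?_
          filter_upwards [hμa, hpos p (ha.trans_le hp)] with q hq hq0
          have hDeq : ‖p.1 - q.1‖ + |p.2 - q.2| = dist q.1 p.1 + |q.2 - p.2| := by
            rw [abs_sub_comm, dist_comm, dist_eq_norm]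
          rw [← ofReal_norm, ← ENNReal.ofReal_mul (by positivity)]
          refine ENNReal.ofReal_le_ofReal ((hK R hR p.2 q.2 hp hq _ (hDeq ▸ hq0)).trans_eq ?_)
          rw [hDeq, Real.mul_rpow hR0.le hq0.le, ← mul_assoc, mul_assoc C₀, ← Real.rpow_add hR0]
          ring_nf
      _ ≤ ENNReal.ofReal (C₀ * R ^ (1 + η - β)) * A := by
          rw [lintegral_const_mul _ ((hD p).pow_const _).ennreal_ofReal]
          gcongr
          exact hAle _ (hD p) (fun q => by positivity)
            fun δ hδ => hfrost p.1 p.2 (ha.trans_le hp) δ hδ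
      _ = _ := by rw [ENNReal.ofReal_mul hC₀]; ring
  refine (lintegral_avgTransform_sq_le hR0).trans ?_
  calc ∫⁻ p, ∫⁻ q, ‖shellKernel σ R (p.1 - q.1) p.2 q.2‖ₑ ∂ν ∂ν
      ≤ ∫⁻ _, ENNReal.ofReal C₀ * A * ENNReal.ofReal (R ^ (1 + η - β)) ∂ν := by
        refine lintegral_mono_ae ?_
        filter_upwards [(Measure.absolutelyContinuous_of_le hν).ae_le hμa] with p hp
        exact hinner p hp
    _ = _ := by rw [lintegral_const]; ring

lemma rpow_neg_le_of_le_five_mul {T x : ℝ} (s : ℝ) (hT : 0 < T) (hTx : T ≤ x) (hx : x ≤ 5 * T) :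
    x ^ (-s) ≤ 5 ^ |s| * T ^ (-s) := by
  have h1 : 1 ≤ x / T := (one_le_div hT).2 hTx
  have h5 : x / T ≤ 5 := (div_le_iff₀ hT).2 hx
  calc x ^ (-s) = (x / T) ^ (-s) * T ^ (-s) := by
        rw [← Real.mul_rpow (by positivity) hT.le, div_mul_cancel₀ _ hT.ne']
    _ ≤ (x / T) ^ |s| * T ^ (-s) := by
        gcongr
        exact neg_le_abs s
    _ ≤ 5 ^ |s| * T ^ (-s) := by gcongr

include hinv in
lemma exists_lintegral_weight_avgTransform_sq_le (hd : 2 ≤ d) (hsupp : ∀ᵐ y ∂σ, ‖y‖ = 1)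
    {μ : Measure (EuclideanSpace ℝ (Fin d) × ℝ)} [IsFiniteMeasure μ] {a α β C η s : ℝ} (ha : 0 < a)
    (hμa : ∀ᵐ p ∂μ, a ≤ p.2)
    (hfrost : ∀ (x' : EuclideanSpace ℝ (Fin d)) (r' : ℝ), 0 < r' → ∀ δ : ℝ, 0 < δ →
      μ {p : EuclideanSpace ℝ (Fin d) × ℝ | dist p.1 x' + |p.2 - r'| < δ}
        ≤ ENNReal.ofReal (C * δ ^ α))
    (hβ : 0 < β) (hβα : β < α) (hβm : β ≤ ((d : ℝ) - 1) / 2) (hη : 0 < η)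
    (hs : 1 + η - β < 2 * s) :
    ∃ B : ℝ≥0∞, B ≠ ∞ ∧ ∀ ν ≤ μ,
      ∫⁻ ξ, ENNReal.ofReal ((1 + ‖ξ‖ ^ 2) ^ (-s)) * ‖avgTransform σ ν ξ‖ₑ ^ 2 ≤
        B * ν Set.univ := by
  obtain ⟨A, hA, hAle⟩ := exists_lintegral_avgTransform_sq_le hinv hd hsupp ha hμa hfrost hβ hβα
    hβm hη
  let U : Set (EuclideanSpace ℝ (Fin d)) := ball 0 1
  let S : ℕ → Set (EuclideanSpace ℝ (Fin d)) := fun j => {ξ | 2 ^ j ≤ ‖ξ‖ ∧ ‖ξ‖ ≤ 2 * 2 ^ j}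
  let M : ℝ≥0∞ := ENNReal.ofReal (σ.real Set.univ)
  let b : ℕ → ℝ := fun j => 5 ^ |s| * (((2 : ℝ) ^ j) ^ 2) ^ (-s) * ((2 : ℝ) ^ j) ^ (1 + η - β)
  have hb : ∀ j, b j = 5 ^ |s| * ((2 : ℝ) ^ (1 + η - β - 2 * s)) ^ j := by
    intro j
    have h2 : (0 : ℝ) ≤ 2 := by norm_num
    have h2' : (0 : ℝ) < 2 := by norm_num
    simp only [b]
    rw [← Real.rpow_natCast ((2 : ℝ) ^ j) 2, ← Real.rpow_natCast, ← Real.rpow_natCast,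
      ← Real.rpow_mul h2, ← Real.rpow_mul h2, ← Real.rpow_mul h2, ← Real.rpow_mul h2, mul_assoc,
      ← Real.rpow_add h2']
    congr 2
    push_cast; ring
  have hbsum : Summable b := by
    simp only [funext hb]
    refine (summable_geometric_of_lt_one (by positivity) ?_).mul_left _
    exact Real.rpow_lt_one_of_one_lt_of_neg (by norm_num) (by linarith)
  have hb0 : ∀ j, 0 ≤ b j := fun j => by rw [hb]; positivity
  refine ⟨ENNReal.ofReal (5 ^ |s|) * M ^ 2 * μ Set.univ * volume U +
    (∑' j, ENNReal.ofReal (b j)) * A, ?_, fun ν hν => ?_⟩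
  · have hU : volume U ≠ ∞ := measure_ball_lt_top.ne
    have hM : M ≠ ∞ := ENNReal.ofReal_ne_top
    rw [← ENNReal.ofReal_tsum_of_nonneg hb0 hbsum]
    finiteness
  have : IsFiniteMeasure ν := isFiniteMeasure_of_le μ hν
  have hcover : (Set.univ : Set (EuclideanSpace ℝ (Fin d))) = U ∪ ⋃ j, S j := by
    refine (Set.eq_univ_of_forall fun ξ => ?_).symm
    rcases lt_or_ge ‖ξ‖ 1 with h | h
    · exact Or.inl (mem_ball_zero_iff.2 h)
    · obtain ⟨j, hj1, hj2⟩ := exists_nat_pow_near h one_lt_two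
      refine Or.inr (Set.mem_iUnion.2 ⟨j, hj1, ?_⟩)
      rw [pow_succ'] at hj2
      exact hj2.le
  let G : EuclideanSpace ℝ (Fin d) → ℝ≥0∞ := fun ξ =>
    ENNReal.ofReal ((1 + ‖ξ‖ ^ 2) ^ (-s)) * ‖avgTransform σ ν ξ‖ₑ ^ 2
  have hball : ∫⁻ ξ in U, G ξ ≤
      ENNReal.ofReal (5 ^ |s|) * M ^ 2 * μ Set.univ * volume U * ν Set.univ := by
    have hF : ∀ ξ, ‖avgTransform σ ν ξ‖ₑ ≤ M * ν Set.univ := by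
      intro ξ
      rw [← ofReal_norm, ← ofReal_measureReal (μ := ν),
        ← ENNReal.ofReal_mul measureReal_nonneg]
      exact ENNReal.ofReal_le_ofReal (norm_avgTransform_le ξ)
    calc ∫⁻ ξ in U, G ξ
        ≤ ∫⁻ _ in U, ENNReal.ofReal (5 ^ |s|) * (M * ν Set.univ) ^ 2 := by
          refine setLIntegral_mono measurable_const fun ξ hξ => ?_
          have hξ1 : ‖ξ‖ < 1 := mem_ball_zero_iff.1 hξ
          refine mul_le_mul' (ENNReal.ofReal_le_ofReal ?_) (by gcongr; exact hF ξ)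
          have := rpow_neg_le_of_le_five_mul (x := 1 + ‖ξ‖ ^ 2) s one_pos
            (by nlinarith [norm_nonneg ξ]) (by nlinarith [norm_nonneg ξ])
          rwa [Real.one_rpow, mul_one] at this
      _ = ENNReal.ofReal (5 ^ |s|) * M ^ 2 * ν Set.univ * volume U * ν Set.univ := by
          rw [setLIntegral_const]; ring
      _ ≤ _ := by gcongr
  have hshell : ∀ j, ∫⁻ ξ in S j, G ξ ≤ ENNReal.ofReal (b j) * (A * ν Set.univ) := by
    intro j
    have h2j : (1 : ℝ) ≤ 2 ^ j := one_le_pow₀ one_le_two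
    calc ∫⁻ ξ in S j, G ξ
        ≤ ∫⁻ ξ in S j, ENNReal.ofReal (5 ^ |s| * (((2 : ℝ) ^ j) ^ 2) ^ (-s)) *
            ‖avgTransform σ ν ξ‖ₑ ^ 2 := by
          refine setLIntegral_mono ?_ fun ξ hξ => ?_
          · exact measurable_const.mul
              ((continuous_avgTransform (σ := σ) (ν := ν)).enorm.measurable.pow_const 2)
          · refine mul_le_mul_left (ENNReal.ofReal_le_ofReal ?_) _
            have h1 : ((2 : ℝ) ^ j) ^ 2 ≤ ‖ξ‖ ^ 2 := by gcongr; exact hξ.1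
            have h2 : ‖ξ‖ ^ 2 ≤ (2 * 2 ^ j) ^ 2 := by gcongr; exact hξ.2
            exact rpow_neg_le_of_le_five_mul s (by positivity) (by linarith) (by nlinarith)
      _ ≤ ∫⁻ ξ, ENNReal.ofReal (5 ^ |s| * (((2 : ℝ) ^ j) ^ 2) ^ (-s)) *
            ‖avgTransform σ ν ξ‖ₑ ^ 2 ∂(shellMeasure d (2 ^ j)) :=
          lintegral_mono' (restrict_le_shellMeasure (by positivity)) le_rfl
      _ ≤ ENNReal.ofReal (5 ^ |s| * (((2 : ℝ) ^ j) ^ 2) ^ (-s)) *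
            (A * ν Set.univ * ENNReal.ofReal (((2 : ℝ) ^ j) ^ (1 + η - β))) := by
          rw [lintegral_const_mul' _ _ ENNReal.ofReal_ne_top]
          gcongr
          exact hAle ν hν _ h2j
      _ = _ := by
          rw [ENNReal.ofReal_mul (by positivity : (0 : ℝ) ≤ 5 ^ |s| * (((2 : ℝ) ^ j) ^ 2) ^ (-s))]
          ring
  calc ∫⁻ ξ, G ξ = ∫⁻ ξ in U ∪ ⋃ j, S j, G ξ := by rw [← hcover, Measure.restrict_univ]
    _ ≤ (∫⁻ ξ in U, G ξ) + ∑' j, ∫⁻ ξ in S j, G ξ :=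
        (lintegral_union_le _ _ _).trans (add_le_add_right (lintegral_iUnion_le _ _) _)
    _ ≤ ENNReal.ofReal (5 ^ |s|) * M ^ 2 * μ Set.univ * volume U * ν Set.univ +
          ∑' j, ENNReal.ofReal (b j) * (A * ν Set.univ) :=
        add_le_add hball (ENNReal.tsum_le_tsum hshell)
    _ = _ := by rw [ENNReal.tsum_mul_right]; ring

end AvgTransform

section Duality

variable {d : ℕ} {σ : Measure (EuclideanSpace ℝ (Fin d))} [IsFiniteMeasure σ]
  (hinv : ∀ L : EuclideanSpace ℝ (Fin d) ≃ₗᵢ[ℝ] EuclideanSpace ℝ (Fin d), MeasurePreserving L σ σ)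

open FourierTransform

lemma exists_schwartzMap_fourier_ofReal (f : SchwartzMap (EuclideanSpace ℝ (Fin d)) ℝ) :
    ∃ g : SchwartzMap (EuclideanSpace ℝ (Fin d)) ℂ, ⇑g = 𝓕 (fun x => (f x : ℂ)) ∧
      ∀ z, (f z : ℂ) = ∫ ξ, planeWave z ξ * g ξ := by
  let fC : SchwartzMap (EuclideanSpace ℝ (Fin d)) ℂ := f.postcompCLM Complex.ofRealCLM
  refine ⟨𝓕 fC, SchwartzMap.fourier_coe fC, fun z => ?_⟩
  have h1 : (𝓕⁻ (𝓕 fC)) z = (f z : ℂ) := by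
    rw [FourierPair.fourierInv_fourier_eq]; rfl
  rw [← h1, SchwartzMap.fourierInv_coe, Real.fourierInv_eq']
  simp only [planeWave, smul_eq_mul, real_inner_comm]

lemma integrable_rpow_mul_norm_sq (s : ℝ) (g : SchwartzMap (EuclideanSpace ℝ (Fin d)) ℂ) :
    Integrable fun ξ => (1 + ‖ξ‖ ^ 2) ^ s * ‖g ξ‖ ^ 2 := by
  obtain ⟨n, hn⟩ := exists_nat_ge s
  obtain ⟨M, hM0, hM⟩ := g.decay 0 0
  have hgM : ∀ ξ, ‖g ξ‖ ≤ M := fun ξ => by simpa using hM ξ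
  have hintg := ((g.integrable (μ := volume)).norm.add
    (g.integrable_pow_mul volume (2 * n))).const_mul (2 ^ (n - 1) * M)
  refine hintg.mono' ?_ (Filter.Eventually.of_forall fun ξ => ?_)
  · have := g.continuous
    refine Measurable.aestronglyMeasurable (Measurable.mul ?_ (by fun_prop))
    exact Measurable.pow_const (by fun_prop) _
  · have h1 : (1 : ℝ) ≤ 1 + ‖ξ‖ ^ 2 := by linarith [sq_nonneg ‖ξ‖]
    have h2 : (1 + ‖ξ‖ ^ 2) ^ s ≤ 2 ^ (n - 1) * (1 + ‖ξ‖ ^ (2 * n)) := by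
      calc (1 + ‖ξ‖ ^ 2) ^ s ≤ (1 + ‖ξ‖ ^ 2) ^ (n : ℝ) :=
            Real.rpow_le_rpow_of_exponent_le h1 hn
        _ = (1 + ‖ξ‖ ^ 2) ^ n := Real.rpow_natCast _ _
        _ ≤ 2 ^ (n - 1) * (1 ^ n + (‖ξ‖ ^ 2) ^ n) := add_pow_le zero_le_one (sq_nonneg _) n
        _ = _ := by rw [one_pow, ← pow_mul]
    rw [Real.norm_of_nonneg (by positivity)]
    calc (1 + ‖ξ‖ ^ 2) ^ s * ‖g ξ‖ ^ 2
        ≤ 2 ^ (n - 1) * (1 + ‖ξ‖ ^ (2 * n)) * (M * ‖g ξ‖) := by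
          rw [sq ‖g ξ‖]
          gcongr
          exact hgM ξ
      _ = _ := by simp only [Pi.add_apply]; ring

include hinv in
lemma integral_comp_sub_smul {f : EuclideanSpace ℝ (Fin d) → ℝ}
    {g : SchwartzMap (EuclideanSpace ℝ (Fin d)) ℂ}
    (hfg : ∀ z, (f z : ℂ) = ∫ ξ, planeWave z ξ * g ξ) (x : EuclideanSpace ℝ (Fin d)) (r : ℝ) :
    ((∫ y, f (x - r • y) ∂σ : ℝ) : ℂ) =
      ∫ ξ, planeWave x ξ * cosTransform σ ((2 * Real.pi * r) • ξ) * g ξ := by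
  have hg := g.continuous
  rw [← integral_complex_ofReal]
  simp only [hfg]
  rw [integral_integral_swap]
  · refine integral_congr_ae (Filter.Eventually.of_forall fun ξ => ?_)
    have h1 : ∀ y : EuclideanSpace ℝ (Fin d), planeWave (x - r • y) ξ =
        planeWave x ξ * planeWave ((-r) • y) ξ := fun y => by
      rw [← planeWave_add, neg_smul, sub_eq_add_neg]
    simp only [h1]
    rw [integral_mul_const, integral_const_mul, integral_planeWave_smul hinv,
      cosTransform_eq_of_norm_eq hinv (η := (2 * Real.pi * r) • ξ)]
    rw [mul_neg, neg_smul, norm_neg]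
  · refine (((g.integrable (μ := volume)).norm).comp_snd σ).mono'
      (Measurable.aestronglyMeasurable (Continuous.measurable (by fun_prop)))
      (Filter.Eventually.of_forall fun p => ?_)
    simp only [Function.uncurry]
    rw [norm_mul, norm_planeWave, one_mul]

include hinv in
lemma integral_integral_comp_sub_smul {f : EuclideanSpace ℝ (Fin d) → ℝ}
    {g : SchwartzMap (EuclideanSpace ℝ (Fin d)) ℂ}
    (hfg : ∀ z, (f z : ℂ) = ∫ ξ, planeWave z ξ * g ξ)
    {ν : Measure (EuclideanSpace ℝ (Fin d) × ℝ)} [IsFiniteMeasure ν] :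
    ((∫ p, ∫ y, f (p.1 - p.2 • y) ∂σ ∂ν : ℝ) : ℂ) = ∫ ξ, avgTransform σ ν ξ * g ξ := by
  have hg := g.continuous
  have hc := continuous_cosTransform (σ := σ)
  rw [← integral_complex_ofReal]
  simp only [integral_comp_sub_smul hinv hfg]
  rw [integral_integral_swap]
  · refine integral_congr_ae (Filter.Eventually.of_forall fun ξ => ?_)
    simp only
    rw [integral_mul_const, avgTransform]
  · refine ((((g.integrable (μ := volume)).norm).comp_snd ν).const_mul (σ.real Set.univ)).mono'
      (Measurable.aestronglyMeasurable (Continuous.measurable (by fun_prop)))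
      (Filter.Eventually.of_forall fun p => ?_)
    simp only [Function.uncurry]
    rw [norm_mul]
    gcongr
    exact norm_planeWave_mul_cosTransform_le _ _ _

include hinv in
lemma enorm_integral_integral_sq_le (s : ℝ) (f : SchwartzMap (EuclideanSpace ℝ (Fin d)) ℝ)
    {ν : Measure (EuclideanSpace ℝ (Fin d) × ℝ)} [IsFiniteMeasure ν] :
    ‖∫ p, ∫ y, f (p.1 - p.2 • y) ∂σ ∂ν‖ₑ ^ 2 ≤ ENNReal.ofReal (sobolevNorm s f ^ 2) *
      ∫⁻ ξ, ENNReal.ofReal ((1 + ‖ξ‖ ^ 2) ^ (-s)) * ‖avgTransform σ ν ξ‖ₑ ^ 2 := by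
  obtain ⟨g, hg, hfg⟩ := exists_schwartzMap_fourier_ofReal f
  have hgc := g.continuous
  have hF := continuous_avgTransform (σ := σ) (ν := ν)
  have hw : ∀ (c : ℝ) (ξ : EuclideanSpace ℝ (Fin d)), 0 < (1 + ‖ξ‖ ^ 2) ^ c := fun c ξ => by
    positivity
  have hwm : ∀ c : ℝ, Measurable fun ξ : EuclideanSpace ℝ (Fin d) =>
      ENNReal.ofReal ((1 + ‖ξ‖ ^ 2) ^ c) := fun c =>
    (Measurable.pow_const (by fun_prop) c).ennreal_ofReal
  have hwsq : ∀ (c : ℝ) (ξ : EuclideanSpace ℝ (Fin d)),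
      ENNReal.ofReal ((1 + ‖ξ‖ ^ 2) ^ (c / 2)) ^ 2 = ENNReal.ofReal ((1 + ‖ξ‖ ^ 2) ^ c) := by
    intro c ξ
    rw [← ENNReal.ofReal_pow (hw _ ξ).le, ← Real.rpow_natCast, ← Real.rpow_mul (by positivity)]
    congr 2
    push_cast; ring
  have hnorm : ∫⁻ ξ, ENNReal.ofReal ((1 + ‖ξ‖ ^ 2) ^ s) * ‖g ξ‖ₑ ^ 2 =
      ENNReal.ofReal (sobolevNorm s f ^ 2) := by
    have h0 : ∀ ξ, 0 ≤ (1 + ‖ξ‖ ^ 2) ^ s * ‖g ξ‖ ^ 2 := fun ξ => by positivity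
    rw [sobolevNorm, ← hg, ← Real.sqrt_eq_rpow, Real.sq_sqrt (integral_nonneg h0),
      ofReal_integral_eq_lintegral_ofReal (integrable_rpow_mul_norm_sq s g)
        (Filter.Eventually.of_forall h0)]
    refine lintegral_congr fun ξ => ?_
    rw [ENNReal.ofReal_mul (hw s ξ).le, ENNReal.ofReal_pow (norm_nonneg _), ofReal_norm]
  have hCS := ENNReal.lintegral_mul_le_Lp_mul_Lq volume Real.HolderConjugate.two_two
    (f := fun ξ => ENNReal.ofReal ((1 + ‖ξ‖ ^ 2) ^ (s / 2)) * ‖g ξ‖ₑ)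
    (g := fun ξ => ENNReal.ofReal ((1 + ‖ξ‖ ^ 2) ^ (-s / 2)) * ‖avgTransform σ ν ξ‖ₑ)
    ((hwm _).mul hgc.enorm.measurable).aemeasurable
    ((hwm _).mul hF.enorm.measurable).aemeasurable
  simp only [Pi.mul_apply, ENNReal.rpow_two, mul_pow, hwsq, hnorm] at hCS
  have hle : ‖∫ p, ∫ y, f (p.1 - p.2 • y) ∂σ ∂ν‖ₑ ≤
      ENNReal.ofReal (sobolevNorm s f ^ 2) ^ ((1 : ℝ) / 2) *
        (∫⁻ ξ, ENNReal.ofReal ((1 + ‖ξ‖ ^ 2) ^ (-s)) * ‖avgTransform σ ν ξ‖ₑ ^ 2) ^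
          ((1 : ℝ) / 2) := by
    refine le_trans ?_ hCS
    rw [← ofReal_norm, ← Complex.norm_real, integral_integral_comp_sub_smul hinv hfg, ofReal_norm]
    refine (enorm_integral_le_lintegral_enorm _).trans_eq (lintegral_congr fun ξ => ?_)
    have h1 : ENNReal.ofReal ((1 + ‖ξ‖ ^ 2) ^ (s / 2)) *
        ENNReal.ofReal ((1 + ‖ξ‖ ^ 2) ^ (-s / 2)) = 1 := by
      rw [← ENNReal.ofReal_mul (hw _ ξ).le, ← Real.rpow_add (by positivity),
        show s / 2 + -s / 2 = 0 by ring, Real.rpow_zero, ENNReal.ofReal_one]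
    rw [enorm_mul, mul_mul_mul_comm, h1, one_mul, mul_comm]
  refine (pow_le_pow_left' hle 2).trans_eq ?_
  rw [← ENNReal.mul_rpow_of_nonneg _ _ (by norm_num), ← ENNReal.rpow_natCast, ← ENNReal.rpow_mul]
  norm_num

end Duality

section WeakType

lemma sq_mul_measure_lt_le {X : Type*} [MeasurableSpace X] {μ : Measure X} [IsFiniteMeasure μ]
    {h : X → ℝ} (hm : Measurable h) (hi : Integrable h μ) {Q : ℝ≥0∞}
    (hQ : ∀ ν ≤ μ, ‖∫ p, h p ∂ν‖ₑ ^ 2 ≤ Q * ν Set.univ) {t : ℝ} (ht : 0 < t) :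
    ENNReal.ofReal t ^ 2 * μ {p | t < h p} ≤ Q := by
  set E : Set X := {p | t < h p} with hE
  have hEm : MeasurableSet E := measurableSet_lt measurable_const hm
  have h1 : ENNReal.ofReal t * μ E ≤ ‖∫ p in E, h p ∂μ‖ₑ := by
    have h0 : 0 ≤ᵐ[μ.restrict E] h :=
      (ae_restrict_mem hEm).mono fun p (hp : t < h p) => (ht.trans hp).le
    calc ENNReal.ofReal t * μ E = ∫⁻ _ in E, ENNReal.ofReal t ∂μ := (setLIntegral_const _ _).symm
      _ ≤ ∫⁻ p in E, ENNReal.ofReal (h p) ∂μ :=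
          setLIntegral_mono hm.ennreal_ofReal fun p (hp : t < h p) =>
            ENNReal.ofReal_le_ofReal hp.le
      _ = ENNReal.ofReal (∫ p in E, h p ∂μ) :=
          (ofReal_integral_eq_lintegral_ofReal hi.restrict h0).symm
      _ ≤ _ := Real.ofReal_le_enorm _
  have h2 := hQ (μ.restrict E) Measure.restrict_le_self
  rw [Measure.restrict_apply_univ] at h2
  rcases eq_or_ne (μ E) 0 with hμ | hμ
  · rw [hμ, mul_zero]; exact zero_le
  · refine (ENNReal.mul_le_mul_iff_left hμ (measure_ne_top μ E)).1 ?_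
    calc ENNReal.ofReal t ^ 2 * μ E * μ E = (ENNReal.ofReal t * μ E) ^ 2 := by ring
      _ ≤ _ := (pow_le_pow_left' h1 2).trans h2

lemma continuous_integral_comp_sub_smul {d : ℕ} {σ : Measure (EuclideanSpace ℝ (Fin d))}
    [IsFiniteMeasure σ] (f : SchwartzMap (EuclideanSpace ℝ (Fin d)) ℝ) :
    Continuous fun p : EuclideanSpace ℝ (Fin d) × ℝ => ∫ y, f (p.1 - p.2 • y) ∂σ := by
  obtain ⟨M, -, hM⟩ := f.decay 0 0
  have hf := f.continuous
  refine continuous_of_dominated (bound := fun _ => M) (fun p => ?_) (fun p => ?_)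
    (integrable_const _) ?_
  · exact Measurable.aestronglyMeasurable (Continuous.measurable (by fun_prop))
  · exact Filter.Eventually.of_forall fun y => by simpa using hM (p.1 - p.2 • y)
  · exact Filter.Eventually.of_forall fun y => by fun_prop

lemma norm_integral_comp_sub_smul_le {d : ℕ} {σ : Measure (EuclideanSpace ℝ (Fin d))}
    [IsFiniteMeasure σ] (f : SchwartzMap (EuclideanSpace ℝ (Fin d)) ℝ) :
    ∃ M, ∀ p : EuclideanSpace ℝ (Fin d) × ℝ, ‖∫ y, f (p.1 - p.2 • y) ∂σ‖ ≤ M := by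
  obtain ⟨M, -, hM⟩ := f.decay 0 0
  exact ⟨M * σ.real Set.univ, fun p => norm_integral_le_of_norm_le_const
    (Filter.Eventually.of_forall fun y => by simpa using hM (p.1 - p.2 • y))⟩

lemma isFiniteMeasure_of_frostman {X : Type*} [PseudoMetricSpace X] [MeasurableSpace (X × ℝ)]
    {μ : Measure (X × ℝ)} {K : Set (X × ℝ)} (hK : IsCompact K) (hμK : μ Kᶜ = 0) (x₀ : X)
    {α C : ℝ}
    (hfrost : ∀ (x' : X) (r' : ℝ), 0 < r' → ∀ δ : ℝ, 0 < δ →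
      μ {p : X × ℝ | dist p.1 x' + |p.2 - r'| < δ} ≤ ENNReal.ofReal (C * δ ^ α)) :
    IsFiniteMeasure μ := by
  obtain ⟨M, hM⟩ := hK.exists_bound_of_continuousOn
    (f := fun p : X × ℝ => dist p.1 x₀ + |p.2 - 1|) (by fun_prop)
  have hsub : K ⊆ {p : X × ℝ | dist p.1 x₀ + |p.2 - 1| < |M| + 1} := fun p hp => by
    have h1 := (le_abs_self _).trans (hM p hp)
    have h2 := le_abs_self M
    change dist p.1 x₀ + |p.2 - 1| < |M| + 1
    linarith
  refine ⟨?_⟩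
  calc μ Set.univ = μ (K ∪ Kᶜ) := by rw [Set.union_compl_self]
    _ ≤ μ K + μ Kᶜ := measure_union_le _ _
    _ = μ K := by rw [hμK, add_zero]
    _ ≤ _ := (measure_mono hsub).trans (hfrost x₀ 1 one_pos _ (by positivity))
    _ < ∞ := ENNReal.ofReal_lt_top

end WeakType

/-- Theorem 5 (from [O3]): if `μ` is a nonnegative measure supported on a compact
subset of `ℝ^d × (0,∞)` with `μ(B((x',r'),δ)) ≤ C δ^α` for some `α ∈ (0,(d-1)/2)`
(balls in the metric `|x-x'| + |r-r'|`), then the weak-type `(2,∞)` bound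
`‖Sf‖_{L^{2,∞}(μ)} ≲ ‖f‖_{W^{2,(1-α)/2+ε}}` holds for Schwartz functions `f`. -/
theorem stmt_18 (d : ℕ) (hd : 2 ≤ d)
    (μ : Measure (EuclideanSpace ℝ (Fin d) × ℝ))
    (hcomp : ∃ K : Set (EuclideanSpace ℝ (Fin d) × ℝ), IsCompact K ∧
      K ⊆ {p | 0 < p.2} ∧ μ Kᶜ = 0)
    (α C : ℝ) (hα0 : 0 < α) (hα1 : α < ((d : ℝ) - 1) / 2)
    (hfrost : ∀ (x' : EuclideanSpace ℝ (Fin d)) (r' : ℝ), 0 < r' → ∀ δ : ℝ, 0 < δ →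
      μ {p : EuclideanSpace ℝ (Fin d) × ℝ | dist p.1 x' + |p.2 - r'| < δ}
        ≤ ENNReal.ofReal (C * δ ^ α))
    (ε : ℝ) (hε : 0 < ε) :
    ∃ C' > 0, ∀ f : SchwartzMap (EuclideanSpace ℝ (Fin d)) ℝ, ∀ t : ℝ, 0 < t →
      ENNReal.ofReal t *
          (μ {p : EuclideanSpace ℝ (Fin d) × ℝ | t < |sphAvg (⇑f) p.1 p.2|}) ^ ((1 : ℝ) / 2)
        ≤ ENNReal.ofReal (C' * sobolevNorm ((1 - α) / 2 + ε) (⇑f)) := by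
  obtain ⟨K, hK, hKpos, hμK⟩ := hcomp
  have := isFiniteMeasure_of_frostman hK hμK 0 hfrost
  have := isFiniteMeasure_sphMeasure hd
  obtain ⟨a, ha, haK⟩ := hK.exists_forall_le' (f := fun p => p.2) (a := 0) (by fun_prop)
    fun p hp => hKpos hp
  have hμa : ∀ᵐ p ∂μ, a ≤ p.2 := by
    have h1 : ∀ᵐ p ∂μ, p ∈ K := hμK
    exact h1.mono haK
  have hinv := measurePreserving_sphMeasure (d := d)
  have hmin : 0 < min ε α := lt_min hε hα0
  have hminε : min ε α ≤ ε := min_le_left _ _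
  have hminα : min ε α ≤ α := min_le_right _ _
  obtain ⟨B, hB, hBle⟩ := exists_lintegral_weight_avgTransform_sq_le (β := α - min ε α / 2)
    (η := ε) (s := (1 - α) / 2 + ε) hinv hd (ae_norm_eq_one_sphMeasure d) ha hμa hfrost
    (by linarith) (by linarith) (by linarith) hε (by linarith)
  refine ⟨Real.sqrt (2 * B.toReal) + 1, by positivity, fun f t ht => ?_⟩
  set N : ℝ := sobolevNorm ((1 - α) / 2 + ε) f with hN
  have hN0 : 0 ≤ N := Real.rpow_nonneg (integral_nonneg fun ξ => by positivity) _
  let h : EuclideanSpace ℝ (Fin d) × ℝ → ℝ := fun p => sphAvg f p.1 p.2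
  have hcont : Continuous h := continuous_integral_comp_sub_smul (σ := sphMeasure d) f
  have hintg : Integrable h μ := by
    obtain ⟨M, hM⟩ := norm_integral_comp_sub_smul_le (σ := sphMeasure d) f
    exact Integrable.of_bound hcont.measurable.aestronglyMeasurable M
      (Filter.Eventually.of_forall hM)
  have hQ : ∀ ν ≤ μ, ‖∫ p, h p ∂ν‖ₑ ^ 2 ≤ ENNReal.ofReal (N ^ 2) * B * ν Set.univ := by
    intro ν hν
    have : IsFiniteMeasure ν := isFiniteMeasure_of_le μ hν
    rw [mul_assoc]
    exact (enorm_integral_integral_sq_le hinv _ f).trans (mul_le_mul_right (hBle ν hν) _)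
  have hpos := sq_mul_measure_lt_le hcont.measurable hintg hQ ht
  have hneg := sq_mul_measure_lt_le hcont.measurable.neg hintg.neg
    (Q := ENNReal.ofReal (N ^ 2) * B) (fun ν hν => by
      simp only [Pi.neg_apply]
      rw [integral_neg, enorm_neg]; exact hQ ν hν) ht
  have hsub : {p : EuclideanSpace ℝ (Fin d) × ℝ | t < |sphAvg f p.1 p.2|} ⊆
      {p | t < h p} ∪ {p | t < (-h) p} :=
    fun p (hp : t < |h p|) => lt_abs.1 hp
  have hsq : ENNReal.ofReal t ^ 2 * μ {p | t < |sphAvg f p.1 p.2|} ≤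
      ENNReal.ofReal (2 * B.toReal * N ^ 2) := by
    calc _ ≤ ENNReal.ofReal t ^ 2 * (μ {p | t < h p} + μ {p | t < (-h) p}) := by
          gcongr
          exact (measure_mono hsub).trans (measure_union_le _ _)
      _ ≤ ENNReal.ofReal (N ^ 2) * B + ENNReal.ofReal (N ^ 2) * B := by
          rw [mul_add]; exact add_le_add hpos hneg
      _ = _ := by
          rw [ENNReal.ofReal_mul (by positivity), ENNReal.ofReal_mul zero_le_two,
            ENNReal.ofReal_toReal hB, ENNReal.ofReal_ofNat]
          ring
  calc ENNReal.ofReal t * μ {p | t < |sphAvg f p.1 p.2|} ^ ((1 : ℝ) / 2)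
      = (ENNReal.ofReal t ^ 2 * μ {p | t < |sphAvg f p.1 p.2|}) ^ ((1 : ℝ) / 2) := by
        rw [ENNReal.mul_rpow_of_nonneg _ _ (by norm_num), ← ENNReal.rpow_natCast,
          ← ENNReal.rpow_mul]
        norm_num
    _ ≤ ENNReal.ofReal (2 * B.toReal * N ^ 2) ^ ((1 : ℝ) / 2) := by gcongr
    _ = ENNReal.ofReal (Real.sqrt (2 * B.toReal) * N) := by
        rw [ENNReal.ofReal_rpow_of_nonneg (by positivity) (by norm_num), ← Real.sqrt_eq_rpow,
          Real.sqrt_mul (by positivity), Real.sqrt_sq hN0]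
    _ ≤ ENNReal.ofReal ((Real.sqrt (2 * B.toReal) + 1) * N) := by
        gcongr
        linarith
end
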